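/- arXiv:1303.6341 — 2 statements merged into one kernel-verified Lean document; each statement's English description precedes it below -/
import Mathlib

section
/- Let n ≥ 1 and let μ : NC_n → ℂ satisfy Σ_{π∈NC_n} μ_π = 1 and the stationarity system, and assume μ is the unique such vector (i.e., every v : NC_n → ℂ with Σ_π v_π = 1 satisfying the stationarity system equals μ). Then for every wheel polynomial p of order n, p(1,1,…,1) = ASM(n) · Σ_{π∈NC_n} μ_π · p(π); that is, the evaluation-at-(1,…,1) functional equals ASM(n) times the μ-weighted combination of the π-evaluation functionals. -/
open scoped BigOperators

open MvPolynomial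

attribute [local instance 10] Classical.propDecidable

/-- A noncrossing matching of order `n`, on the points `0, …, 2n-1`
(representing the 1-indexed points `1, …, 2n`): a fixed-point-free involution
with no crossing `a < b < c < d`, `f a = c`, `f b = d`. -/
structure NCM (n : ℕ) where
  f : Fin (2 * n) → Fin (2 * n)
  invol : ∀ k, f (f k) = k
  nofix : ∀ k, f k ≠ k
  noncross : ∀ a b c d : Fin (2 * n), a < b → b < c → c < d → f a = c → f b = d → False

theorem NCM.ext' {n : ℕ} {π σ : NCM n} (h : π.f = σ.f) : π = σ := by
  cases π; cases σ; simpa using h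

noncomputable instance {n : ℕ} : Fintype (NCM n) :=
  Fintype.ofInjective NCM.f fun _ _ h => NCM.ext' h

/-- `q = e^{2πi/3}`. -/
noncomputable def q : ℂ := Complex.exp (2 * Real.pi * Complex.I / 3)

/-- A wheel polynomial of order `n`: homogeneous of total degree `n(n-1)` and
vanishing under every substitution `z_j := q² z_i`, `z_k := q⁴ z_i` for `i < j < k`. -/
def IsWheel (n : ℕ) (p : MvPolynomial (Fin (2 * n)) ℂ) : Prop :=
  p.IsHomogeneous (n * (n - 1)) ∧
  ∀ i j k : Fin (2 * n), i < j → j < k →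
    (aeval fun l : Fin (2 * n) =>
      if l = j then C (q ^ 2) * X i
      else if l = k then C (q ^ 4) * X i
      else (X l : MvPolynomial (Fin (2 * n)) ℂ)) p = 0

/-- The `π`-evaluation `p(π) = p(q^{-π_1}, …, q^{-π_{2n}})`, where the `k`-th coordinate
is `q⁻¹` if `π` matches `k` to the right and `q` if it matches `k` to the left. -/
noncomputable def evalNC {n : ℕ} (p : MvPolynomial (Fin (2 * n)) ℂ) (π : NCM n) : ℂ :=
  eval (fun k => if k < π.f k then q⁻¹ else q) p

/-- Evaluation of a polynomial with all variables set to `1`. -/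
noncomputable def evalOne {n : ℕ} (p : MvPolynomial (Fin (2 * n)) ℂ) : ℂ :=
  eval (fun _ => (1 : ℂ)) p

/-- The alternating sign matrix numbers `ASM(n) = ∏_{j=0}^{n-1} (3j+1)!/(n+j)!`. -/
noncomputable def ASM (n : ℕ) : ℂ :=
  ∏ j ∈ Finset.range n, ((3 * j + 1).factorial : ℂ) / ((n + j).factorial : ℂ)

/-- Cyclic successor on `Fin m`. -/
def fsucc {m : ℕ} (k : Fin m) : Fin m := ⟨((k : ℕ) + 1) % m, Nat.mod_lt _ k.pos⟩

/-- The Temperley–Lieb operator `e_k` (underlying function on points): if `π` matches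
`k` with `k+1` it is `π`; otherwise it matches `k ↔ k+1`, `π(k) ↔ π(k+1)` and agrees
with `π` elsewhere (indices cyclic modulo `2n`). -/
def eRaw {n : ℕ} (k : Fin (2 * n)) (π : NCM n) : Fin (2 * n) → Fin (2 * n) :=
  if π.f k = fsucc k then π.f
  else fun m =>
    if m = k then fsucc k
    else if m = fsucc k then k
    else if m = π.f k then π.f (fsucc k)
    else if m = π.f (fsucc k) then π.f k
    else π.f m

/-- The stationarity linear system `2n·v_π = Σ_{k=1}^{2n} Σ_{π' : e_k(π') = π} v_{π'}`. -/
def Stationary {n : ℕ} (v : NCM n → ℂ) : Prop :=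
  ∀ π : NCM n, ((2 * n : ℕ) : ℂ) * v π =
    ∑ k : Fin (2 * n), ∑ π' : NCM n, if eRaw k π' = π.f then v π' else 0

namespace WheelProof

lemma q_cube : q ^ 3 = 1 := by
  unfold q
  rw [← Complex.exp_nat_mul]
  rw [Complex.exp_eq_one_iff]
  exact ⟨1, by push_cast; ring⟩

lemma q_ne_one : q ≠ 1 := by
  unfold q
  intro h
  rw [Complex.exp_eq_one_iff] at h
  obtain ⟨m, hm⟩ := h
  have h2 : (2 * Real.pi * Complex.I : ℂ) ≠ 0 := Complex.two_pi_I_ne_zero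
  have h3 : (2 * Real.pi * Complex.I : ℂ) * (1 - 3 * m) = 0 := by
    linear_combination 3 * hm
  rcases mul_eq_zero.1 h3 with h4 | h4
  · exact h2 h4
  · have : (1 : ℤ) - 3 * m = 0 := by exact_mod_cast h4
    omega

lemma q_quad : q ^ 2 + q + 1 = 0 := by
  have h : (q - 1) * (q ^ 2 + q + 1) = 0 := by linear_combination q_cube
  rcases mul_eq_zero.1 h with h | h
  · exact absurd (sub_eq_zero.1 h) q_ne_one
  · exact h

lemma q_ne_zero : q ≠ 0 := by
  intro h
  have := q_cube
  rw [h] at this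
  norm_num at this

lemma q_inv : q⁻¹ = q ^ 2 := by
  field_simp [q_ne_zero]
  exact q_cube.symm

lemma q_four : q ^ 4 = q := by linear_combination q * q_cube

lemma q_sq_ne_one : q ^ 2 ≠ 1 := by
  intro h
  apply q_ne_one
  linear_combination q_cube - q * h

lemma q_sq_ne_q : q ^ 2 ≠ q := by
  intro h
  apply q_ne_one
  have : q * (q - 1) = 0 := by linear_combination h
  rcases mul_eq_zero.1 this with h | h
  · exact absurd h q_ne_zero
  · exact sub_eq_zero.1 h

lemma norm_q : ‖q‖ = 1 := by
  have h : ‖q‖ ^ 3 = 1 := by rw [← norm_pow, q_cube, norm_one]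
  exact (pow_eq_one_iff_of_nonneg (norm_nonneg _) (by norm_num)).1 h

/-! ### General facts on polynomials -/

section General
variable {σ τ : Type*}

lemma eval_aeval' (g : σ → MvPolynomial τ ℂ) (f : MvPolynomial σ ℂ) (z : τ → ℂ) :
    eval z (aeval g f) = eval (fun l => eval z (g l)) f := by
  have : (eval z).comp ((aeval g : MvPolynomial σ ℂ →ₐ[ℂ] MvPolynomial τ ℂ) : MvPolynomial σ ℂ →+* MvPolynomial τ ℂ)
      = eval (fun l => eval z (g l)) := by
    apply MvPolynomial.ringHom_ext
    · intro r; simp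
    · intro i; simp
  exact RingHom.congr_fun this f

lemma aeval_eq_zero_iff (g : σ → MvPolynomial τ ℂ) (f : MvPolynomial σ ℂ) :
    aeval g f = 0 ↔ ∀ z, eval (fun l => eval z (g l)) f = 0 := by
  constructor
  · intro h z
    rw [← eval_aeval', h, map_zero]
  · intro h
    apply MvPolynomial.funext
    intro z
    rw [eval_aeval', h, map_zero]

lemma dvd_of_aeval_update [DecidableEq σ] (m : σ) (h f : MvPolynomial σ ℂ)
    (hf : aeval (Function.update X m h) f = 0) : (X m - h) ∣ f := by
  have key : (Ideal.Quotient.mkₐ ℂ (Ideal.span {X m - h})).comp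
      (aeval (Function.update X m h)) = Ideal.Quotient.mkₐ ℂ (Ideal.span {X m - h}) := by
    apply MvPolynomial.algHom_ext
    intro i
    simp only [AlgHom.comp_apply, aeval_X]
    by_cases hi : i = m
    · subst hi
      simp only [Function.update_self, Ideal.Quotient.mkₐ_eq_mk]
      symm
      rw [Ideal.Quotient.mk_eq_mk_iff_sub_mem]
      exact Ideal.subset_span rfl
    · rw [Function.update_of_ne hi]
  have h2 := AlgHom.congr_fun key f
  simp only [AlgHom.comp_apply, hf, map_zero, Ideal.Quotient.mkₐ_eq_mk] at h2
  have h3 := Ideal.Quotient.eq_zero_iff_mem.1 h2.symm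
  exact Ideal.mem_span_singleton.1 h3

lemma prod_dvd_of_forall {ι : Type*} [DecidableEq ι] (s : Finset ι) (l : ι → MvPolynomial σ ℂ)
    (g : ι → σ → MvPolynomial σ ℂ)
    (hdvd : ∀ i ∈ s, ∀ f, aeval (g i) f = 0 → l i ∣ f)
    (hne : ∀ i ∈ s, ∀ j ∈ s, i ≠ j → aeval (g i) (l j) ≠ 0)
    (f : MvPolynomial σ ℂ) (hf : ∀ i ∈ s, aeval (g i) f = 0) :
    (∏ i ∈ s, l i) ∣ f := by
  induction s using Finset.induction_on with
  | empty => simp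
  | insert a s ha ih =>
    obtain ⟨φ, hφ⟩ := ih (fun i hi => hdvd i (Finset.mem_insert_of_mem hi))
      (fun i hi j hj => hne i (Finset.mem_insert_of_mem hi) j (Finset.mem_insert_of_mem hj))
      (fun i hi => hf i (Finset.mem_insert_of_mem hi))
    have h1 := hf a (Finset.mem_insert_self _ _)
    rw [hφ, map_mul, map_prod] at h1
    have h2 : aeval (g a) φ = 0 := by
      rcases mul_eq_zero.1 h1 with h | h
      · exfalso
        obtain ⟨j, hj, hj0⟩ := Finset.prod_eq_zero_iff.1 h
        exact hne a (Finset.mem_insert_self _ _) j (Finset.mem_insert_of_mem hj)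
          (fun e => ha (e ▸ hj)) hj0
      · exact h
    obtain ⟨ψ, hψ⟩ := hdvd a (Finset.mem_insert_self _ _) φ h2
    rw [Finset.prod_insert ha]
    exact ⟨ψ, by rw [hφ, hψ]; ring⟩

lemma totalDegree_prod_of_ne {ι : Type*} (s : Finset ι) (l : ι → MvPolynomial σ ℂ)
    (hl : ∀ i ∈ s, l i ≠ 0) : (∏ i ∈ s, l i).totalDegree = ∑ i ∈ s, (l i).totalDegree := by
  classical
  induction s using Finset.induction_on with
  | empty => simp
  | insert a s ha ih =>
    rw [Finset.prod_insert ha, Finset.sum_insert ha, totalDegree_mul_of_isDomain,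
      ih (fun i hi => hl i (Finset.mem_insert_of_mem hi))]
    · exact hl a (Finset.mem_insert_self _ _)
    · exact Finset.prod_ne_zero_iff.2 (fun i hi => hl i (Finset.mem_insert_of_mem hi))

lemma totalDegree_aeval_le (g : σ → MvPolynomial τ ℂ) (hg : ∀ i, (g i).totalDegree ≤ 1)
    (f : MvPolynomial σ ℂ) : (aeval g f).totalDegree ≤ f.totalDegree := by
  classical
  rw [aeval_def, eval₂_eq]
  apply totalDegree_finsetSum_le
  intro d hd
  refine (totalDegree_mul _ _).trans ?_
  have h1 : (algebraMap ℂ (MvPolynomial τ ℂ) (coeff d f)).totalDegree = 0 := by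
    rw [MvPolynomial.algebraMap_eq, totalDegree_C]
  rw [h1, zero_add]
  refine (totalDegree_finsetProd _ _).trans ?_
  refine le_trans ?_ (le_totalDegree hd)
  rw [Finsupp.sum]
  apply Finset.sum_le_sum
  intro i _
  refine (totalDegree_pow _ _).trans ?_
  calc d i * (g i).totalDegree ≤ d i * 1 := Nat.mul_le_mul_left _ (hg i)
    _ = d i := mul_one _

lemma one_le_totalDegree_of_ne (f : MvPolynomial σ ℂ) (y z : σ → ℂ) (h : eval y f ≠ eval z f) :
    1 ≤ f.totalDegree := by
  by_contra hc
  have h0 : f.totalDegree = 0 := by omega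
  rw [totalDegree_eq_zero_iff_eq_C] at h0
  rw [h0] at h
  simp at h

lemma eval_smul_of_homog {d : ℕ} (f : MvPolynomial σ ℂ) (hf : f.IsHomogeneous d) (c : ℂ)
    (z : σ → ℂ) : eval (fun i => c * z i) f = c ^ d * eval z f := by
  classical
  rw [eval_eq, eval_eq, Finset.mul_sum]
  apply Finset.sum_congr rfl
  intro m hm
  have := hf (mem_support_iff.1 hm)
  have h2 : ∑ i ∈ m.support, m i = d := by
    rw [← this, Finsupp.weight_apply, Finsupp.sum]; simp
  simp_rw [mul_pow]
  rw [Finset.prod_mul_distrib, Finset.prod_pow_eq_pow_sum, h2]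
  ring

end General

end WheelProof
namespace WheelProof

/-- wheel condition, pointwise, for the variables in `S` -/
def Wh {N : ℕ} (S : Finset (Fin N)) (f : MvPolynomial (Fin N) ℂ) : Prop :=
  ∀ i ∈ S, ∀ j ∈ S, ∀ k ∈ S, i < j → j < k → ∀ z : Fin N → ℂ,
    z j = q ^ 2 * z i → z k = q * z i → eval z f = 0

/-- substitution describing a wheel locus -/
noncomputable def wsub {N : ℕ} (i j k : Fin N) (l : Fin N) : MvPolynomial (Fin N) ℂ :=
  if l = j then C (q ^ 2) * X i else if l = k then C q * X i else X l

lemma locus_iff {N : ℕ} {i j k : Fin N} (hij : i < j) (hjk : j < k) (f : MvPolynomial (Fin N) ℂ) :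
    (∀ z : Fin N → ℂ, z j = q ^ 2 * z i → z k = q * z i → eval z f = 0) ↔
      aeval (wsub i j k) f = 0 := by
  rw [aeval_eq_zero_iff]
  constructor
  · intro h z
    apply h
    · simp [wsub, hij.ne, (hij.trans hjk).ne]
    · simp [wsub, hij.ne, (hij.trans hjk).ne, hjk.ne']
  · intro h z h1 h2
    rw [← h z]
    congr 1
    congr 1
    funext l
    unfold wsub
    split_ifs with e1 e2
    · subst e1; simp [h1]
    · subst e2; simp [h2]
    · simp

lemma wheel_iff {n : ℕ} (p : MvPolynomial (Fin (2 * n)) ℂ) :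
    IsWheel n p ↔ p.IsHomogeneous (n * (n - 1)) ∧ Wh Finset.univ p := by
  unfold IsWheel Wh
  refine and_congr Iff.rfl ?_
  constructor
  · intro h i _ j _ k _ hij hjk
    rw [locus_iff hij hjk]
    have := h i j k hij hjk
    rw [q_four] at this
    exact this
  · intro h i j k hij hjk
    have := h i (Finset.mem_univ _) j (Finset.mem_univ _) k (Finset.mem_univ _) hij hjk
    rw [locus_iff hij hjk] at this
    rw [q_four]
    exact this

lemma exists_generic {N : ℕ} {i j k : Fin N} (hij : i < j) (hjk : j < k) (R : ℝ) :
    ∃ z : Fin N → ℂ, z j = q ^ 2 * z i ∧ z k = q * z i ∧ Function.Injective z ∧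
      ∀ l, R < ‖z l‖ := by
  set t : ℝ := |R| + 1 with ht
  have htp : 0 < t := by positivity
  have htR : R < t := by have := le_abs_self R; linarith
  let y : Fin N → ℝ := fun l => ((l : ℕ) + 1 : ℝ) * t
  have yp : ∀ l, 0 < y l := fun l => by positivity
  have yR : ∀ l, R < y l := fun l => by
    have : t ≤ y l := by
      have h0 : (0:ℝ) ≤ ((l : ℕ) : ℝ) := by positivity
      simp only [y]; nlinarith
    linarith
  have yi : Function.Injective y := by
    intro a b hab
    simp only [y] at hab
    have := mul_right_cancel₀ htp.ne' hab
    have h2 : (a : ℕ) = b := by exact_mod_cast (add_right_cancel this)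
    exact Fin.ext h2
  have ik := hij.trans hjk
  let w : Fin N → ℂ := fun l => if l = j then q ^ 2 else if l = k then q else 1
  let u : Fin N → Fin N := fun l => if l = j then i else if l = k then i else l
  have wn : ∀ l, ‖w l‖ = 1 := by
    intro l; simp only [w]; split_ifs <;> simp [norm_q]
  have hz : ∀ a b, w a * (y (u a) : ℂ) = w b * (y (u b) : ℂ) → a = b := by
    intro a b hab
    have h1 : y (u a) = y (u b) := by
      have := congrArg norm hab
      rw [norm_mul, norm_mul, wn, wn, one_mul, one_mul, Complex.norm_real, Complex.norm_real,
        Real.norm_of_nonneg (yp _).le, Real.norm_of_nonneg (yp _).le] at this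
      exact this
    have h2 : w a = w b := by
      rw [h1] at hab
      exact mul_right_cancel₀ (by exact_mod_cast (yp _).ne') hab
    have h3 := yi h1
    simp only [w, u] at h2 h3
    have c1 := q_sq_ne_one
    have c2 := q_sq_ne_q
    have c3 := q_ne_one
    clear_value y
    by_cases a1 : a = j
    · by_cases b1 : b = j
      · rw [a1, b1]
      · by_cases b2 : b = k
        · rw [if_pos a1, if_neg b1, if_pos b2] at h2
          exact absurd h2 c2
        · rw [if_pos a1, if_neg b1, if_neg b2] at h2
          exact absurd h2 c1
    · by_cases a2 : a = k
      · by_cases b1 : b = j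
        · rw [if_neg a1, if_pos a2, if_pos b1] at h2
          exact absurd h2.symm c2
        · by_cases b2 : b = k
          · rw [a2, b2]
          · rw [if_neg a1, if_pos a2, if_neg b1, if_neg b2] at h2
            exact absurd h2 c3
      · by_cases b1 : b = j
        · rw [if_neg a1, if_neg a2, if_pos b1] at h2
          exact absurd h2.symm c1
        · by_cases b2 : b = k
          · rw [if_neg a1, if_neg a2, if_neg b1, if_pos b2] at h2
            exact absurd h2.symm c3
          · rw [if_neg a1, if_neg a2, if_neg b1, if_neg b2] at h3
            exact h3
  refine ⟨fun l => w l * (y (u l) : ℂ), ?_, ?_, hz, ?_⟩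
  · simp [w, u, hij.ne, ik.ne]
  · simp [w, u, hij.ne, ik.ne, hjk.ne']
  · intro l
    simp only [norm_mul, wn, one_mul, Complex.norm_real, Real.norm_of_nonneg (yp _).le]
    exact yR _

lemma locus_cancel {N : ℕ} {i j k : Fin N} (hij : i < j) (hjk : j < k)
    (f g : MvPolynomial (Fin N) ℂ)
    (h : ∀ z : Fin N → ℂ, z j = q ^ 2 * z i → z k = q * z i → eval z (f * g) = 0)
    (hf : ∃ z : Fin N → ℂ, z j = q ^ 2 * z i ∧ z k = q * z i ∧ eval z f ≠ 0) :
    ∀ z : Fin N → ℂ, z j = q ^ 2 * z i → z k = q * z i → eval z g = 0 := by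
  rw [locus_iff hij hjk] at h ⊢
  rw [map_mul] at h
  rcases mul_eq_zero.1 h with h | h
  · rw [← locus_iff hij hjk] at h
    obtain ⟨z, h1, h2, h3⟩ := hf
    exact absurd (h z h1 h2) h3
  · exact h

/-- product of the linear factors `X m - c` -/
noncomputable def linP {N : ℕ} (s : Finset (Fin N × ℂ)) : MvPolynomial (Fin N) ℂ :=
  ∏ x ∈ s, (X x.1 - C x.2)

lemma X_sub_C_ne {N : ℕ} (m : Fin N) (c : ℂ) : (X m - C c : MvPolynomial (Fin N) ℂ) ≠ 0 := by
  intro h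
  have := congrArg (eval (fun _ => c + 1)) h
  simp at this

lemma linP_ne {N : ℕ} (s : Finset (Fin N × ℂ)) : linP s ≠ 0 :=
  Finset.prod_ne_zero_iff.2 fun _ _ => X_sub_C_ne _ _

lemma card_le_linP {N : ℕ} (s : Finset (Fin N × ℂ)) : s.card ≤ (linP s).totalDegree := by
  unfold linP
  rw [totalDegree_prod_of_ne _ _ (fun _ _ => X_sub_C_ne _ _), Finset.card_eq_sum_ones]
  apply Finset.sum_le_sum
  intro x _
  apply one_le_totalDegree_of_ne _ (fun _ => x.2) (fun _ => x.2 + 1)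
  simp

lemma exists_linP {N : ℕ} (s : Finset (Fin N × ℂ)) (f : MvPolynomial (Fin N) ℂ)
    (h : ∀ x ∈ s, ∀ z : Fin N → ℂ, z x.1 = x.2 → eval z f = 0) : ∃ φ, f = linP s * φ := by
  apply prod_dvd_of_forall s (fun x => X x.1 - C x.2)
    (fun x => Function.update X x.1 (C x.2))
  · intro x _ f hf
    exact dvd_of_aeval_update _ _ _ hf
  · intro x _ y _ hxy h0
    rw [aeval_eq_zero_iff] at h0
    have := h0 (fun _ => y.2 + 1)
    by_cases hm : y.1 = x.1
    · simp only [map_sub, eval_X, eval_C, hm, Function.update_self] at this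
      exact hxy (Prod.ext hm.symm (sub_eq_zero.1 this))
    · simp [Function.update_of_ne hm] at this
  · intro x hx
    rw [aeval_eq_zero_iff]
    intro z
    apply h x hx
    simp

lemma Wh_of_linP {N : ℕ} (S : Finset (Fin N)) (s : Finset (Fin N × ℂ))
    (φ : MvPolynomial (Fin N) ℂ) (h : Wh S (linP s * φ)) : Wh S φ := by
  intro i hi j hj k hk hij hjk
  apply locus_cancel hij hjk _ _ (h i hi j hj k hk hij hjk)
  obtain ⟨z, h1, h2, -, h4⟩ := exists_generic hij hjk (∑ x ∈ s, ‖x.2‖)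
  refine ⟨z, h1, h2, ?_⟩
  unfold linP
  rw [map_prod, Finset.prod_ne_zero_iff]
  intro x hx h0
  simp only [map_sub, eval_X, eval_C] at h0
  have h5 := h4 x.1
  rw [sub_eq_zero.1 h0] at h5
  have := Finset.single_le_sum (f := fun x : Fin N × ℂ => ‖x.2‖) (fun _ _ => norm_nonneg _) hx
  linarith

/-- specialization of two variables -/
noncomputable def spec {N : ℕ} (i j : Fin N) (a b : ℂ) (f : MvPolynomial (Fin N) ℂ) :
    MvPolynomial (Fin N) ℂ :=
  aeval (Function.update (Function.update X i (C a)) j (C b)) f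

lemma eval_spec {N : ℕ} (i j : Fin N) (a b : ℂ) (f : MvPolynomial (Fin N) ℂ) (z : Fin N → ℂ) :
    eval z (spec i j a b f) = eval (Function.update (Function.update z i a) j b) f := by
  unfold spec
  rw [eval_aeval']
  congr 1
  congr 1
  funext l
  by_cases h1 : l = j
  · subst h1; simp
  · rw [Function.update_of_ne h1, Function.update_of_ne h1]
    by_cases h2 : l = i
    · subst h2; simp
    · rw [Function.update_of_ne h2, Function.update_of_ne h2]; simp

lemma totalDegree_spec_le {N : ℕ} (i j : Fin N) (a b : ℂ) (f : MvPolynomial (Fin N) ℂ) :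
    (spec i j a b f).totalDegree ≤ f.totalDegree := by
  apply totalDegree_aeval_le
  intro l
  by_cases h1 : l = j
  · subst h1; simp
  · rw [Function.update_of_ne h1]
    by_cases h2 : l = i
    · subst h2; simp
    · rw [Function.update_of_ne h2]; simp

lemma Wh_spec {N : ℕ} (S : Finset (Fin N)) (i j : Fin N) (a b : ℂ) (f : MvPolynomial (Fin N) ℂ)
    (h : Wh S f) : Wh ((S.erase i).erase j) (spec i j a b f) := by
  intro u hu v hv w hw huv hvw z h1 h2
  simp only [Finset.mem_erase] at hu hv hw
  rw [eval_spec]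
  apply h u hu.2.2 v hv.2.2 w hw.2.2 huv hvw
  · simp [Function.update_of_ne, hu.1, hv.1, hu.2.1, hv.2.1, h1]
  · simp [Function.update_of_ne, hu.1, hw.1, hu.2.1, hw.2.1, h2]

/-- vanishing on the hyperplane `z_j = q² z_i` -/
def Van {N : ℕ} (i j : Fin N) (f : MvPolynomial (Fin N) ℂ) : Prop :=
  ∀ z : Fin N → ℂ, z j = q ^ 2 * z i → eval z f = 0

lemma van_of_spec {N : ℕ} {i j : Fin N} (hij : i < j) (f : MvPolynomial (Fin N) ℂ)
    (h : ∀ a : ℂ, a ≠ 0 → spec i j a (q ^ 2 * a) f = 0) : Van i j f := by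
  have h1 : aeval (Function.update X j (C (q ^ 2) * X i)) f * X i = 0 := by
    apply MvPolynomial.funext
    intro z
    rw [map_mul, eval_aeval', eval_X, map_zero]
    by_cases hz : z i = 0
    · rw [hz, mul_zero]
    · have h2 := congrArg (eval z) (h (z i) hz)
      rw [eval_spec, map_zero, Function.update_eq_self] at h2
      rw [mul_eq_zero]; left
      rw [← h2]
      congr 1; congr 1
      funext l
      by_cases hl : l = j
      · subst hl; simp
      · simp [Function.update_of_ne hl]
  have h2 : aeval (Function.update X j (C (q ^ 2) * X i)) f = 0 := by
    rcases mul_eq_zero.1 h1 with h | h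
    · exact h
    · exact absurd h (X_ne_zero i)
  rw [aeval_eq_zero_iff] at h2
  intro z hz
  rw [← h2 z]
  congr 1; congr 1
  funext l
  by_cases hl : l = j
  · subst hl; simp [hz]
  · simp [Function.update_of_ne hl]

/-- the linear conditions satisfied by a specialization -/
lemma spec_vanish {N : ℕ} (S : Finset (Fin N)) (f : MvPolynomial (Fin N) ℂ) (hf : Wh S f)
    {i j : Fin N} (hi : i ∈ S) (hj : j ∈ S) (hij : i < j) (a : ℂ)
    (m : Fin N) (hm : m ∈ (S.erase i).erase j) (hout : m < i ∨ j < m) (z : Fin N → ℂ)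
    (hz : z m = q * a) : eval z (spec i j a (q ^ 2 * a) f) = 0 := by
  simp only [Finset.mem_erase] at hm
  rw [eval_spec]
  have hmj := hm.1
  have hmi := hm.2.1
  rcases hout with h | h
  · apply hf m hm.2.2 i hi j hj h hij
    · simp only [Function.update_of_ne hij.ne, Function.update_self, Function.update_of_ne hmj,
        Function.update_of_ne hmi, hz]
      linear_combination (-a) * q_cube
    · simp only [Function.update_self, Function.update_of_ne hmj,
        Function.update_of_ne hmi, hz]
      ring
  · apply hf i hi j hj m hm.2.2 hij h
    · simp [Function.update_of_ne hij.ne]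
    · simp [Function.update_of_ne hij.ne, Function.update_of_ne hmj,
        Function.update_of_ne hmi, hz]

lemma spec_eq_zero_or {N : ℕ} (s : Finset (Fin N × ℂ)) (f φ : MvPolynomial (Fin N) ℂ)
    (h : f = linP s * φ) (hφ : φ ≠ 0) : s.card + φ.totalDegree ≤ f.totalDegree := by
  rw [h, totalDegree_mul_of_isDomain (linP_ne s) hφ]
  have := card_le_linP s
  omega

/-- factorization in the adjacent case -/
lemma adj_factor {N : ℕ} (S : Finset (Fin N)) (f : MvPolynomial (Fin N) ℂ) (hf : Wh S f)
    {i j : Fin N} (hi : i ∈ S) (hj : j ∈ S) (hij : i < j)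
    (hadj : ∀ m ∈ S, ¬ (i < m ∧ m < j)) (a : ℂ) :
    ∃ φ, Wh ((S.erase i).erase j) φ ∧
      spec i j a (q ^ 2 * a) f = (∏ m ∈ (S.erase i).erase j, (X m - C (q * a))) * φ ∧
      (φ ≠ 0 → ((S.erase i).erase j).card + φ.totalDegree ≤ f.totalDegree) := by
  set S' := (S.erase i).erase j with hS'
  set s : Finset (Fin N × ℂ) := S'.image (fun m => (m, q * a)) with hs
  obtain ⟨φ, hφ⟩ := exists_linP s (spec i j a (q ^ 2 * a) f) (by
    intro x hx z hz
    simp only [hs, Finset.mem_image] at hx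
    obtain ⟨m, hm, rfl⟩ := hx
    have hm' := hm
    simp only [hS', Finset.mem_erase] at hm'
    apply spec_vanish S f hf hi hj hij a m hm _ z hz
    have := hadj m hm'.2.2
    rcases lt_trichotomy m i with h | h | h
    · exact Or.inl h
    · exact absurd h hm'.2.1
    · rcases lt_trichotomy m j with h' | h' | h'
      · exact absurd ⟨h, h'⟩ this
      · exact absurd h' hm'.1
      · exact Or.inr h')
  have hinj : Function.Injective (fun m : Fin N => (m, q * a)) := fun x y h => (Prod.ext_iff.1 h).1
  refine ⟨φ, ?_, ?_, ?_⟩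
  · apply Wh_of_linP S' s
    rw [← hφ]
    exact Wh_spec S i j _ _ f hf
  · rw [hφ]
    congr 1
    unfold linP
    rw [hs, Finset.prod_image (fun x _ y _ h => hinj h)]
  · intro h0
    have h1 := spec_eq_zero_or s _ φ hφ h0
    have h2 := totalDegree_spec_le i j a (q ^ 2 * a) f
    have h3 : s.card = S'.card := Finset.card_image_of_injective _ hinj
    omega

lemma card_erase2 {N : ℕ} (S : Finset (Fin N)) {i j : Fin N} (hi : i ∈ S) (hj : j ∈ S)
    (hij : i < j) {n : ℕ} (hn : S.card = 2 * (n + 1)) : ((S.erase i).erase j).card = 2 * n := by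
  rw [Finset.card_erase_of_mem, Finset.card_erase_of_mem hi, hn]
  · omega
  · exact Finset.mem_erase.2 ⟨hij.ne', hj⟩

/-- the nonadjacent case: strictly more factors -/
lemma nonadj_zero {N : ℕ} {n : ℕ} (S : Finset (Fin N)) (hn : S.card = 2 * (n + 1))
    (IH : ∀ S : Finset (Fin N), S.card = 2 * n → ∀ f, Wh S f → f ≠ 0 →
      n * (n - 1) ≤ f.totalDegree)
    (f : MvPolynomial (Fin N) ℂ) (hf : Wh S f) (hd : f.totalDegree ≤ (n + 1) * n)
    {i j m0 : Fin N} (hi : i ∈ S) (hj : j ∈ S) (hm0 : m0 ∈ S) (him : i < m0) (hmj : m0 < j)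
    (h1 : ∀ m ∈ S, i < m → m < j → Van i m f) (h2 : ∀ m ∈ S, i < m → m < j → Van m j f) :
    Van i j f := by
  have hij := him.trans hmj
  apply van_of_spec hij
  intro a ha
  set S' := (S.erase i).erase j with hS'
  let c : Fin N → ℂ := fun m => if i < m ∧ m < j then q ^ 2 * a else q * a
  set s : Finset (Fin N × ℂ) := insert (m0, a) (S'.image (fun m => (m, c m))) with hs
  obtain ⟨φ, hφ⟩ := exists_linP s (spec i j a (q ^ 2 * a) f) (by
    intro x hx z hz
    simp only [hs, Finset.mem_insert, Finset.mem_image] at hx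
    rcases hx with rfl | ⟨m, hm, rfl⟩
    · simp only at hz
      rw [eval_spec]
      apply h2 m0 hm0 him hmj
      simp [Function.update_of_ne hmj.ne, Function.update_of_ne him.ne', hz]
    · have hm' := hm
      simp only [hS', Finset.mem_erase] at hm'
      by_cases hin : i < m ∧ m < j
      · simp only [c, hin, and_self, if_true] at hz
        rw [eval_spec]
        apply h1 m hm'.2.2 hin.1 hin.2
        simp [Function.update_of_ne hm'.1, Function.update_of_ne hm'.2.1,
          Function.update_of_ne hij.ne, hz]
      · simp only [c, hin, if_false] at hz
        apply spec_vanish S f hf hi hj hij a m hm _ z hz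
        rcases lt_trichotomy m i with h | h | h
        · exact Or.inl h
        · exact absurd h hm'.2.1
        · rcases lt_trichotomy m j with h' | h' | h'
          · exact absurd ⟨h, h'⟩ hin
          · exact absurd h' hm'.1
          · exact Or.inr h')
  have hinj : Function.Injective (fun m : Fin N => (m, c m)) := fun x y h => (Prod.ext_iff.1 h).1
  have hcard : s.card = 2 * n + 1 := by
    rw [hs, Finset.card_insert_of_notMem, Finset.card_image_of_injective _ hinj, hS',
      card_erase2 S hi hj hij hn]
    intro hmem
    obtain ⟨m, -, hm⟩ := Finset.mem_image.1 hmem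
    have e1 := (Prod.ext_iff.1 hm).1
    have e2 := (Prod.ext_iff.1 hm).2
    simp only at e1 e2
    subst e1
    simp only [c, him, hmj, and_self, if_true] at e2
    have : (q ^ 2 - 1) * a = 0 := by linear_combination e2
    rcases mul_eq_zero.1 this with h | h
    · exact q_sq_ne_one (sub_eq_zero.1 h)
    · exact ha h
  by_contra hne
  have hφ0 : φ ≠ 0 := by
    rintro rfl
    rw [mul_zero] at hφ
    exact hne hφ
  have hw : Wh S' φ := by
    apply Wh_of_linP S' s
    rw [← hφ]
    exact Wh_spec S i j _ _ f hf
  have d1 := IH S' (card_erase2 S hi hj hij hn) φ hw hφ0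
  have d2 := spec_eq_zero_or s _ φ hφ hφ0
  have d3 := totalDegree_spec_le i j a (q ^ 2 * a) f
  have d4 : n * (n - 1) + 2 * n = (n + 1) * n := by
    cases n with
    | zero => simp
    | succ n => simp; ring
  omega

lemma zero_of_all_van {N : ℕ} {n : ℕ} (S : Finset (Fin N)) (hn : S.card = 2 * (n + 1))
    (f : MvPolynomial (Fin N) ℂ) (hd : f.totalDegree ≤ (n + 1) * n)
    (h : ∀ i ∈ S, ∀ j ∈ S, i < j → Van i j f) : f = 0 := by
  by_contra hf0
  set s : Finset (Fin N × Fin N) := S.offDiag.filter (fun x => x.1 < x.2) with hs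
  have hsm : ∀ x ∈ s, x.1 ∈ S ∧ x.2 ∈ S ∧ x.1 < x.2 := by
    intro x hx
    simp only [hs, Finset.mem_filter, Finset.mem_offDiag] at hx
    exact ⟨hx.1.1, hx.1.2.1, hx.2⟩
  have hlin : ∀ x ∈ s, (X x.2 - C (q ^ 2) * X x.1 : MvPolynomial (Fin N) ℂ) ≠ 0 := by
    intro x hx h0
    have := congrArg (eval (fun _ => (1:ℂ))) h0
    simp only [map_sub, map_mul, eval_X, eval_C, map_zero] at this
    apply q_sq_ne_one
    linear_combination -this
  have hdvd : (∏ x ∈ s, (X x.2 - C (q ^ 2) * X x.1)) ∣ f := by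
    apply prod_dvd_of_forall s _ (fun x => Function.update X x.2 (C (q ^ 2) * X x.1))
    · intro x _ f hf
      exact dvd_of_aeval_update _ _ _ hf
    · intro x hx y hy hxy h0
      have hx' := (hsm x hx).2.2
      have hy' := (hsm y hy).2.2
      rw [aeval_eq_zero_iff] at h0
      by_cases e2 : y.2 = x.2
      · have e1 : y.1 ≠ x.1 := fun e => hxy (Prod.ext e.symm e2.symm)
        have := h0 (Function.update 0 x.1 1)
        have hne : y.1 ≠ x.2 := fun e => by rw [e, ← e2] at hy'; exact lt_irrefl _ hy'
        simp [e2, e1, hne, Function.update_of_ne, q_ne_zero] at this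
      · by_cases e1 : y.1 = x.2
        · have hne : y.2 ≠ x.1 := fun e => by rw [e, e1] at hy'; exact absurd (hy'.trans hx') (lt_irrefl _)
          have := h0 (Function.update 0 y.2 1)
          simp [e1, e2, hne, hne.symm, Function.update_of_ne] at this
        · have := h0 (fun _ => 1)
          simp only [map_sub, map_mul, aeval_X, eval_X, eval_C, Function.update_of_ne e2,
            Function.update_of_ne e1] at this
          apply q_sq_ne_one
          linear_combination -this
    · intro x hx
      rw [aeval_eq_zero_iff]
      intro z
      obtain ⟨h1, h2, h3⟩ := hsm x hx
      apply h x.1 h1 x.2 h2 h3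
      simp [Function.update_of_ne h3.ne]
  have h1 := totalDegree_le_of_dvd_of_isDomain hdvd hf0
  rw [totalDegree_prod_of_ne _ _ hlin] at h1
  have h2 : s.card ≤ ∑ x ∈ s, (X x.2 - C (q ^ 2) * X x.1 : MvPolynomial (Fin N) ℂ).totalDegree := by
    rw [Finset.card_eq_sum_ones]
    apply Finset.sum_le_sum
    intro x hx
    apply one_le_totalDegree_of_ne _ 0 (fun _ => 1)
    simp only [map_sub, map_mul, eval_X, eval_C, Pi.zero_apply]
    intro h0
    apply q_sq_ne_one
    linear_combination h0
  have h3 : S.offDiag.card = s.card + s.card := by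
    rw [← Finset.card_filter_add_card_filter_not (s := S.offDiag) (fun x => x.1 < x.2)]
    congr 1
    apply Finset.card_bij (fun x _ => (x.2, x.1))
    · intro x hx
      simp only [hs, Finset.mem_filter, Finset.mem_offDiag] at hx ⊢
      refine ⟨⟨hx.1.2.1, hx.1.1, hx.1.2.2.symm⟩, ?_⟩
      exact lt_of_le_of_ne (not_lt.1 hx.2) hx.1.2.2.symm
    · intro x _ y _ hxy
      have := Prod.ext_iff.1 hxy
      exact Prod.ext this.2 this.1
    · intro x hx
      simp only [hs, Finset.mem_filter, Finset.mem_offDiag] at hx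
      refine ⟨(x.2, x.1), ?_, rfl⟩
      simp only [Finset.mem_filter, Finset.mem_offDiag]
      exact ⟨⟨hx.1.2.1, hx.1.1, hx.1.2.2.symm⟩, not_lt.2 hx.2.le⟩
  rw [Finset.offDiag_card, hn] at h3
  have h4 : 2 * (n + 1) * (2 * (n + 1)) - 2 * (n + 1) = 2 * ((n + 1) * n + (n + 1) * (n + 1)) := by
    rw [Nat.sub_eq_iff_eq_add]
    · ring
    · nlinarith
  rw [h4] at h3
  have h5 : 0 < (n + 1) * (n + 1) := by positivity
  omega

/-- vanishing on all adjacent hyperplanes suffices -/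
lemma zero_of_adj_van {N : ℕ} {n : ℕ} (S : Finset (Fin N)) (hn : S.card = 2 * (n + 1))
    (IH : ∀ S : Finset (Fin N), S.card = 2 * n → ∀ f, Wh S f → f ≠ 0 →
      n * (n - 1) ≤ f.totalDegree)
    (f : MvPolynomial (Fin N) ℂ) (hf : Wh S f) (hd : f.totalDegree ≤ (n + 1) * n)
    (h : ∀ i ∈ S, ∀ j ∈ S, i < j → (∀ m ∈ S, ¬ (i < m ∧ m < j)) → Van i j f) : f = 0 := by
  apply zero_of_all_van S hn f hd
  have key : ∀ d : ℕ, ∀ i ∈ S, ∀ j ∈ S, i < j → (j : ℕ) - i ≤ d → Van i j f := by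
    intro d
    induction d with
    | zero => intro i _ j _ hij hd; rw [Fin.lt_def] at hij; omega
    | succ d ih =>
      intro i hi j hj hij hd'
      by_cases hex : ∃ m ∈ S, i < m ∧ m < j
      · obtain ⟨m0, hm0, h1, h2⟩ := hex
        apply nonadj_zero S hn IH f hf hd hi hj hm0 h1 h2
        · intro m hm h3 h4
          apply ih i hi m hm h3
          rw [Fin.lt_def] at h3 h4; omega
        · intro m hm h3 h4
          apply ih m hm j hj h4
          rw [Fin.lt_def] at h3 h4; omega
      · push Not at hex
        apply h i hi j hj hij
        intro m hm h3
        exact absurd h3.2 (not_lt.2 (hex m hm h3.1))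
  intro i hi j hj hij
  exact key _ i hi j hj hij le_rfl

/-- Lemma D: minimal degree -/
theorem min_degree {N : ℕ} (n : ℕ) : ∀ S : Finset (Fin N), S.card = 2 * n → ∀ f, Wh S f → f ≠ 0 →
      n * (n - 1) ≤ f.totalDegree := by
  induction n with
  | zero => intro S _ f _ _; simp
  | succ n ih =>
    intro S hn f hf hf0
    by_contra hlt
    push Not at hlt
    simp only [Nat.add_sub_cancel] at hlt
    apply hf0
    apply zero_of_adj_van S hn ih f hf hlt.le
    intro i hi j hj hij hadj
    apply van_of_spec hij
    intro a ha
    obtain ⟨φ, h1, h2, h3⟩ := adj_factor S f hf hi hj hij hadj a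
    by_cases hφ : φ = 0
    · rw [h2, hφ, mul_zero]
    · exfalso
      have h4 := h3 hφ
      rw [card_erase2 S hi hj hij hn] at h4
      have h5 := ih _ (card_erase2 S hi hj hij hn) φ h1 hφ
      have d4 : n * (n - 1) + 2 * n = (n + 1) * n := by
        cases n with
        | zero => simp
        | succ n => simp; ring
      omega

/-- wheel polynomials of degree at most `n(n-1)` are homogeneous -/
theorem wheel_scale {N : ℕ} (n : ℕ) (S : Finset (Fin N)) (hn : S.card = 2 * n)
    (f : MvPolynomial (Fin N) ℂ) (hf : Wh S f) (hd : f.totalDegree ≤ n * (n - 1)) (c : ℂ)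
    (z : Fin N → ℂ) : eval (fun i => c * z i) f = c ^ (n * (n - 1)) * eval z f := by
  set d := n * (n - 1) with hdd
  have ev : ∀ g : MvPolynomial (Fin N) ℂ, ∀ z : Fin N → ℂ,
      eval z (aeval (fun i => C c * X i : Fin N → MvPolynomial (Fin N) ℂ) g) =
      eval (fun i => c * z i) g := by
    intro g z
    rw [eval_aeval']; simp
  set F := aeval (fun i => C c * X i : Fin N → MvPolynomial (Fin N) ℂ) f - C (c ^ d) * f with hF
  have hFW : Wh S F := by
    intro i hi j hj k hk hij hjk z h1 h2
    rw [hF, map_sub, map_mul, ev, hf i hi j hj k hk hij hjk z h1 h2,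
      hf i hi j hj k hk hij hjk]
    · ring
    · rw [h1]; ring
    · rw [h2]; ring
  have hsum : F = ∑ e ∈ Finset.range d, C (c ^ e - c ^ d) * homogeneousComponent e f := by
    have h1 : f = ∑ e ∈ Finset.range (d + 1), homogeneousComponent e f := by
      conv_lhs => rw [← sum_homogeneousComponent f]
      apply Finset.sum_subset
      · intro x hx; simp only [Finset.mem_range] at hx ⊢; omega
      · intro x _ hx2
        simp only [Finset.mem_range] at hx2
        exact homogeneousComponent_eq_zero x f (by omega)
    apply MvPolynomial.funext
    intro y
    rw [hF, map_sub, ev, map_mul, eval_C]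
    have h2 : ∀ y, eval y f = ∑ e ∈ Finset.range (d + 1), eval y (homogeneousComponent e f) := by
      intro y
      conv_lhs => rw [h1]
      rw [map_sum]
    rw [h2, h2, map_sum, Finset.mul_sum, ← Finset.sum_sub_distrib, Finset.sum_range_succ]
    have h3 : ∀ e, eval (fun i => c * y i) (homogeneousComponent e f)
        = c ^ e * eval y (homogeneousComponent e f) := fun e =>
      eval_smul_of_homog _ (homogeneousComponent_isHomogeneous e f) c y
    simp only [h3, map_mul, eval_C]
    rw [sub_self, add_zero]
    apply Finset.sum_congr rfl
    intro e _
    ring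
  have hF0 : F = 0 := by
    by_contra hne
    have h1 := min_degree n S hn F hFW hne
    rw [← hdd] at h1
    rcases Nat.eq_zero_or_pos d with h0 | h0
    · rw [h0, Finset.range_zero, Finset.sum_empty] at hsum
      exact hne hsum
    · have h2 : F.totalDegree ≤ d - 1 := by
        rw [hsum]
        apply totalDegree_finsetSum_le
        intro e he
        rw [Finset.mem_range] at he
        refine (totalDegree_mul _ _).trans ?_
        rw [totalDegree_C, zero_add]
        have := (homogeneousComponent_isHomogeneous e f).totalDegree_le
        omega
      omega
  have := congrArg (eval z) hF0
  rw [hF, map_sub, map_mul, ev, eval_C, map_zero] at this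
  exact sub_eq_zero.1 this

end WheelProof
namespace WheelProof

/-- noncrossing perfect matching on a subset -/
structure IsMatch {N : ℕ} (S : Finset (Fin N)) (g : Fin N → Fin N) : Prop where
  mem : ∀ k ∈ S, g k ∈ S
  inv : ∀ k ∈ S, g (g k) = k
  ne : ∀ k ∈ S, g k ≠ k
  nc : ∀ a ∈ S, ∀ b ∈ S, ∀ c d, a < b → b < c → c < d → g a = c → g b = d → False

/-- the evaluation point of a matching -/
noncomputable def sgn {N : ℕ} (g : Fin N → Fin N) (k : Fin N) : ℂ := if k < g k then q⁻¹ else q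

lemma sgn_ne_one {N : ℕ} (g : Fin N → Fin N) (k : Fin N) : sgn g k ≠ 1 := by
  unfold sgn
  split_ifs
  · rw [q_inv]; exact q_sq_ne_one
  · exact q_ne_one

lemma IsMatch.insert {N : ℕ} {S : Finset (Fin N)} {g : Fin N → Fin N} {i j : Fin N}
    (hi : i ∈ S) (hj : j ∈ S) (hij : i < j) (hadj : ∀ m ∈ S, ¬ (i < m ∧ m < j))
    (hg : IsMatch ((S.erase i).erase j) g) :
    IsMatch S (fun k => if k = i then j else if k = j then i else g k) := by
  have hmem : ∀ k ∈ S, k ≠ i → k ≠ j → k ∈ (S.erase i).erase j := fun k h1 h2 h3 =>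
    Finset.mem_erase.2 ⟨h3, Finset.mem_erase.2 ⟨h2, h1⟩⟩
  have hmem' : ∀ k ∈ (S.erase i).erase j, k ∈ S ∧ k ≠ i ∧ k ≠ j := by
    intro k hk
    simp only [Finset.mem_erase] at hk
    exact ⟨hk.2.2, hk.2.1, hk.1⟩
  constructor
  · intro k hk
    by_cases h1 : k = i
    · simp [h1, hj]
    · by_cases h2 : k = j
      · simp [h2, hij.ne', hi]
      · simp only [h1, h2, if_false]
        exact (hmem' _ (hg.mem k (hmem k hk h1 h2))).1
  · intro k hk
    by_cases h1 : k = i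
    · simp [h1, hij.ne']
    · by_cases h2 : k = j
      · simp [h2, hij.ne']
      · have h3 := hmem' _ (hg.mem k (hmem k hk h1 h2))
        simp only [h1, h2, if_false, h3.2.1, h3.2.2]
        exact hg.inv k (hmem k hk h1 h2)
  · intro k hk
    by_cases h1 : k = i
    · simp [h1, hij.ne']
    · by_cases h2 : k = j
      · simp [h2, hij.ne', hij.ne]
      · simp only [h1, h2, if_false]
        exact hg.ne k (hmem k hk h1 h2)
  · intro a ha b hb c d hab hbc hcd h1 h2
    by_cases a1 : a = i
    · simp only [a1, if_true] at h1
      exact hadj b hb ⟨a1 ▸ hab, h1 ▸ hbc⟩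
    · by_cases a2 : a = j
      · simp only [a2, hij.ne', if_false, if_true] at h1
        rw [a2, ] at hab
        rw [← h1] at hbc
        exact absurd (hab.trans hbc) (not_lt.2 hij.le)
      · simp only [a1, a2, if_false] at h1
        have hc := hmem' _ (hg.mem a (hmem a ha a1 a2))
        rw [h1] at hc
        by_cases b1 : b = i
        · simp only [b1, if_true] at h2
          exact hadj c hc.1 ⟨b1 ▸ hbc, h2 ▸ hcd⟩
        · by_cases b2 : b = j
          · simp only [b2, hij.ne', if_false, if_true] at h2
            rw [b2] at hbc
            rw [← h2] at hcd
            exact absurd (hbc.trans hcd) (not_lt.2 hij.le)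
          · simp only [b1, b2, if_false] at h2
            exact hg.nc a (hmem a ha a1 a2) b (hmem b hb b1 b2) c d hab hbc hcd h1 h2

lemma IsMatch.erase {N : ℕ} {S : Finset (Fin N)} {g : Fin N → Fin N} (hg : IsMatch S g)
    {i : Fin N} (hi : i ∈ S) : IsMatch ((S.erase i).erase (g i)) g := by
  have hmem' : ∀ k ∈ (S.erase i).erase (g i), k ∈ S ∧ k ≠ i ∧ k ≠ g i := by
    intro k hk
    simp only [Finset.mem_erase] at hk
    exact ⟨hk.2.2, hk.2.1, hk.1⟩
  constructor
  · intro k hk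
    obtain ⟨h1, h2, h3⟩ := hmem' k hk
    refine Finset.mem_erase.2 ⟨?_, Finset.mem_erase.2 ⟨?_, hg.mem k h1⟩⟩
    · intro h
      apply h2
      rw [← hg.inv k h1, h, hg.inv i hi]
    · intro h
      apply h3
      rw [← h, hg.inv k h1]
  · exact fun k hk => hg.inv k (hmem' k hk).1
  · exact fun k hk => hg.ne k (hmem' k hk).1
  · exact fun a ha b hb => hg.nc a (hmem' a ha).1 b (hmem' b hb).1

lemma deg_arith (n : ℕ) : n * (n - 1) + 2 * n = (n + 1) * n := by
  cases n with
  | zero => simp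
  | succ n => simp; ring

/-- Lemma V: the matching evaluations determine a wheel polynomial -/
theorem eval_determine {N : ℕ} (n : ℕ) : ∀ S : Finset (Fin N), S.card = 2 * n → ∀ f, Wh S f →
    f.totalDegree ≤ n * (n - 1) →
    (∀ g, IsMatch S g → ∀ z : Fin N → ℂ, (∀ k ∈ S, z k = sgn g k) → eval z f = 0) → f = 0 := by
  induction n with
  | zero =>
    intro S hS f _ hd h
    have hS0 : S = ∅ := by simpa using hS
    subst hS0
    have h0 : f.totalDegree = 0 := by simpa using hd
    rw [totalDegree_eq_zero_iff_eq_C] at h0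
    have := h id ⟨by simp, by simp, by simp, by simp⟩ 0 (by simp)
    rw [h0] at this
    rw [h0]
    simp only [eval_C] at this
    rw [this, map_zero]
  | succ n ih =>
    intro S hS f hf hd h
    simp only [Nat.add_sub_cancel] at hd
    apply zero_of_adj_van S hS (min_degree n) f hf hd
    intro i hi j hj hij hadj
    apply van_of_spec hij
    intro a ha
    obtain ⟨φ, h1, h2, h3⟩ := adj_factor S f hf hi hj hij hadj a
    have hc := card_erase2 S hi hj hij hS
    have hdφ : φ.totalDegree ≤ n * (n - 1) := by
      by_cases h0 : φ = 0
      · simp [h0]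
      · have := h3 h0
        have := deg_arith n
        omega
    have hφ0 : φ = 0 := by
      apply ih _ hc φ h1 hdφ
      intro g' hg' z' hz'
      have hg := hg'.insert hi hj hij hadj
      set g : Fin N → Fin N := fun k => if k = i then j else if k = j then i else g' k with hgdef
      set z : Fin N → ℂ := Function.update (Function.update z' i q⁻¹) j q with hz
      have hzs : ∀ k ∈ S, z k = sgn g k := by
        intro k hk
        by_cases k1 : k = i
        · subst k1
          simp [hz, sgn, hgdef, Function.update_of_ne hij.ne, hij]
        · by_cases k2 : k = j
          · subst k2
            simp [hz, sgn, hgdef, hij.ne', not_lt.2 hij.le]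
          · rw [hz, Function.update_of_ne k2, Function.update_of_ne k1]
            rw [hz' k (Finset.mem_erase.2 ⟨k2, Finset.mem_erase.2 ⟨k1, hk⟩⟩)]
            simp [sgn, hgdef, k1, k2]
      have e1 := h g hg z hzs
      have e2 := wheel_scale (n + 1) S hS f hf (by simpa using hd) (q * a) z
      rw [e1, mul_zero] at e2
      have e3 : eval (fun k => q * a * z' k) (spec i j a (q ^ 2 * a) f) = 0 := by
        rw [eval_spec, ← e2]
        congr 1; congr 1
        funext k
        by_cases k2 : k = j
        · subst k2
          simp [hz]; ring
        · rw [hz, Function.update_of_ne k2, Function.update_of_ne k2]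
          by_cases k1 : k = i
          · subst k1
            simp only [Function.update_self]
            have := q_ne_zero
            field_simp
          · rw [Function.update_of_ne k1, Function.update_of_ne k1]
      rw [h2, map_mul, map_prod, wheel_scale n _ hc φ h1 hdφ] at e3
      have hqa : q * a ≠ 0 := mul_ne_zero q_ne_zero ha
      rcases mul_eq_zero.1 e3 with e4 | e4
      · exfalso
        obtain ⟨m, hm, hm0⟩ := Finset.prod_eq_zero_iff.1 e4
        simp only [map_sub, eval_X, eval_C] at hm0
        apply sgn_ne_one g' m
        rw [← hz' m hm]
        have : q * a * (z' m - 1) = 0 := by linear_combination hm0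
        rcases mul_eq_zero.1 this with h | h
        · exact absurd h hqa
        · exact sub_eq_zero.1 h
      · rcases mul_eq_zero.1 e4 with h | h
        · exact absurd h (pow_ne_zero _ hqa)
        · exact h
    rw [h2, hφ0, mul_zero]

lemma exists_adj {N : ℕ} {S : Finset (Fin N)} {g : Fin N → Fin N} (hg : IsMatch S g)
    {a0 : Fin N} (ha0 : a0 ∈ S) (hmin : ∀ k ∈ S, a0 ≤ k) {m : Fin N} (hm : m ∈ S)
    (h1 : m ≠ a0) (h2 : m ≠ g a0) :
    ∃ i ∈ S, i ≠ a0 ∧ i < g i ∧ ∀ x ∈ S, ¬ (i < x ∧ x < g i) := by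
  have key : ∀ d : ℕ, ∀ i ∈ S, i ≠ a0 → i < g i → (g i : ℕ) - i ≤ d →
      ∃ i ∈ S, i ≠ a0 ∧ i < g i ∧ ∀ x ∈ S, ¬ (i < x ∧ x < g i) := by
    intro d
    induction d with
    | zero => intro i _ _ h h'; rw [Fin.lt_def] at h; omega
    | succ d ih =>
      intro i hi hia hig hd
      by_cases hex : ∃ x ∈ S, i < x ∧ x < g i
      · obtain ⟨x, hx, hx1, hx2⟩ := hex
        have hai : a0 < i := lt_of_le_of_ne (hmin i hi) (Ne.symm hia)
        -- `g x` lies inside too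
        have hgx := hg.mem x hx
        have hgxi : g x ≠ i := fun h => by
          have := hg.inv x hx; rw [h] at this; exact absurd this hx2.ne'
        have hgxj : g x ≠ g i := fun h => by
          have := hg.inv x hx; rw [h, hg.inv i hi] at this; exact absurd this hx1.ne
        have h3 : i < g x := by
          by_contra hc
          have hlt : g x < i := lt_of_le_of_ne (not_lt.1 hc) hgxi
          exact hg.nc (g x) hgx i hi x (g i) hlt hx1 hx2 (hg.inv x hx) rfl
        have h4 : g x < g i := by
          by_contra hc
          have hlt : g i < g x := lt_of_le_of_ne (not_lt.1 hc) (Ne.symm hgxj)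
          exact hg.nc i hi x hx (g i) (g x) hx1 hx2 hlt rfl rfl
        rcases lt_or_gt_of_ne (hg.ne x hx) with h | h
        · apply ih (g x) hgx (hai.trans h3).ne'
          · rw [hg.inv x hx]; exact h
          · rw [hg.inv x hx]
            rw [Fin.lt_def] at h3 hx2 h; omega
        · apply ih x hx (hai.trans hx1).ne' h
          rw [Fin.lt_def] at hx1 h4 h; omega
      · push Not at hex
        exact ⟨i, hi, hia, hig, fun x hx h => absurd h.2 (not_lt.2 (hex x hx h.1))⟩
  rcases lt_or_gt_of_ne (hg.ne m hm) with h | h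
  · apply key _ (g m) (hg.mem m hm) _ _ le_rfl
    · intro e
      apply h2
      rw [← e, hg.inv m hm]
    · rw [hg.inv m hm]; exact h
  · exact key _ m hm h1 h le_rfl

/-- Flip lemma -/
theorem flip {N : ℕ} (n : ℕ) : ∀ S : Finset (Fin N), S.card = 2 * (n + 1) → ∀ f, Wh S f →
    f.totalDegree ≤ (n + 1) * n → ∀ g, IsMatch S g → ∀ a0 ∈ S, (∀ k ∈ S, a0 ≤ k) →
    ∀ z : Fin N → ℂ, (∀ k ∈ S, z k = sgn g k) →
    eval (z ∘ Equiv.swap a0 (g a0)) f = eval z f := by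
  induction n with
  | zero =>
    intro S hS f hf hd g hg a0 ha0 hmin z hz
    have h0 : f.totalDegree = 0 := by simpa using hd
    rw [totalDegree_eq_zero_iff_eq_C] at h0
    rw [h0]
    simp
  | succ n ih =>
    intro S hS f hf hd g hg a0 ha0 hmin z hz
    have hex : ∃ m ∈ S, m ≠ a0 ∧ m ≠ g a0 := by
      have : 0 < ((S.erase a0).erase (g a0)).card := by
        have h1 := Finset.pred_card_le_card_erase (s := S.erase a0) (a := g a0)
        have h2 := Finset.pred_card_le_card_erase (s := S) (a := a0)
        omega
      obtain ⟨m, hm⟩ := Finset.card_pos.1 this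
      simp only [Finset.mem_erase] at hm
      exact ⟨m, hm.2.2, hm.2.1, hm.1⟩
    obtain ⟨m, hm, hm1, hm2⟩ := hex
    obtain ⟨i, hi, hia, hij, hadj⟩ := exists_adj hg ha0 hmin hm hm1 hm2
    have hj := hg.mem i hi
    obtain ⟨φ, h1, h2, h3⟩ := adj_factor S f hf hi hj hij hadj q⁻¹
    have hc := card_erase2 S hi hj hij hS
    have hdφ : φ.totalDegree ≤ (n + 1) * n := by
      by_cases h0 : φ = 0
      · simp [h0]
      · have h4 := h3 h0
        have h5 := deg_arith (n + 1)
        simp only [Nat.add_sub_cancel] at h5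
        omega
    have e1 : i ≠ g a0 := fun h => by
      rw [h, hg.inv a0 ha0] at hij
      exact absurd hij (not_lt.2 (hmin _ (hg.mem _ ha0)))
    have e2 : g i ≠ a0 := fun h => by
      apply e1; rw [← h, hg.inv i hi]
    have e3 : g i ≠ g a0 := fun h => by
      apply hia; rw [← hg.inv i hi, h, hg.inv a0 ha0]
    have ev : ∀ y : Fin N → ℂ, y i = q⁻¹ → y (g i) = q → eval y f =
        (∏ m ∈ (S.erase i).erase (g i), (y m - 1)) * eval y φ := by
      intro y y1 y2
      have h4 := congrArg (eval y) h2
      have h5 : q ^ 2 * q⁻¹ = q := by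
        have := q_ne_zero
        field_simp
      rw [eval_spec, h5, ← y1, Function.update_eq_self, ← y2, Function.update_eq_self] at h4
      rw [h4, map_mul, map_prod]
      congr 1
      apply Finset.prod_congr rfl
      intro m _
      simp [y1, y2, q_ne_zero]
    have z1 : z i = q⁻¹ := by rw [hz i hi]; simp [sgn, hij]
    have z2 : z (g i) = q := by
      rw [hz _ hj]; simp [sgn, hg.inv i hi, not_lt.2 hij.le]
    rw [ev z z1 z2, ev _ (by simp [Equiv.swap_apply_of_ne_of_ne hia e1, z1])
      (by simp [Equiv.swap_apply_of_ne_of_ne e2 e3, z2])]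
    have hmem : ∀ x, x ∈ S → x ≠ i → x ≠ g i → x ∈ (S.erase i).erase (g i) := fun x a b c =>
      Finset.mem_erase.2 ⟨c, Finset.mem_erase.2 ⟨b, a⟩⟩
    have ha0' := hmem a0 ha0 (Ne.symm hia) (Ne.symm e2)
    have hb0' := hmem (g a0) (hg.mem _ ha0) (Ne.symm e1) (Ne.symm e3)
    congr 1
    · apply Finset.prod_equiv (Equiv.swap a0 (g a0))
      · intro x
        by_cases x1 : x = a0
        · rw [x1, Equiv.swap_apply_left]; exact ⟨fun _ => hb0', fun _ => ha0'⟩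
        · by_cases x2 : x = g a0
          · rw [x2, Equiv.swap_apply_right]; exact ⟨fun _ => ha0', fun _ => hb0'⟩
          · rw [Equiv.swap_apply_of_ne_of_ne x1 x2]
      · intro x _; rfl
    · apply ih _ hc φ h1 hdφ g (hg.erase hi) a0 ha0'
      · intro k hk
        simp only [Finset.mem_erase] at hk
        exact hmin k hk.2.2
      · intro k hk
        simp only [Finset.mem_erase] at hk
        exact hz k hk.2.2

end WheelProof
namespace WheelProof

/-- the working class of polynomials -/
def WW (n : ℕ) (p : MvPolynomial (Fin (2 * n)) ℂ) : Prop :=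
  Wh Finset.univ p ∧ p.totalDegree ≤ n * (n - 1)

lemma fsucc_val {m : ℕ} (k : Fin m) :
    ((k : ℕ) + 1 = m ∧ (fsucc k : ℕ) = 0) ∨ ((k : ℕ) + 1 < m ∧ (fsucc k : ℕ) = k + 1) := by
  have hk := k.isLt
  rcases Nat.lt_or_ge ((k : ℕ) + 1) m with h | h
  · right; exact ⟨h, Nat.mod_eq_of_lt h⟩
  · left
    have h2 : (k : ℕ) + 1 = m := by omega
    refine ⟨h2, ?_⟩
    show ((k : ℕ) + 1) % m = 0
    rw [h2, Nat.mod_self]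

lemma fsucc_inj {m : ℕ} : Function.Injective (fsucc : Fin m → Fin m) := by
  intro a b h
  have h' : (fsucc a : ℕ) = fsucc b := by rw [h]
  have := fsucc_val a
  have := fsucc_val b
  apply Fin.ext
  omega

/-- cyclic shift as a permutation -/
noncomputable def sh (m : ℕ) : Fin m ≃ Fin m :=
  Equiv.ofBijective fsucc (Finite.injective_iff_bijective.1 fsucc_inj)

@[simp] lemma sh_apply {m : ℕ} (k : Fin m) : sh m k = fsucc k := rfl

lemma sh_symm {m : ℕ} (k : Fin m) : fsucc ((sh m).symm k) = k := (sh m).apply_symm_apply k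

lemma symm_sh {m : ℕ} (k : Fin m) : (sh m).symm (fsucc k) = k := (sh m).symm_apply_apply k

lemma fsucc_ne {n : ℕ} (k : Fin (2 * n)) : fsucc k ≠ k := by
  intro h
  have h' : (fsucc k : ℕ) = k := by rw [h]
  have := fsucc_val k
  omega

lemma eval_rename' {N : ℕ} (σ : Fin N → Fin N) (p : MvPolynomial (Fin N) ℂ) (z : Fin N → ℂ) :
    eval z (rename σ p) = eval (z ∘ σ) p := by
  rw [eval_rename]

lemma totalDegree_rename' {N : ℕ} (σ : Fin N → Fin N) (p : MvPolynomial (Fin N) ℂ) :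
    (rename σ p).totalDegree ≤ p.totalDegree := totalDegree_rename_le _ _

lemma WW.rot {n : ℕ} {p : MvPolynomial (Fin (2 * n)) ℂ} (h : WW n p) :
    WW n (rename (sh (2 * n)) p) := by
  refine ⟨?_, (totalDegree_rename' _ _).trans h.2⟩
  intro i _ j _ k _ hij hjk z hj hk
  rw [eval_rename']
  obtain ⟨i, rfl⟩ := (sh (2 * n)).surjective i
  obtain ⟨j, rfl⟩ := (sh (2 * n)).surjective j
  obtain ⟨k, rfl⟩ := (sh (2 * n)).surjective k
  simp only [sh_apply, Fin.lt_def] at hij hjk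
  have h1 := fsucc_val i
  have h2 := fsucc_val j
  have h3 := fsucc_val k
  by_cases hi : (i : ℕ) + 1 < 2 * n
  · exact h.1 i (Finset.mem_univ _) j (Finset.mem_univ _) k (Finset.mem_univ _)
      (by rw [Fin.lt_def]; omega) (by rw [Fin.lt_def]; omega) _ hj hk
  · refine h.1 j (Finset.mem_univ _) k (Finset.mem_univ _) i (Finset.mem_univ _)
      (by rw [Fin.lt_def]; omega) (by rw [Fin.lt_def]; omega) _ ?_ ?_
    · simp only [Function.comp_apply]
      rw [hj, hk]
      linear_combination (-q * z ((sh (2 * n)) i)) * q_cube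
    · simp only [Function.comp_apply]
      rw [hj]
      linear_combination (- z ((sh (2 * n)) i)) * q_cube

lemma WW.irot {n : ℕ} {p : MvPolynomial (Fin (2 * n)) ℂ} (h : WW n p) :
    WW n (rename (sh (2 * n)).symm p) := by
  refine ⟨?_, (totalDegree_rename' _ _).trans h.2⟩
  intro i _ j _ k _ hij hjk z hj hk
  rw [eval_rename']
  have e : ∀ x, (z ∘ (sh (2 * n)).symm) (fsucc x) = z x := by
    intro x
    simp only [Function.comp_apply, symm_sh]
  rw [Fin.lt_def] at hij hjk
  have h1 := fsucc_val i
  have h2 := fsucc_val j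
  have h3 := fsucc_val k
  by_cases hi : (k : ℕ) + 1 < 2 * n
  · exact h.1 (fsucc i) (Finset.mem_univ _) (fsucc j) (Finset.mem_univ _) (fsucc k)
      (Finset.mem_univ _)
      (by rw [Fin.lt_def]; omega) (by rw [Fin.lt_def]; omega) _ (by rw [e, e, hj])
      (by rw [e, e, hk])
  · refine h.1 (fsucc k) (Finset.mem_univ _) (fsucc i) (Finset.mem_univ _) (fsucc j)
      (Finset.mem_univ _)
      (by rw [Fin.lt_def]; omega) (by rw [Fin.lt_def]; omega) _ ?_ ?_
    · rw [e, e, hk]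
      linear_combination (- z i) * q_cube
    · rw [e, e, hj, hk]
      ring

lemma noncross' {n : ℕ} (π : NCM n) {a b c d : Fin (2 * n)} (h1 : (a : ℕ) < b) (h2 : (b : ℕ) < c)
    (h3 : (c : ℕ) < d) (h4 : π.f a = c) (h5 : π.f b = d) : False :=
  π.noncross a b c d h1 h2 h3 h4 h5

/-- rotation of a matching -/
noncomputable def rot {n : ℕ} (π : NCM n) : NCM n where
  f k := (sh (2 * n)).symm (π.f (fsucc k))
  invol k := by rw [sh_symm, π.invol, symm_sh]
  nofix k h := by
    have := congrArg (sh (2 * n)) h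
    simp only [Equiv.apply_symm_apply, sh_apply] at this
    exact π.nofix _ this
  noncross a b c d hab hbc hcd h1 h2 := by
    have h1' : π.f (fsucc a) = fsucc c := by rw [← h1, sh_symm]
    have h2' : π.f (fsucc b) = fsucc d := by rw [← h2, sh_symm]
    rw [Fin.lt_def] at hab hbc hcd
    have e1 := fsucc_val a
    have e2 := fsucc_val b
    have e3 := fsucc_val c
    have e4 := fsucc_val d
    by_cases hd : (d : ℕ) + 1 < 2 * n
    · exact noncross' π (by omega) (by omega) (by omega) h1' h2'
    · have h3' : π.f (fsucc d) = fsucc b := by rw [← h2', π.invol]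
      exact noncross' π (by omega) (by omega) (by omega) h3' h1'

lemma rot_f {n : ℕ} (π : NCM n) (k : Fin (2 * n)) :
    (rot π).f k = (sh (2 * n)).symm (π.f (fsucc k)) := rfl

lemma fsucc_rot {n : ℕ} (π : NCM n) (k : Fin (2 * n)) :
    fsucc ((rot π).f k) = π.f (fsucc k) := by rw [rot_f, sh_symm]

lemma rot_inj {n : ℕ} : Function.Injective (rot : NCM n → NCM n) := by
  intro π ρ h
  apply NCM.ext'
  funext k
  rw [← sh_symm k, ← fsucc_rot, ← fsucc_rot, h]

lemma rot_surj {n : ℕ} : Function.Surjective (rot : NCM n → NCM n) :=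
  Finite.injective_iff_surjective.1 rot_inj

lemma isMatch_univ {n : ℕ} (π : NCM n) : IsMatch Finset.univ π.f where
  mem _ _ := Finset.mem_univ _
  inv k _ := π.invol k
  ne k _ := π.nofix k
  nc := fun a _ b _ c d => π.noncross a b c d

end WheelProof
namespace WheelProof

lemma evalNC_eq {n : ℕ} (p : MvPolynomial (Fin (2 * n)) ℂ) (π : NCM n) :
    evalNC p π = eval (sgn π.f) p := rfl

lemma sgn_lt {n : ℕ} {π : NCM n} {k : Fin (2 * n)} (h : (k : ℕ) < π.f k) : sgn π.f k = q⁻¹ := by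
  unfold sgn
  rw [if_pos]
  exact h

lemma sgn_ge {n : ℕ} {π : NCM n} {k : Fin (2 * n)} (h : ¬ (k : ℕ) < π.f k) : sgn π.f k = q := by
  unfold sgn
  rw [if_neg]
  exact h

lemma evalNC_rot {n : ℕ} (p : MvPolynomial (Fin (2 * n)) ℂ) (hp : WW n p) (π : NCM n) :
    evalNC (rename (sh (2 * n)) p) π = evalNC p (rot π) := by
  rcases n with _ | n
  · rw [evalNC_eq, evalNC_eq, eval_rename']
    congr 2
    funext k
    exact k.elim0
  · have h0 : 0 < 2 * (n + 1) := by omega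
    have key := flip n Finset.univ (by simp) (rename (sh (2 * (n + 1))) p) hp.rot.1
      hp.rot.2 π.f (isMatch_univ π) ⟨0, h0⟩ (Finset.mem_univ _)
      (fun k _ => by rw [Fin.le_def]; exact Nat.zero_le _) (sgn π.f) (fun _ _ => rfl)
    rw [evalNC_eq, evalNC_eq, ← key, eval_rename']
    congr 2
    funext k
    simp only [Function.comp_apply, sh_apply]
    have e1 := fsucc_val k
    have e2 := fsucc_rot π k
    have e3 := fsucc_val ((rot π).f k)
    have e4 := (rot π).nofix k
    have e5 : ((rot π).f k : ℕ) ≠ k := fun h => e4 (Fin.ext h)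
    rw [e2] at e3
    by_cases hk : fsucc k = ⟨0, h0⟩
    · rw [hk, Equiv.swap_apply_left]
      rw [hk] at e1 e3
      simp only at e1
      have e6 := π.nofix ⟨0, h0⟩
      have e7 : (π.f ⟨0, h0⟩ : ℕ) ≠ 0 := fun h => e6 (Fin.ext h)
      rw [sgn_ge, sgn_ge]
      · omega
      · rw [π.invol]; simp
    · by_cases hk2 : fsucc k = π.f ⟨0, h0⟩
      · rw [hk2, Equiv.swap_apply_right]
        have e6 := π.nofix ⟨0, h0⟩
        have e7 : (π.f ⟨0, h0⟩ : ℕ) ≠ 0 := fun h => e6 (Fin.ext h)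
        rw [hk2, π.invol] at e3
        rw [hk2] at e1
        simp only at e3
        have := ((rot π).f k).isLt
        have := (π.f ⟨0, h0⟩).isLt
        rw [sgn_lt, sgn_lt]
        · omega
        · simp only; omega
      · rw [Equiv.swap_apply_of_ne_of_ne hk hk2]
        have hk' : (fsucc k : ℕ) ≠ 0 := fun h => hk (Fin.ext h)
        have hk2' : (π.f (fsucc k) : ℕ) ≠ 0 := by
          intro h
          apply hk2
          have : π.f (fsucc k) = ⟨0, h0⟩ := Fin.ext h
          rw [← this, π.invol]
        by_cases hlt : (fsucc k : ℕ) < π.f (fsucc k)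
        · rw [sgn_lt hlt, sgn_lt]
          omega
        · rw [sgn_ge hlt, sgn_ge]
          omega

/-- divided difference relation -/
def IsT {n : ℕ} (k : Fin (2 * n)) (p t : MvPolynomial (Fin (2 * n)) ℂ) : Prop :=
  (X k - X (fsucc k)) * t =
    (C q * X k - C q⁻¹ * X (fsucc k)) * (p - rename (Equiv.swap k (fsucc k)) p)

lemma IsT.ev {n : ℕ} {k : Fin (2 * n)} {p t : MvPolynomial (Fin (2 * n)) ℂ} (h : IsT k p t)
    (z : Fin (2 * n) → ℂ) : (z k - z (fsucc k)) * eval z t =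
    (q * z k - q⁻¹ * z (fsucc k)) *
      (eval z p - eval (z ∘ Equiv.swap k (fsucc k)) p) := by
  have := congrArg (MvPolynomial.eval z) h
  simpa only [map_mul, map_sub, eval_X, eval_C, eval_rename'] using this

lemma isT_exists {n : ℕ} (k : Fin (2 * n)) (p : MvPolynomial (Fin (2 * n)) ℂ) :
    ∃ t, IsT k p t := by
  have h : (X k - X (fsucc k)) ∣ (p - rename (Equiv.swap k (fsucc k)) p) := by
    apply dvd_of_aeval_update
    rw [aeval_eq_zero_iff]
    intro z
    rw [map_sub, eval_rename', sub_eq_zero]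
    congr 2
    funext l
    simp only [Function.comp_apply]
    by_cases h1 : l = k
    · subst h1
      rw [Equiv.swap_apply_left, Function.update_self, Function.update_of_ne (fsucc_ne _)]
    · by_cases h2 : l = fsucc k
      · subst h2
        rw [Equiv.swap_apply_right, Function.update_self, Function.update_of_ne (fsucc_ne _)]
      · rw [Equiv.swap_apply_of_ne_of_ne h1 h2]
  obtain ⟨t, ht⟩ := h
  refine ⟨(C q * X k - C q⁻¹ * X (fsucc k)) * t, ?_⟩
  unfold IsT
  rw [ht]
  ring

lemma totalDegree_X_sub {N : ℕ} {a b : Fin N} (h : a ≠ b) :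
    (X a - X b : MvPolynomial (Fin N) ℂ) ≠ 0 ∧
    (X a - X b : MvPolynomial (Fin N) ℂ).totalDegree = 1 := by
  have h0 : eval (fun l => if l = a then (1 : ℂ) else 0) (X a - X b : MvPolynomial (Fin N) ℂ) = 1 := by
    simp [h.symm]
  constructor
  · intro h1
    rw [h1] at h0
    simp at h0
  · apply le_antisymm
    · refine (totalDegree_sub _ _).trans ?_
      simp
    · apply one_le_totalDegree_of_ne _ (fun l => if l = a then (1 : ℂ) else 0) 0
      rw [h0]
      simp

lemma IsT.ww {n : ℕ} {k : Fin (2 * n)} {p t : MvPolynomial (Fin (2 * n)) ℂ} (h : IsT k p t)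
    (hp : WW n p) : WW n t := by
  have hX := totalDegree_X_sub (fsucc_ne k).symm
  constructor
  · intro a _ b _ c _ hab hbc
    apply locus_cancel hab hbc (X k - X (fsucc k)) t
    · intro z hb hc
      rw [h, map_mul]
      by_cases hin : (k = a ∨ k = b ∨ k = c) ∧ (fsucc k = a ∨ fsucc k = b ∨ fsucc k = c)
      · have hz : (eval z) (C q * X k - C q⁻¹ * X (fsucc k)) = 0 := by
          simp only [map_mul, map_sub, eval_X, eval_C]
          have e1 := fsucc_val k
          rw [Fin.lt_def] at hab hbc
          have hc' := c.isLt
          have key : (k = a ∧ fsucc k = b) ∨ (k = b ∧ fsucc k = c) ∨ (k = c ∧ fsucc k = a) := by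
            simp only [Fin.ext_iff] at hin ⊢
            omega
          rcases key with ⟨r1, r2⟩ | ⟨r1, r2⟩ | ⟨r1, r2⟩
          · rw [r2, r1, hb, q_inv]
            linear_combination (-q * z a) * q_cube
          · rw [r2, r1, hb, hc, q_inv]; ring
          · rw [r2, r1, hc, q_inv]; ring
        rw [hz, zero_mul]
      · have hz1 : eval z p = 0 := hp.1 a (Finset.mem_univ _) b (Finset.mem_univ _) c
          (Finset.mem_univ _) hab hbc z hb hc
        have hz2 : eval (z ∘ Equiv.swap k (fsucc k)) p = 0 := by
          -- locate the swapped triple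
          set s := Equiv.swap k (fsucc k) with hs
          have hz : ∀ x, (z ∘ s) (s x) = z x := by
            intro x; simp [hs]
          have e1 := fsucc_val k
          have sv : ∀ x : Fin (2 * n), (x = k ∧ s x = fsucc k) ∨ (x = fsucc k ∧ s x = k) ∨
              (x ≠ k ∧ x ≠ fsucc k ∧ s x = x) := by
            intro x
            by_cases h1 : x = k
            · left; exact ⟨h1, by rw [h1, hs, Equiv.swap_apply_left]⟩
            · by_cases h2 : x = fsucc k
              · right; left; exact ⟨h2, by rw [h2, hs, Equiv.swap_apply_right]⟩
              · right; right; exact ⟨h1, h2, Equiv.swap_apply_of_ne_of_ne h1 h2⟩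
          have sa := sv a
          have sb := sv b
          have sc := sv c
          rw [Fin.lt_def] at hab hbc
          simp only [Fin.ext_iff, ne_eq] at hin sa sb sc
          have hal := a.isLt
          have hcl := c.isLt
          have hkl := k.isLt
          have hor : ((s a : ℕ) < s b ∧ (s b : ℕ) < s c) ∨ ((s b : ℕ) < s c ∧ (s c : ℕ) < s a) ∨
              ((s c : ℕ) < s a ∧ (s a : ℕ) < s b) := by
            omega
          rcases hor with ⟨r1, r2⟩ | ⟨r1, r2⟩ | ⟨r1, r2⟩
          · apply hp.1 (s a) (Finset.mem_univ _) (s b) (Finset.mem_univ _) (s c)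
              (Finset.mem_univ _) r1 r2
            · rw [hz, hz, hb]
            · rw [hz, hz, hc]
          · apply hp.1 (s b) (Finset.mem_univ _) (s c) (Finset.mem_univ _) (s a)
              (Finset.mem_univ _) r1 r2
            · rw [hz, hz, hb, hc]
              linear_combination (-q * z a) * q_cube
            · rw [hz, hz, hb]
              linear_combination (- z a) * q_cube
          · apply hp.1 (s c) (Finset.mem_univ _) (s a) (Finset.mem_univ _) (s b)
              (Finset.mem_univ _) r1 r2
            · rw [hz, hz, hc]
              linear_combination (- z a) * q_cube
            · rw [hz, hz, hb, hc]
              ring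
        rw [map_sub _ p, eval_rename', hz1, hz2, sub_zero, mul_zero]
    · obtain ⟨z, h1, h2, h3, -⟩ := exists_generic hab hbc 0
      refine ⟨z, h1, h2, ?_⟩
      simp only [map_sub, eval_X]
      intro h0
      exact fsucc_ne k (h3 (sub_eq_zero.1 h0)).symm
  · by_cases ht : t = 0
    · rw [ht]; simp
    · have h1 : ((X k - X (fsucc k)) * t).totalDegree = 1 + t.totalDegree := by
        rw [totalDegree_mul_of_isDomain hX.1 ht, hX.2]
      rw [h] at h1
      have h2 := totalDegree_mul (C q * X k - C q⁻¹ * X (fsucc k))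
        (p - rename (Equiv.swap k (fsucc k)) p)
      have h3 : (C q * X k - C q⁻¹ * X (fsucc k) : MvPolynomial (Fin (2 * n)) ℂ).totalDegree ≤ 1 := by
        refine (totalDegree_sub _ _).trans (max_le ?_ ?_) <;>
        · refine (totalDegree_mul _ _).trans ?_
          simp
      have h4 : (p - rename (Equiv.swap k (fsucc k)) p).totalDegree ≤ p.totalDegree :=
        (totalDegree_sub _ _).trans (max_le le_rfl (totalDegree_rename' _ _))
      have := hp.2
      omega

end WheelProof
namespace WheelProof

lemma eRaw_rot {n : ℕ} (k : Fin (2 * n)) (π : NCM n) (m : Fin (2 * n)) :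
    fsucc (eRaw k (rot π) m) = eRaw (fsucc k) π (fsucc m) := by
  have hi : ∀ a b : Fin (2 * n), fsucc a = fsucc b ↔ a = b := fun a b => fsucc_inj.eq_iff
  have h1 : (rot π).f k = fsucc k ↔ π.f (fsucc k) = fsucc (fsucc k) := by
    rw [← hi, fsucc_rot]
  unfold eRaw
  by_cases h : (rot π).f k = fsucc k
  · rw [if_pos h, if_pos (h1.1 h), fsucc_rot]
  · rw [if_neg h, if_neg (fun h' => h (h1.2 h'))]
    simp only [hi, ← fsucc_rot]
    split_ifs <;> rfl

/-- local action of the divided difference on the evaluation functionals -/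
def QQ {n : ℕ} (k : Fin (2 * n)) (π : NCM n) : Prop :=
  ∃ ρ : NCM n, ρ.f = eRaw k π ∧ ∀ p t, WW n p → IsT k p t → evalNC t π = evalNC p ρ - evalNC p π

lemma isT_irot {n : ℕ} {k : Fin (2 * n)} {p t : MvPolynomial (Fin (2 * n)) ℂ}
    (h : IsT (fsucc k) p t) :
    IsT k (rename (sh (2 * n)).symm p) (rename (sh (2 * n)).symm t) := by
  unfold IsT at h ⊢
  have h2 := congrArg (rename (sh (2 * n)).symm) h
  simp only [map_mul, map_sub, rename_X, rename_C, symm_sh, rename_rename] at h2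
  rw [h2]
  congr 2
  rw [rename_rename]
  congr 2
  funext m
  simp only [Function.comp_apply]
  obtain ⟨m, rfl⟩ := (sh (2 * n)).surjective m
  rw [sh_apply, symm_sh]
  have := Equiv.swap_apply_apply (sh (2 * n)) k (fsucc k)
  simp only [sh_apply] at this
  rw [this]
  simp only [Equiv.Perm.mul_apply]
  have e : (sh (2 * n))⁻¹ (fsucc m) = m := symm_sh m
  rw [e, sh_apply, symm_sh]

lemma QQ_rot {n : ℕ} {k : Fin (2 * n)} {π : NCM n} (h : QQ k (rot π)) : QQ (fsucc k) π := by
  obtain ⟨ρ, h1, h2⟩ := h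
  obtain ⟨ρ, rfl⟩ := rot_surj ρ
  refine ⟨ρ, ?_, ?_⟩
  · funext m
    obtain ⟨m, rfl⟩ := (sh (2 * n)).surjective m
    rw [sh_apply, ← eRaw_rot, ← h1, fsucc_rot]
  · intro p t hp ht
    have h3 := h2 _ _ hp.irot (isT_irot ht)
    rw [← evalNC_rot _ (ht.ww hp).irot, ← evalNC_rot _ hp.irot, ← evalNC_rot _ hp.irot] at h3
    simpa only [rename_rename, Equiv.self_comp_symm, rename_id_apply] using h3

lemma QQ_easy {n : ℕ} {k : Fin (2 * n)} {π : NCM n} (h : π.f k = fsucc k)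
    (hk : (k : ℕ) + 1 < 2 * n) : QQ k π := by
  refine ⟨π, by unfold eRaw; rw [if_pos h], ?_⟩
  intro p t _ ht
  rw [sub_self, evalNC_eq]
  have e := fsucc_val k
  have h1 := ht.ev (sgn π.f)
  have hz1 : sgn π.f k = q⁻¹ := sgn_lt (by rw [h]; omega)
  have hz2 : sgn π.f (fsucc k) = q := sgn_ge (by rw [← h, π.invol, h]; omega)
  rw [hz1, hz2, mul_inv_cancel₀ q_ne_zero, inv_mul_cancel₀ q_ne_zero, sub_self, zero_mul] at h1
  rcases mul_eq_zero.1 h1 with h1 | h1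
  · rw [q_inv, sub_eq_zero] at h1
    exact absurd h1 q_sq_ne_q
  · exact h1

lemma QQ_hard {n : ℕ} {k : Fin (2 * n)} {π : NCM n} (h0 : (π.f k : ℕ) = 0)
    (hk : (k : ℕ) + 1 < 2 * n) : QQ k π := by
  have e : (fsucc k : ℕ) = k + 1 := by have := fsucc_val k; omega
  have hk0 : (k : ℕ) ≠ 0 := by
    intro h
    exact π.nofix k (Fin.ext (by omega))
  set o := π.f k with ho
  have hok : π.f o = k := π.invol k
  have hne : o ≠ fsucc k := by
    intro h
    rw [h] at h0
    omega
  set k' := fsucc k with hk'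
  set m := π.f k' with hm
  have hmk : π.f m = k' := π.invol k'
  have hm1 : (k' : ℕ) < m := by
    by_contra hlt
    have n1 : (m : ℕ) ≠ k' := fun h => π.nofix k' (Fin.ext h)
    have n2 : (m : ℕ) ≠ k := by
      intro h
      have : m = k := Fin.ext h
      rw [this] at hmk
      exact hne (ho.trans hmk)
    have n3 : (m : ℕ) ≠ 0 := by
      intro h
      have : m = o := Fin.ext (by omega)
      rw [this, hok] at hmk
      exact fsucc_ne k hmk.symm
    exact noncross' π (a := o) (b := m) (c := k) (d := k') (by omega) (by omega) (by omega) hok hmk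
  have hraw : ∀ x, eRaw k π x = if x = k then k' else if x = k' then k else if x = o then m
      else if x = m then o else π.f x := by
    intro x
    unfold eRaw
    rw [if_neg hne]
  have v1 : eRaw k π k = k' := by rw [hraw, if_pos rfl]
  have v2 : eRaw k π k' = k := by rw [hraw, if_neg (fsucc_ne k), if_pos rfl]
  have v3 : eRaw k π o = m := by
    rw [hraw, if_neg, if_neg hne, if_pos rfl]
    intro h; rw [h] at h0; exact hk0 h0
  have v4 : eRaw k π m = o := by
    rw [hraw, if_neg, if_neg, if_neg, if_pos rfl]
    · intro h; rw [h] at hm1; omega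
    · intro h; rw [h] at hm1; omega
    · intro h; rw [h] at hm1; omega
  have v5 : ∀ x, x ≠ k → x ≠ k' → x ≠ o → x ≠ m → eRaw k π x = π.f x := by
    intro x a b c d
    rw [hraw, if_neg a, if_neg b, if_neg c, if_neg d]
  have v6 : ∀ x, x ≠ k → x ≠ k' → x ≠ o → x ≠ m →
      π.f x ≠ k ∧ π.f x ≠ k' ∧ π.f x ≠ o ∧ π.f x ≠ m := by
    intro x a b c d
    refine ⟨?_, ?_, ?_, ?_⟩
    · intro h; apply c; rw [ho, ← h, π.invol]
    · intro h; apply d; rw [hm, ← h, π.invol]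
    · intro h; apply a; rw [← hok, ← h, π.invol]
    · intro h; apply b; rw [← hmk, ← h, π.invol]
  have cases4 : ∀ x, x = k ∨ x = k' ∨ x = o ∨ x = m ∨ (x ≠ k ∧ x ≠ k' ∧ x ≠ o ∧ x ≠ m) := by
    intro x; tauto
  have vinv : ∀ x, eRaw k π (eRaw k π x) = x := by
    intro x
    rcases cases4 x with h | h | h | h | ⟨a, b, c, d⟩
    · rw [h, v1, v2]
    · rw [h, v2, v1]
    · rw [h, v3, v4]
    · rw [h, v4, v3]
    · obtain ⟨a', b', c', d'⟩ := v6 x a b c d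
      rw [v5 x a b c d, v5 _ a' b' c' d', π.invol]
  have vfix : ∀ x, eRaw k π x ≠ x := by
    intro x
    rcases cases4 x with h | h | h | h | ⟨a, b, c, d⟩
    · rw [h, v1]; exact fsucc_ne k
    · rw [h, v2]; exact (fsucc_ne k).symm
    · rw [h, v3]; intro h; rw [h] at hm1; omega
    · rw [h, v4]; intro h; rw [← h] at hm1; omega
    · rw [v5 x a b c d]; exact π.nofix x
  have vnc : ∀ a b c d : Fin (2 * n), a < b → b < c → c < d → eRaw k π a = c → eRaw k π b = d →
      False := by
    intro a b c d hab hbc hcd h1 h2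
    rw [Fin.lt_def] at hab hbc hcd
    have hmv : eRaw k π c = a := by rw [← h1, vinv]
    rcases cases4 a with h | h | h | h | ⟨a1, a2, a3, a4⟩
    · rw [h, v1] at h1; rw [h] at hab; rw [← h1] at hbc; omega
    · rw [h, v2] at h1; rw [h] at hab; rw [← h1] at hbc; omega
    · -- the arc from o to m
      rw [h, v3] at h1
      rw [← h1] at hbc hcd
      rw [h] at hab
      rcases cases4 b with h' | h' | h' | h' | ⟨b1, b2, b3, b4⟩
      · rw [h', v1] at h2; rw [← h2] at hcd; omega
      · rw [h', v2] at h2; rw [← h2] at hcd; omega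
      · rw [h'] at hab; omega
      · rw [h'] at hbc; omega
      · rw [v5 b b1 b2 b3 b4] at h2
        have b1' : (b : ℕ) ≠ k := fun h => b1 (Fin.ext h)
        have b2' : (b : ℕ) ≠ k' := fun h => b2 (Fin.ext h)
        by_cases hbk : (b : ℕ) < k
        · exact noncross' π (a := o) (b := b) (c := k) (d := d) hab hbk (by omega) hok h2
        · exact noncross' π (a := k') (b := b) (c := m) (d := d) (by omega) hbc hcd rfl h2
    · rw [h, v4] at h1
      rw [h] at hab
      rw [← h1] at hbc
      omega
    · rw [v5 a a1 a2 a3 a4] at h1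
      obtain ⟨c1, c2, c3, c4⟩ := v6 a a1 a2 a3 a4
      rw [h1] at c1 c2 c3 c4
      have a1' : (a : ℕ) ≠ k := fun h => a1 (Fin.ext h)
      have a2' : (a : ℕ) ≠ k' := fun h => a2 (Fin.ext h)
      have a4' : (a : ℕ) ≠ m := fun h => a4 (Fin.ext h)
      have c1' : (c : ℕ) ≠ k := fun h => c1 (Fin.ext h)
      have c2' : (c : ℕ) ≠ k' := fun h => c2 (Fin.ext h)
      have c4' : (c : ℕ) ≠ m := fun h => c4 (Fin.ext h)
      rcases cases4 b with h' | h' | h' | h' | ⟨b1, b2, b3, b4⟩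
      · rw [h', v1] at h2; rw [h'] at hbc; rw [← h2] at hcd; omega
      · rw [h', v2] at h2; rw [h'] at hbc; rw [← h2] at hcd; omega
      · rw [h'] at hab; omega
      · rw [h', v4] at h2; rw [← h2] at hcd; omega
      · rw [v5 b b1 b2 b3 b4] at h2
        exact noncross' π hab hbc hcd h1 h2
  let ρ : NCM n := ⟨eRaw k π, vinv, vfix, vnc⟩
  refine ⟨ρ, rfl, ?_⟩
  intro p t hp ht
  have hz1 : sgn π.f k = q := sgn_ge (by rw [← ho]; omega)
  have hz2 : sgn π.f k' = q⁻¹ := sgn_lt (by rw [← hm]; omega)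
  have h1 := ht.ev (sgn π.f)
  have hs : sgn π.f ∘ Equiv.swap k (fsucc k) = sgn ρ.f := by
    funext x
    simp only [Function.comp_apply]
    rcases cases4 x with h | h | h | h | ⟨a, b, c, d⟩
    · rw [h, Equiv.swap_apply_left, hz2, sgn_lt]
      show (k : ℕ) < eRaw k π k
      rw [v1]; omega
    · rw [h, Equiv.swap_apply_right, hz1, sgn_ge]
      show ¬ (k' : ℕ) < eRaw k π k'
      rw [v2]; omega
    · rw [h, Equiv.swap_apply_of_ne_of_ne _ hne, sgn_lt, sgn_lt]
      · show (o : ℕ) < eRaw k π o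
        rw [v3]; omega
      · rw [hok]; omega
      · intro h; rw [h] at h0; omega
    · rw [h, Equiv.swap_apply_of_ne_of_ne, sgn_ge, sgn_ge]
      · show ¬ (m : ℕ) < eRaw k π m
        rw [v4]; omega
      · rw [hmk]; omega
      · intro h; rw [h] at hm1; omega
      · intro h
        have h : m = k' := h
        rw [h] at hm1; omega
    · rw [Equiv.swap_apply_of_ne_of_ne a b]
      show sgn π.f x = sgn (eRaw k π) x
      unfold sgn
      rw [v5 x a b c d]
  rw [hs, ← hk', hz1, hz2] at h1
  rw [evalNC_eq, evalNC_eq, evalNC_eq]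
  have hq : q - q⁻¹ ≠ 0 := by
    rw [q_inv, sub_ne_zero]; exact q_sq_ne_q.symm
  apply mul_left_cancel₀ hq
  rw [h1]
  have : q * q - q⁻¹ * q⁻¹ = - (q - q⁻¹) := by
    rw [q_inv]
    linear_combination (-q) * q_cube
  rw [this]
  ring

lemma QQ_all {n : ℕ} (d : ℕ) : ∀ (k : Fin (2 * n)) (π : NCM n), (π.f k : ℕ) = d → QQ k π := by
  have easy : ∀ (k : Fin (2 * n)) (π : NCM n), π.f k = fsucc k → QQ k π := by
    intro k π h
    have hk := fsucc_val k
    rcases hk with ⟨h1, h2⟩ | ⟨h1, h2⟩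
    · obtain ⟨k, rfl⟩ := (sh (2 * n)).surjective k
      apply QQ_rot
      rw [sh_apply] at h h1 h2
      apply QQ_easy
      · rw [rot_f, h, symm_sh]
      · have := fsucc_val k
        omega
    · exact QQ_easy h h1
  induction d with
  | zero =>
    intro k π h
    by_cases he : π.f k = fsucc k
    · exact easy k π he
    · apply QQ_hard h
      have := fsucc_val k
      rcases this with ⟨h1, h2⟩ | ⟨h1, h2⟩
      · exact absurd (Fin.ext (by omega)) he
      · exact h1
  | succ d ih =>
    intro k π h
    obtain ⟨k, rfl⟩ := (sh (2 * n)).surjective k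
    rw [sh_apply] at *
    apply QQ_rot
    apply ih
    have h1 := fsucc_rot π k
    have h2 := fsucc_val ((rot π).f k)
    rw [h1] at h2
    omega

end WheelProof
namespace WheelProof

lemma eval_one_isT {n : ℕ} {k : Fin (2 * n)} {p t : MvPolynomial (Fin (2 * n)) ℂ}
    (h : IsT k p t) : evalOne t = (q - q⁻¹) *
      (evalOne (pderiv k p) - evalOne (pderiv (fsucc k) p)) := by
  have h1 := congrArg (fun f => evalOne (pderiv k f)) h
  have hr : ∀ f : MvPolynomial (Fin (2 * n)) ℂ,
      evalOne (rename (Equiv.swap k (fsucc k)) f) = evalOne f := by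
    intro f
    unfold evalOne
    rw [eval_rename']
    rfl
  have hs : pderiv k (rename (Equiv.swap k (fsucc k)) p) =
      rename (Equiv.swap k (fsucc k)) (pderiv (fsucc k) p) := by
    have := pderiv_rename (Equiv.swap k (fsucc k)).injective (fsucc k) p
    rwa [Equiv.swap_apply_right] at this
  have hne := fsucc_ne k
  simp only [Derivation.leibniz, map_sub, smul_eq_mul, pderiv_X_self, pderiv_X_of_ne hne, hs,
    pderiv_C] at h1
  have e0 : ∀ f : MvPolynomial (Fin (2 * n)) ℂ, evalOne f = eval (fun _ => (1 : ℂ)) f := fun _ => rfl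
  simp only [e0, map_add, map_sub, map_mul, eval_X, eval_C, map_one, map_zero] at h1 hr ⊢
  rw [hr, hr] at h1
  linear_combination h1

/-- choice of the divided difference -/
noncomputable def TT {n : ℕ} (k : Fin (2 * n)) (p : MvPolynomial (Fin (2 * n)) ℂ) :
    MvPolynomial (Fin (2 * n)) ℂ := (isT_exists k p).choose

lemma TT_spec {n : ℕ} (k : Fin (2 * n)) (p : MvPolynomial (Fin (2 * n)) ℂ) : IsT k p (TT k p) :=
  (isT_exists k p).choose_spec

lemma evalOne_sum_TT {n : ℕ} (p : MvPolynomial (Fin (2 * n)) ℂ) :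
    evalOne (∑ k, TT k p) = 0 := by
  unfold evalOne
  rw [map_sum]
  have : ∀ k, eval (fun _ => (1 : ℂ)) (TT k p) = (q - q⁻¹) *
      (evalOne (pderiv k p) - evalOne (pderiv (fsucc k) p)) := fun k => eval_one_isT (TT_spec k p)
  simp only [this]
  rw [← Finset.mul_sum, Finset.sum_sub_distrib]
  have h2 := Equiv.sum_comp (sh (2 * n)) (fun k => evalOne (pderiv k p))
  simp only [sh_apply] at h2
  rw [h2, sub_self, mul_zero]

lemma WW.add {n : ℕ} {p r : MvPolynomial (Fin (2 * n)) ℂ} (hp : WW n p) (hr : WW n r) :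
    WW n (p + r) := by
  refine ⟨?_, (totalDegree_add _ _).trans (max_le hp.2 hr.2)⟩
  intro i hi j hj k hk hij hjk z h1 h2
  rw [map_add, hp.1 i hi j hj k hk hij hjk z h1 h2, hr.1 i hi j hj k hk hij hjk z h1 h2, add_zero]

lemma WW.smul {n : ℕ} {p : MvPolynomial (Fin (2 * n)) ℂ} (hp : WW n p) (c : ℂ) :
    WW n (C c * p) := by
  refine ⟨?_, ?_⟩
  · intro i hi j hj k hk hij hjk z h1 h2
    rw [map_mul, hp.1 i hi j hj k hk hij hjk z h1 h2, mul_zero]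
  · refine (totalDegree_mul _ _).trans ?_
    rw [totalDegree_C, zero_add]
    exact hp.2

lemma WW.zero {n : ℕ} : WW n 0 := by
  refine ⟨?_, by simp⟩
  intro i hi j hj k hk hij hjk z h1 h2
  simp

lemma WW.sum {n : ℕ} {ι : Type*} (s : Finset ι) (p : ι → MvPolynomial (Fin (2 * n)) ℂ)
    (hp : ∀ i ∈ s, WW n (p i)) : WW n (∑ i ∈ s, p i) := by
  classical
  induction s using Finset.induction_on with
  | empty => simpa using WW.zero
  | insert a s ha ih =>
    rw [Finset.sum_insert ha]
    exact (hp a (Finset.mem_insert_self _ _)).add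
      (ih fun i hi => hp i (Finset.mem_insert_of_mem hi))

/-- the Temperley-Lieb operator on matchings -/
noncomputable def ee {n : ℕ} (k : Fin (2 * n)) (π : NCM n) : NCM n := (QQ_all _ k π rfl).choose

lemma ee_f {n : ℕ} (k : Fin (2 * n)) (π : NCM n) : (ee k π).f = eRaw k π :=
  (QQ_all _ k π rfl).choose_spec.1

lemma evalNC_TT {n : ℕ} (k : Fin (2 * n)) (π : NCM n) (p : MvPolynomial (Fin (2 * n)) ℂ)
    (hp : WW n p) : evalNC (TT k p) π = evalNC p (ee k π) - evalNC p π :=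
  (QQ_all _ k π rfl).choose_spec.2 p _ hp (TT_spec k p)

lemma ww_eq {n : ℕ} {p r : MvPolynomial (Fin (2 * n)) ℂ} (hp : WW n p) (hr : WW n r)
    (h : ∀ π, evalNC p π = evalNC r π) : p = r := by
  have hd := hp.add (hr.smul (-1))
  have h0 := eval_determine n Finset.univ (by simp) _ hd.1 hd.2 (by
    intro g hg z hz
    let π : NCM n := ⟨g, fun k => hg.inv k (Finset.mem_univ _), fun k => hg.ne k (Finset.mem_univ _),
      fun a b c d => hg.nc a (Finset.mem_univ _) b (Finset.mem_univ _) c d⟩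
    have hz' : z = sgn π.f := funext fun k => hz k (Finset.mem_univ _)
    have h1 := h π
    rw [evalNC_eq, evalNC_eq, ← hz'] at h1
    rw [map_add, map_mul, eval_C, h1]
    ring)
  have : p - r = 0 := by
    rw [← h0]
    simp
    ring
  exact sub_eq_zero.1 this

/-- Assembly, given the symmetric reference polynomial. -/
theorem assembly (n : ℕ) (μ : NCM n → ℂ)
    (hsum : ∑ π : NCM n, μ π = 1) (hstat : Stationary μ)
    (huniq : ∀ v : NCM n → ℂ, (∑ π : NCM n, v π = 1) → Stationary v → v = μ)
    (A : ℂ) (p0 : MvPolynomial (Fin (2 * n)) ℂ) (hp0 : WW n p0) (h1 : ∀ π, evalNC p0 π = 1)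
    (hA : evalOne p0 = A) (p : MvPolynomial (Fin (2 * n)) ℂ) (hp : WW n p) :
    evalOne p = A * ∑ π : NCM n, μ π * evalNC p π := by
  classical
  -- the dual operator
  let Pt : (NCM n → ℂ) →ₗ[ℂ] (NCM n → ℂ) :=
    { toFun := fun g π => (∑ k, (g (ee k π) - g π)) + ∑ ρ, μ ρ * g ρ
      map_add' := by
        intro g h
        funext π
        simp only [Pi.add_apply, mul_add, Finset.sum_add_distrib]
        have : ∀ k, g (ee k π) + h (ee k π) - (g π + h π) =
          (g (ee k π) - g π) + (h (ee k π) - h π) := fun k => by ring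
        simp only [this, Finset.sum_add_distrib]
        ring
      map_smul' := by
        intro c g
        funext π
        simp only [Pi.smul_apply, smul_eq_mul, RingHom.id_apply, mul_add, Finset.mul_sum, mul_sub]
        congr 1
        apply Finset.sum_congr rfl
        intro ρ _
        ring }
  have hPt : ∀ g π, Pt g π = (∑ k, (g (ee k π) - g π)) + ∑ ρ, μ ρ * g ρ := fun _ _ => rfl
  have stat_iff : ∀ v : NCM n → ℂ, Stationary v ↔
      ∀ g : NCM n → ℂ, ∑ π, v π * ∑ k, (g (ee k π) - g π) = 0 := by
    intro v
    have e1 : ∀ (k : Fin (2 * n)) (π' π : NCM n), eRaw k π' = π.f ↔ ee k π' = π := by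
      intro k π' π
      rw [← ee_f]
      exact ⟨fun h => NCM.ext' h, fun h => by rw [h]⟩
    have e2 : ∀ g : NCM n → ℂ, ∑ π, v π * ∑ k, (g (ee k π) - g π) =
        ∑ π, g π * ((∑ k : Fin (2 * n), ∑ π', if eRaw k π' = π.f then v π' else 0) -
          ((2 * n : ℕ) : ℂ) * v π) := by
      intro g
      have a1 : ∀ π, v π * ∑ k, (g (ee k π) - g π) =
          (∑ k : Fin (2 * n), v π * g (ee k π)) - ((2 * n : ℕ) : ℂ) * v π * g π := by
        intro π
        rw [Finset.sum_sub_distrib, mul_sub, Finset.mul_sum]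
        simp
        ring
      rw [Finset.sum_congr rfl fun π _ => a1 π]
      simp only [mul_sub, Finset.sum_sub_distrib]
      congr 1
      · rw [Finset.sum_comm]
        simp only [Finset.mul_sum]
        rw [Finset.sum_comm (s := (Finset.univ : Finset (NCM n)))]
        apply Finset.sum_congr rfl
        intro k _
        rw [Finset.sum_comm]
        apply Finset.sum_congr rfl
        intro π' _
        simp only [e1]
        rw [Finset.sum_eq_single (ee k π')]
        · simp [mul_comm]
        · intro b _ hb
          rw [if_neg (fun h => hb h.symm), mul_zero]
        · simp
      · apply Finset.sum_congr rfl
        intro π _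
        ring
    constructor
    · intro h g
      rw [e2]
      apply Finset.sum_eq_zero
      intro π _
      rw [h π, sub_self, mul_zero]
    · intro h π
      have := h (Pi.single π 1)
      rw [e2, Finset.sum_eq_single π] at this
      · rw [Pi.single_eq_same, one_mul, sub_eq_zero] at this
        exact this.symm
      · intro b _ hb
        rw [Pi.single_eq_of_ne hb, zero_mul]
      · simp
  have hμ0 := (stat_iff μ).1 hstat
  -- surjectivity of `Pt`
  have hsurj : Function.Surjective Pt := by
    rw [← LinearMap.range_eq_top]
    by_contra hne
    obtain ⟨φ, hφ0, hφ⟩ := Submodule.exists_le_ker_of_lt_top _ (lt_top_iff_ne_top.2 hne)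
    let v : NCM n → ℂ := fun π => φ (Pi.single π 1)
    have hv : ∀ g, φ g = ∑ π, v π * g π := by
      intro g
      have : g = ∑ π, g π • (Pi.single π (1 : ℂ) : NCM n → ℂ) := by
        funext ρ
        rw [Finset.sum_apply, Finset.sum_eq_single ρ]
        · simp
        · intro b _ hb
          rw [Pi.smul_apply, Pi.single_eq_of_ne (Ne.symm hb), smul_zero]
        · simp
      conv_lhs => rw [this]
      rw [map_sum]
      apply Finset.sum_congr rfl
      intro π _
      rw [map_smul, smul_eq_mul, mul_comm]
    have hz : ∀ g : NCM n → ℂ, ∑ π, v π * ∑ k, (g (ee k π) - g π) + (∑ π, v π) * ∑ ρ, μ ρ * g ρ = 0 := by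
      intro g
      have : φ (Pt g) = 0 := hφ ⟨g, rfl⟩
      rw [hv] at this
      simp only [hPt, mul_add, Finset.sum_add_distrib] at this
      rw [Finset.sum_mul]
      exact this
    have hs0 : ∑ π, v π = 0 := by
      have := hz (fun _ => 1)
      simpa [hsum] using this
    have hst : Stationary v := by
      rw [stat_iff]
      intro g
      have := hz g
      rwa [hs0, zero_mul, add_zero] at this
    have hv0 : (fun π => μ π + v π) = μ := by
      apply huniq
      · rw [Finset.sum_add_distrib, hsum, hs0, add_zero]
      · rw [stat_iff]
        intro g
        simp only [add_mul, Finset.sum_add_distrib]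
        rw [hμ0, (stat_iff v).1 hst, add_zero]
    apply hφ0
    apply LinearMap.ext
    intro g
    rw [hv]
    simp only [LinearMap.zero_apply]
    apply Finset.sum_eq_zero
    intro π _
    have : μ π + v π = μ π := congrFun hv0 π
    have : v π = 0 := by linear_combination this
    rw [this, zero_mul]
  have hinj : Function.Injective Pt := LinearMap.injective_iff_surjective.2 hsurj
  -- the subspace of value vectors
  let G : Submodule ℂ (NCM n → ℂ) :=
    { carrier := {g | ∃ p, WW n p ∧ ∀ π, evalNC p π = g π}
      zero_mem' := ⟨0, WW.zero, fun π => by simp [evalNC_eq]⟩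
      add_mem' := by
        rintro g h ⟨p, hp, hg⟩ ⟨r, hr, hh⟩
        refine ⟨p + r, hp.add hr, fun π => ?_⟩
        rw [Pi.add_apply, ← hg, ← hh, evalNC_eq, map_add]; rfl
      smul_mem' := by
        rintro c g ⟨p, hp, hg⟩
        refine ⟨C c * p, hp.smul c, fun π => ?_⟩
        rw [Pi.smul_apply, ← hg, evalNC_eq, map_mul, eval_C]; rfl }
  have hT : ∀ p, WW n p → WW n (∑ k, TT k p) := fun p hp =>
    WW.sum _ _ fun k _ => (TT_spec k p).ww hp
  have hTe : ∀ p, WW n p → ∀ π, evalNC (∑ k, TT k p) π = ∑ k, (evalNC p (ee k π) - evalNC p π) := by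
    intro p hp π
    rw [evalNC_eq, map_sum]
    exact Finset.sum_congr rfl fun k _ => evalNC_TT k π p hp
  have comb : ∀ r, WW n r → ∀ c : ℂ, WW n ((∑ k, TT k r) + C c * p0) ∧
      ∀ π, evalNC ((∑ k, TT k r) + C c * p0) π = (∑ k, (evalNC r (ee k π) - evalNC r π)) + c := by
    intro r hr c
    refine ⟨(hT r hr).add (hp0.smul c), fun π => ?_⟩
    rw [← hTe r hr, evalNC_eq, map_add, map_mul, eval_C, ← evalNC_eq, ← evalNC_eq, h1, mul_one]
  have hG : ∀ g ∈ G, Pt g ∈ G := by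
    rintro g ⟨r, hr, hg⟩
    have hg' : g = fun π => evalNC r π := funext fun π => (hg π).symm
    subst hg'
    exact ⟨_, (comb r hr (∑ ρ, μ ρ * evalNC r ρ)).1, (comb r hr _).2⟩
  have hGs : Function.Surjective (Pt.restrict hG) := by
    apply LinearMap.injective_iff_surjective.1
    intro a b hab
    apply Subtype.ext
    apply hinj
    exact congrArg Subtype.val hab
  obtain ⟨⟨g, r, hr, hg⟩, hgr⟩ := hGs ⟨fun π => evalNC p π, p, hp, fun _ => rfl⟩
  have hg' : g = fun π => evalNC r π := funext fun π => (hg π).symm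
  subst hg'
  have hgr' : ∀ π, (∑ k, (evalNC r (ee k π) - evalNC r π)) + ∑ ρ, μ ρ * evalNC r ρ = evalNC p π :=
    fun π => congrFun (congrArg Subtype.val hgr) π
  set c := ∑ ρ, μ ρ * evalNC r ρ with hc
  have hcp : ∑ π, μ π * evalNC p π = c := by
    simp only [← hgr', mul_add, Finset.sum_add_distrib]
    rw [hμ0 (fun π => evalNC r π), ← Finset.sum_mul, hsum]
    ring
  have hfin : p = (∑ k, TT k r) + C c * p0 := by
    apply ww_eq hp (comb r hr c).1
    intro π
    rw [(comb r hr c).2, hgr']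
  rw [hcp]
  have h2 := evalOne_sum_TT r
  rw [hfin]
  unfold evalOne at *
  rw [map_add, h2, map_mul, eval_C, hA]
  ring

end WheelProof
namespace WheelProof

section Alternant
variable {N : ℕ} (e : Fin N → ℕ)

/-- the alternant matrix -/
def altM {R : Type*} [CommRing R] (e : Fin N → ℕ) (z : Fin N → R) : Matrix (Fin N) (Fin N) R :=
  Matrix.of fun i j => z i ^ e j

lemma alt_map {R S : Type*} [CommRing R] [CommRing S] (φ : R →+* S) (z : Fin N → R) :
    φ (altM e z).det = (altM e (fun i => φ (z i))).det := by
  rw [RingHom.map_det]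
  congr 1
  ext i j
  simp [altM]

lemma vdm_map {R S : Type*} [CommRing R] [CommRing S] (φ : R →+* S) (z : Fin N → R) :
    φ (Matrix.vandermonde z).det = (Matrix.vandermonde (fun i => φ (z i))).det := by
  rw [RingHom.map_det]
  congr 1
  ext i j
  simp [Matrix.vandermonde_apply]

lemma alt_dvd : (Matrix.vandermonde (X : Fin N → MvPolynomial (Fin N) ℂ)).det ∣
    (altM e (X : Fin N → MvPolynomial (Fin N) ℂ)).det := by
  classical
  rw [Matrix.det_vandermonde, Finset.prod_sigma']
  apply prod_dvd_of_forall (g := fun x => Function.update X x.2 (X x.1))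
  · rintro ⟨i, j⟩ hx f hf
    exact dvd_of_aeval_update _ _ _ hf
  · rintro ⟨i, j⟩ hx ⟨i', j'⟩ hx' hne h0
    simp only [Finset.mem_sigma, Finset.mem_univ, Finset.mem_Ioi, true_and] at hx hx'
    rw [aeval_eq_zero_iff] at h0
    have h1 := h0 (fun l => ((l : ℕ) : ℂ))
    simp only [map_sub, eval_X, sub_eq_zero] at h1
    have hv : ∀ l : Fin N, eval (fun l : Fin N => ((l : ℕ) : ℂ))
        (Function.update X j (X i) l : MvPolynomial (Fin N) ℂ) =
        ((if l = j then (i : ℕ) else (l : ℕ) : ℕ) : ℂ) := by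
      intro l
      by_cases hl : l = j
      · subst hl; simp
      · simp [Function.update_of_ne hl, hl]
    rw [hv, hv] at h1
    have h2 : (if j' = j then (i : ℕ) else (j' : ℕ)) = if i' = j then (i : ℕ) else (i' : ℕ) := by
      exact_mod_cast h1
    rw [Fin.lt_def] at hx hx'
    have hne' : ¬ (i = i' ∧ j = j') := by
      rintro ⟨rfl, rfl⟩; exact hne rfl
    simp only [Fin.ext_iff] at hne' h2
    split_ifs at h2 <;> omega
  · rintro ⟨i, j⟩ hx
    simp only [Finset.mem_sigma, Finset.mem_univ, Finset.mem_Ioi, true_and] at hx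
    have := alt_map e ((aeval (Function.update X j (X i)) :
      MvPolynomial (Fin N) ℂ →ₐ[ℂ] MvPolynomial (Fin N) ℂ) :
      MvPolynomial (Fin N) ℂ →+* MvPolynomial (Fin N) ℂ) X
    simp only [RingHom.coe_coe, aeval_X] at this
    simp only
    rw [this]
    apply Matrix.det_zero_of_row_eq (ne_of_lt hx)
    funext l
    simp only [altM, Matrix.of_apply]
    rw [Function.update_self, Function.update_of_ne (ne_of_lt hx)]

/-- the quotient of the alternant by the Vandermonde -/
noncomputable def p0 : MvPolynomial (Fin N) ℂ := (alt_dvd e).choose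

lemma p0_spec : (altM e (X : Fin N → MvPolynomial (Fin N) ℂ)).det =
    (Matrix.vandermonde (X : Fin N → MvPolynomial (Fin N) ℂ)).det * p0 e := (alt_dvd e).choose_spec

lemma p0_aeval {R : Type*} [CommRing R] [Algebra ℂ R] (z : Fin N → R) :
    (altM e z).det = (Matrix.vandermonde z).det * aeval z (p0 e) := by
  have h := congrArg ((aeval z : MvPolynomial (Fin N) ℂ →ₐ[ℂ] R) : MvPolynomial (Fin N) ℂ →+* R)
    (p0_spec e)
  rw [map_mul, alt_map, vdm_map] at h
  simpa using h

lemma p0_eval (z : Fin N → ℂ) :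
    (altM e z).det = (Matrix.vandermonde z).det * eval z (p0 e) := p0_aeval e z

lemma vdm_ne : (Matrix.vandermonde (X : Fin N → MvPolynomial (Fin N) ℂ)).det ≠ 0 := by
  rw [Matrix.det_vandermonde_ne_zero_iff]
  exact X_injective

lemma p0_symm (σ : Equiv.Perm (Fin N)) (z : Fin N → ℂ) :
    eval (z ∘ σ) (p0 e) = eval z (p0 e) := by
  have h1 := p0_aeval e (R := MvPolynomial (Fin N) ℂ) (X ∘ σ)
  have ha : (altM e (X ∘ σ : Fin N → MvPolynomial (Fin N) ℂ)).det =
      (Equiv.Perm.sign σ : ℤ) * (altM e (X : Fin N → MvPolynomial (Fin N) ℂ)).det := by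
    rw [← Matrix.det_permute]; rfl
  have hv : (Matrix.vandermonde (X ∘ σ : Fin N → MvPolynomial (Fin N) ℂ)).det =
      (Equiv.Perm.sign σ : ℤ) * (Matrix.vandermonde (X : Fin N → MvPolynomial (Fin N) ℂ)).det := by
    rw [← Matrix.det_permute]; rfl
  have hs : ((Equiv.Perm.sign σ : ℤ) : MvPolynomial (Fin N) ℂ) ≠ 0 := by
    rcases Int.units_eq_one_or (Equiv.Perm.sign σ) with h | h <;> rw [h] <;> simp
  rw [ha, hv, p0_spec, mul_assoc] at h1
  have h2 := mul_left_cancel₀ vdm_ne (mul_left_cancel₀ hs h1)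
  have h3 := congrArg (eval z) h2
  rw [eval_aeval'] at h3
  rw [h3]
  congr 2
  funext l
  simp

lemma totalDegree_alt : (altM e (X : Fin N → MvPolynomial (Fin N) ℂ)).det.totalDegree ≤ ∑ j, e j := by
  rw [Matrix.det_apply']
  apply totalDegree_finsetSum_le
  intro σ _
  refine (totalDegree_mul _ _).trans ?_
  have h1 : (((Equiv.Perm.sign σ : ℤ)) : MvPolynomial (Fin N) ℂ).totalDegree = 0 := by
    rcases Int.units_eq_one_or (Equiv.Perm.sign σ) with h | h <;> rw [h] <;> simp
  rw [h1, zero_add]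
  refine (totalDegree_finset_prod _ _).trans ?_
  apply Finset.sum_le_sum
  intro i _
  simp [altM]

lemma totalDegree_vdm :
    (Matrix.vandermonde (X : Fin N → MvPolynomial (Fin N) ℂ)).det.totalDegree = ∑ i ∈ Finset.range N, i := by
  rw [Matrix.det_vandermonde, Finset.prod_sigma', totalDegree_prod_of_ne]
  · rw [Finset.sum_congr rfl (g := fun _ => 1)]
    · rw [← Finset.card_eq_sum_ones, Finset.card_sigma]
      simp only [Fin.card_Ioi]
      rw [← Finset.sum_range_reflect, Finset.sum_range]
    · rintro ⟨i, j⟩ hx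
      simp only [Finset.mem_sigma, Finset.mem_univ, Finset.mem_Ioi, true_and] at hx
      exact (totalDegree_X_sub (ne_of_gt hx)).2
  · rintro ⟨i, j⟩ hx
    simp only [Finset.mem_sigma, Finset.mem_univ, Finset.mem_Ioi, true_and] at hx
    exact (totalDegree_X_sub (ne_of_gt hx)).1

lemma p0_degree : ∑ i ∈ Finset.range N, i + (p0 e).totalDegree ≤ ∑ j, e j ∨ p0 e = 0 := by
  by_cases h : p0 e = 0
  · right; exact h
  · left
    rw [← totalDegree_vdm, ← totalDegree_mul_of_isDomain vdm_ne h, ← p0_spec]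
    exact totalDegree_alt e

lemma p0_wheel (he : ∀ j, ∃ m, e j = 3 * m ∨ e j = 3 * m + 1) : Wh Finset.univ (p0 e) := by
  intro a _ b _ c _ hab hbc
  apply locus_cancel hab hbc (Matrix.vandermonde (X : Fin N → MvPolynomial (Fin N) ℂ)).det
  · intro z hb hc
    rw [← p0_spec, alt_map]
    simp only [eval_X]
    rw [← Matrix.exists_vecMul_eq_zero_iff]
    refine ⟨Pi.single a 1 + Pi.single b (q ^ 2) + Pi.single c q, ?_, ?_⟩
    · intro h
      have h1 := congrFun h a
      have n1 : a ≠ b := ne_of_lt hab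
      have n2 : a ≠ c := ne_of_lt (hab.trans hbc)
      simp [Pi.single_eq_of_ne n1, Pi.single_eq_of_ne n2] at h1
    · funext j
      simp only [Matrix.add_vecMul, Matrix.single_vecMul, Pi.add_apply, Pi.smul_apply,
        Matrix.row_apply, altM, Matrix.of_apply, smul_eq_mul, Pi.zero_apply]
      rw [hb, hc, mul_pow, mul_pow]
      obtain ⟨m, hm | hm⟩ := he j
      · have q1 : q ^ e j = 1 := by rw [hm, pow_mul, q_cube, one_pow]
        rw [← pow_mul, mul_comm 2, pow_mul, q1]
        linear_combination (z a ^ e j) * q_quad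
      · have q1 : q ^ e j = q := by rw [hm, pow_succ, pow_mul, q_cube, one_pow, one_mul]
        rw [← pow_mul, mul_comm 2, pow_mul, q1]
        linear_combination (z a ^ e j) * q_quad + (z a ^ e j) * q * q_cube
  · obtain ⟨z, h1, h2, h3, -⟩ := exists_generic hab hbc 0
    refine ⟨z, h1, h2, ?_⟩
    rw [vdm_map]
    simp only [eval_X]
    exact Matrix.det_vandermonde_ne_zero_iff.2 h3

end Alternant

lemma vdm_range {R : Type*} [CommRing R] (N : ℕ) (v : ℕ → R) :
    (Matrix.vandermonde (fun i : Fin N => v i)).det =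
      ∏ j ∈ Finset.range N, ∏ i ∈ Finset.range j, (v j - v i) := by
  rw [Matrix.det_vandermonde]
  rw [Finset.prod_comm' (s' := fun j => Finset.Iio j) (t' := Finset.univ)]
  · rw [Finset.prod_range]
    apply Finset.prod_congr rfl
    intro j _
    rw [← Nat.Iio_eq_range, ← Fin.map_valEmbedding_Iio, Finset.prod_map]
    rfl
  · intro x y; simp

lemma vdm_split {R : Type*} [CommRing R] (n : ℕ) (v : ℕ → R) :
    ∏ j ∈ Finset.range (2 * n), ∏ i ∈ Finset.range j, (v j - v i) =
      (∏ j ∈ Finset.range n, ∏ i ∈ Finset.range j, (v j - v i)) *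
      (∏ j ∈ Finset.range n, ∏ i ∈ Finset.range j, (v (n + j) - v (n + i))) *
      (∏ j ∈ Finset.range n, ∏ i ∈ Finset.range n, (v (n + j) - v i)) := by
  rw [two_mul, Finset.prod_range_add]
  simp only [Finset.prod_range_add, Finset.prod_mul_distrib]
  ring

end WheelProof
namespace WheelProof

/-- exponents -/
def ev (n i : ℕ) : ℕ := if i < n then 3 * i else 3 * (i - n) + 1

/-- the exponent vector on `Fin (2n)` -/
def ex (n : ℕ) (j : Fin (2 * n)) : ℕ := ev n j

/-- splitting of the index set -/
def psi (n : ℕ) : Fin n ⊕ Fin n ≃ Fin (2 * n) :=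
  finSumFinEquiv.trans (finCongr (two_mul n).symm)

lemma psi_inl (n : ℕ) (a : Fin n) : (psi n (Sum.inl a) : ℕ) = a := by simp [psi]

lemma psi_inr (n : ℕ) (a : Fin n) : (psi n (Sum.inr a) : ℕ) = n + a := by
  simp [psi]
  omega

lemma ev_inl {n i : ℕ} (h : i < n) : ev n i = 3 * i := by rw [ev, if_pos h]

lemma ev_inr (n i : ℕ) : ev n (n + i) = 3 * i + 1 := by
  rw [ev, if_neg (by omega)]; congr 2; omega

lemma det_two_block {R : Type*} [CommRing R] {n : ℕ} (A B : Matrix (Fin n) (Fin n) R) (c d : R) :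
    (Matrix.fromBlocks A (c • B) A (d • B)).det = (d - c) ^ n * A.det * B.det := by
  have h : Matrix.fromBlocks A (c • B) A (d • B) =
      Matrix.fromBlocks 1 0 1 1 * Matrix.fromBlocks A (c • B) 0 ((d - c) • B) := by
    rw [Matrix.fromBlocks_multiply]
    simp only [Matrix.one_mul, Matrix.zero_mul, Matrix.mul_zero, add_zero]
    rw [sub_smul, add_sub_cancel]
  rw [h, Matrix.det_mul, Matrix.det_fromBlocks_zero₁₂, Matrix.det_fromBlocks_zero₂₁,
    Matrix.det_smul]
  simp
  ring

lemma alt_two_block {R : Type*} [CommRing R] (n : ℕ) (x : ℕ → R) (c d : R) (hc : c ^ 3 = 1)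
    (hd : d ^ 3 = 1) :
    (altM (ex n) (fun i : Fin (2 * n) => if (i : ℕ) < n then c * x i else d * x (i - n))).det =
      (d - c) ^ n * (∏ a ∈ Finset.range n, x a) *
        (∏ j ∈ Finset.range n, ∏ i ∈ Finset.range j, (x j ^ 3 - x i ^ 3)) ^ 2 := by
  set A : Matrix (Fin n) (Fin n) R := Matrix.vandermonde (fun a : Fin n => x a ^ 3) with hA
  set B : Matrix (Fin n) (Fin n) R := Matrix.diagonal (fun a : Fin n => x a) * A with hB
  have hBe : ∀ a b : Fin n, B a b = x a ^ (3 * (b : ℕ) + 1) := by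
    intro a b
    rw [hB, Matrix.diagonal_mul, hA, Matrix.vandermonde_apply]
    ring
  have hAe : ∀ a b : Fin n, A a b = x a ^ (3 * (b : ℕ)) := by
    intro a b
    rw [hA, Matrix.vandermonde_apply]
    ring
  have hc3 : ∀ m, c ^ (3 * m) = 1 := fun m => by rw [pow_mul, hc, one_pow]
  have hd3 : ∀ m, d ^ (3 * m) = 1 := fun m => by rw [pow_mul, hd, one_pow]
  rw [← Matrix.det_submatrix_equiv_self (psi n)]
  have hM : (altM (ex n) (fun i : Fin (2 * n) =>
      if (i : ℕ) < n then c * x i else d * x (i - n))).submatrix (psi n) (psi n) =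
      Matrix.fromBlocks A (c • B) A (d • B) := by
    ext i j
    rcases i with i | i <;> rcases j with j | j <;>
      simp only [Matrix.submatrix_apply, altM, Matrix.of_apply, ex, psi_inl, psi_inr,
        ev_inl j.isLt, ev_inr, Matrix.fromBlocks_apply₁₁, Matrix.fromBlocks_apply₁₂,
        Matrix.fromBlocks_apply₂₁, Matrix.fromBlocks_apply₂₂, Matrix.smul_apply, hAe, hBe,
        smul_eq_mul, if_pos i.isLt, mul_pow, hc3, hd3, pow_succ, Nat.add_sub_cancel_left,
        if_neg (show ¬ (n + (i : ℕ) < n) by omega)] <;> ring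
  rw [hM, det_two_block, hB, Matrix.det_mul, Matrix.det_diagonal, hA,
    vdm_range n (fun a => x a ^ 3), Finset.prod_range x]
  ring

lemma vdm_two_block {R : Type*} [CommRing R] (n : ℕ) (x : ℕ → R) (c d : R) (hcd : c * d = 1)
    (hc : c ^ 2 = d) (hd : d ^ 2 = c) (hs : 1 + c + d = 0) :
    (Matrix.vandermonde
      (fun i : Fin (2 * n) => if (i : ℕ) < n then c * x i else d * x (i - n))).det =
      (∏ j ∈ Finset.range n, ∏ i ∈ Finset.range j, (x j - x i)) ^ 2 *
        ((d - c) ^ n * (∏ a ∈ Finset.range n, x a) *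
        (∏ j ∈ Finset.range n, ∏ i ∈ Finset.range j, -(x j ^ 2 + x j * x i + x i ^ 2))) := by
  have h1 := vdm_range (2 * n) (fun i => if i < n then c * x i else d * x (i - n))
  rw [h1, vdm_split]
  have e1 : ∏ j ∈ Finset.range n, ∏ i ∈ Finset.range j,
      ((if j < n then c * x j else d * x (j - n)) - (if i < n then c * x i else d * x (i - n))) =
      ∏ j ∈ Finset.range n, ∏ i ∈ Finset.range j, (c * (x j - x i)) := by
    apply Finset.prod_congr rfl
    intro j hj
    apply Finset.prod_congr rfl
    intro i hi
    rw [Finset.mem_range] at hi hj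
    rw [if_pos hj, if_pos (hi.trans hj), mul_sub]
  have e2 : ∏ j ∈ Finset.range n, ∏ i ∈ Finset.range j,
      ((if n + j < n then c * x (n + j) else d * x (n + j - n)) -
        (if n + i < n then c * x (n + i) else d * x (n + i - n))) =
      ∏ j ∈ Finset.range n, ∏ i ∈ Finset.range j, (d * (x j - x i)) := by
    apply Finset.prod_congr rfl
    intro j hj
    apply Finset.prod_congr rfl
    intro i hi
    rw [if_neg (by omega), if_neg (by omega), Nat.add_sub_cancel_left, Nat.add_sub_cancel_left,
      mul_sub]
  have e3 : ∏ j ∈ Finset.range n, ∏ i ∈ Finset.range n,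
      ((if n + j < n then c * x (n + j) else d * x (n + j - n)) -
        (if i < n then c * x i else d * x (i - n))) =
      ∏ j ∈ Finset.range n, ∏ i ∈ Finset.range n, (d * x j - c * x i) := by
    apply Finset.prod_congr rfl
    intro j hj
    apply Finset.prod_congr rfl
    intro i hi
    rw [Finset.mem_range] at hi
    rw [if_neg (by omega), if_pos hi, Nat.add_sub_cancel_left]
  have e4 : ∀ n : ℕ, ∏ j ∈ Finset.range n, ∏ i ∈ Finset.range n, (d * x j - c * x i) =
      (d - c) ^ n * (∏ a ∈ Finset.range n, x a) *
        (∏ j ∈ Finset.range n, ∏ i ∈ Finset.range j, -(x j ^ 2 + x j * x i + x i ^ 2)) := by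
    intro n
    induction n with
    | zero => simp
    | succ n ih =>
      rw [Finset.prod_range_succ]
      simp only [Finset.prod_range_succ _ n]
      rw [Finset.prod_mul_distrib, ih]
      have : (∏ i ∈ Finset.range n, -(x n ^ 2 + x n * x i + x i ^ 2)) =
          (∏ i ∈ Finset.range n, (d * x i - c * x n)) * ∏ i ∈ Finset.range n, (d * x n - c * x i) := by
        rw [← Finset.prod_mul_distrib]
        apply Finset.prod_congr rfl
        intro i _
        linear_combination (-(x i * x n)) * hd - (x i * x n) * hc
          + (x n ^ 2 + x i ^ 2) * hcd + (-x n * x i) * hs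
      rw [this]
      ring
  rw [e1, e2, e3, e4]
  congr 1
  rw [sq, ← Finset.prod_mul_distrib, ← Finset.prod_mul_distrib]
  apply Finset.prod_congr rfl
  intro j _
  rw [← Finset.prod_mul_distrib, ← Finset.prod_mul_distrib]
  apply Finset.prod_congr rfl
  intro i _
  linear_combination ((x j - x i) ^ 2) * hcd

/-- the common value at matchings -/
noncomputable def kap (n : ℕ) : ℂ := ∏ j ∈ Finset.range n, ∏ _i ∈ Finset.range j, (-3 : ℂ)

lemma kap_ne (n : ℕ) : kap n ≠ 0 := by
  unfold kap
  simp only [Finset.prod_ne_zero_iff]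
  intro _ _ _ _
  norm_num

lemma cube_prod {R : Type*} [CommRing R] (n : ℕ) (x : ℕ → R) :
    (∏ j ∈ Finset.range n, ∏ i ∈ Finset.range j, (x j ^ 3 - x i ^ 3)) ^ 2 =
    ((∏ j ∈ Finset.range n, ∏ i ∈ Finset.range j, (x j - x i)) *
      (∏ j ∈ Finset.range n, ∏ i ∈ Finset.range j, -(x j ^ 2 + x j * x i + x i ^ 2))) ^ 2 := by
  rw [← Finset.prod_mul_distrib, ← Finset.prod_pow, ← Finset.prod_pow]
  apply Finset.prod_congr rfl
  intro j _
  rw [← Finset.prod_mul_distrib, ← Finset.prod_pow, ← Finset.prod_pow]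
  apply Finset.prod_congr rfl
  intro i _
  ring

lemma p0_std (n : ℕ) :
    eval (fun i : Fin (2 * n) => if (i : ℕ) < n then q⁻¹ else q) (p0 (ex n)) = kap n := by
  have hq1 : q⁻¹ * q = 1 := inv_mul_cancel₀ q_ne_zero
  have hq2 : q⁻¹ ^ 2 = q := by rw [q_inv, ← pow_mul, q_four]
  have hq3 : q ^ 2 = q⁻¹ := q_inv.symm
  have hq4 : 1 + q⁻¹ + q = 0 := by rw [q_inv]; linear_combination q_quad
  have hq5 : q⁻¹ ^ 3 = 1 := by rw [inv_pow, q_cube, inv_one]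
  have h := p0_aeval (ex n) (R := MvPolynomial ℕ ℂ)
    (fun i : Fin (2 * n) => if (i : ℕ) < n then C q⁻¹ * X (i : ℕ) else C q * X ((i : ℕ) - n))
  rw [alt_two_block n X (C q⁻¹) (C q) (by rw [← C_pow, hq5, C_1]) (by rw [← C_pow, q_cube, C_1]),
    vdm_two_block n X (C q⁻¹) (C q) (by rw [← C_mul, hq1, C_1]) (by rw [← C_pow, hq2])
      (by rw [← C_pow, hq3]) (by rw [← C_1, ← C_add, ← C_add, hq4, C_0])] at h
  set P : MvPolynomial ℕ ℂ := ∏ j ∈ Finset.range n, ∏ i ∈ Finset.range j, (X j - X i) with hP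
  set S : MvPolynomial ℕ ℂ := ∏ j ∈ Finset.range n, ∏ i ∈ Finset.range j,
    -(X j ^ 2 + X j * X i + X i ^ 2) with hS
  set Y : MvPolynomial ℕ ℂ := ∏ a ∈ Finset.range n, X a with hY
  rw [cube_prod n (X : ℕ → MvPolynomial ℕ ℂ), ← hP, ← hS] at h
  have hne : P ^ 2 * ((C q - C q⁻¹) ^ n * Y * S) ≠ 0 := by
    intro h0
    have h1 := congrArg (eval (fun a : ℕ => ((a : ℂ) + 1))) h0
    rw [map_zero] at h1
    revert h1
    simp only [hP, hS, hY, map_mul, map_pow, map_prod, map_sub, map_neg, map_add, eval_X, eval_C]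
    refine mul_ne_zero (pow_ne_zero _ ?_) (mul_ne_zero (mul_ne_zero (pow_ne_zero _ ?_) ?_) ?_)
    · simp only [Finset.prod_ne_zero_iff, Finset.mem_range]
      intro j _ i hi h2
      have : (j : ℂ) = i := by linear_combination h2
      have : j = i := by exact_mod_cast this
      omega
    · rw [q_inv, sub_ne_zero]; exact q_sq_ne_q.symm
    · simp only [Finset.prod_ne_zero_iff]
      intro j _
      exact Nat.cast_add_one_ne_zero j
    · simp only [Finset.prod_ne_zero_iff]
      intro j _ i _ h2
      rw [neg_eq_zero] at h2
      have h3 : (((j + 1) ^ 2 + (j + 1) * (i + 1) + (i + 1) ^ 2 : ℕ) : ℂ) = 0 := by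
        push_cast; exact h2
      rw [Nat.cast_eq_zero] at h3
      have : 0 < (j + 1) ^ 2 := by positivity
      omega
  have h2 : aeval (fun i : Fin (2 * n) => if (i : ℕ) < n then C q⁻¹ * X (i : ℕ)
      else C q * X ((i : ℕ) - n)) (p0 (ex n)) = S := by
    apply mul_left_cancel₀ hne
    rw [← h]
    ring
  have h3 := congrArg (eval (fun _ : ℕ => (1 : ℂ))) h2
  rw [eval_aeval'] at h3
  have h4 : eval (fun _ : ℕ => (1 : ℂ)) S = kap n := by
    simp only [hS, map_mul, map_pow, map_prod, map_neg, map_add, eval_X, kap]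
    norm_num
  rw [h4] at h3
  rw [← h3]
  congr 2
  funext i
  split_ifs <;> simp

lemma card_open {n : ℕ} (π : NCM n) :
    (Finset.univ.filter fun k : Fin (2 * n) => k < π.f k).card = n := by
  have h1 : (Finset.univ.filter fun k : Fin (2 * n) => k < π.f k).card =
      (Finset.univ.filter fun k : Fin (2 * n) => ¬ k < π.f k).card := by
    apply Finset.card_nbij' π.f π.f
    · intro k hk
      simp only [Finset.coe_filter, Finset.mem_univ, true_and, Set.mem_ofPred_eq] at hk ⊢
      rw [π.invol]; exact not_lt.2 hk.le
    · intro k hk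
      simp only [Finset.coe_filter, Finset.mem_univ, true_and, Set.mem_ofPred_eq] at hk ⊢
      rw [π.invol]; exact lt_of_le_of_ne (not_lt.1 hk) (π.nofix k)
    · intro k _; exact π.invol k
    · intro k _; exact π.invol k
  have h2 := Finset.card_filter_add_card_filter_not (s := (Finset.univ : Finset (Fin (2 * n))))
    (fun k => k < π.f k)
  rw [Finset.card_univ, Fintype.card_fin] at h2
  omega

lemma card_std (n : ℕ) :
    (Finset.univ.filter fun k : Fin (2 * n) => (k : ℕ) < n).card = n := by
  have : (Finset.univ.filter fun k : Fin (2 * n) => (k : ℕ) < n).map Fin.valEmbedding =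
      Finset.range n := by
    ext x
    simp only [Finset.mem_map, Finset.mem_filter, Finset.mem_univ, true_and, Finset.mem_range]
    constructor
    · rintro ⟨a, h, rfl⟩; exact h
    · intro h
      exact ⟨⟨x, by omega⟩, h, rfl⟩
  rw [← Finset.card_map Fin.valEmbedding, this, Finset.card_range]

lemma p0_evalNC (n : ℕ) (π : NCM n) : evalNC (p0 (ex n)) π = kap n := by
  have hc : Fintype.card {k : Fin (2 * n) // k < π.f k} =
      Fintype.card {k : Fin (2 * n) // (k : ℕ) < n} := by
    rw [Fintype.card_subtype, Fintype.card_subtype, card_open, card_std]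
  let E := Fintype.equivOfCardEq hc
  let s := E.extendSubtype
  rw [← p0_std, evalNC_eq,
    ← p0_symm (ex n) s (fun i : Fin (2 * n) => if (i : ℕ) < n then q⁻¹ else q)]
  congr 2
  funext k
  simp only [Function.comp_apply]
  unfold sgn
  by_cases h : k < π.f k
  · rw [if_pos h, if_pos (Equiv.extendSubtype_mem E k h)]
  · rw [if_neg h, if_neg (Equiv.extendSubtype_not_mem E k h)]

end WheelProof
namespace WheelProof

/-- q-integers as polynomials -/
noncomputable def GG (m : ℕ) : Polynomial ℂ := ∑ k ∈ Finset.range m, Polynomial.X ^ k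

lemma GG_sub (a b : ℕ) : (Polynomial.X ^ a - Polynomial.X ^ b : Polynomial ℂ) =
    (Polynomial.X - 1) * (GG a - GG b) := by
  have h1 := geom_sum_mul (Polynomial.X : Polynomial ℂ) a
  have h2 := geom_sum_mul (Polynomial.X : Polynomial ℂ) b
  unfold GG
  linear_combination h2 - h1

lemma GG_eval (a : ℕ) : (GG a).eval 1 = a := by
  simp [GG, Polynomial.eval_finset_sum]

lemma p0_one_mul (n : ℕ) :
    (∏ j ∈ Finset.range (2 * n), ∏ i ∈ Finset.range j, ((j : ℂ) - i)) * evalOne (p0 (ex n)) =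
      ∏ j ∈ Finset.range (2 * n), ∏ i ∈ Finset.range j, ((ev n j : ℂ) - ev n i) := by
  have h := p0_aeval (ex n) (R := Polynomial ℂ) (fun i : Fin (2 * n) => Polynomial.X ^ (i : ℕ))
  have hM : altM (ex n) (fun i : Fin (2 * n) => (Polynomial.X ^ (i : ℕ) : Polynomial ℂ)) =
      (Matrix.vandermonde (fun i : Fin (2 * n) =>
        (Polynomial.X ^ (ev n i) : Polynomial ℂ))).transpose := by
    ext1 i j
    simp only [altM, Matrix.of_apply, Matrix.transpose_apply, Matrix.vandermonde_apply, ex]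
    rw [← pow_mul, ← pow_mul, mul_comm]
  rw [hM, Matrix.det_transpose, vdm_range (2 * n) (fun i => (Polynomial.X ^ (ev n i) : Polynomial ℂ)),
    vdm_range (2 * n) (fun i => (Polynomial.X ^ i : Polynomial ℂ))] at h
  simp only [GG_sub, Finset.prod_mul_distrib] at h
  have hK : (∏ j ∈ Finset.range (2 * n), ∏ _i ∈ Finset.range j, (Polynomial.X - 1 : Polynomial ℂ)) ≠ 0 := by
    simp only [Finset.prod_ne_zero_iff]
    intro _ _ _ _
    exact Polynomial.X_sub_C_ne_zero (1 : ℂ)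
  rw [mul_assoc] at h
  have h2 := mul_left_cancel₀ hK h
  have h3 := congrArg (Polynomial.evalRingHom (1 : ℂ)) h2
  have h4 : Polynomial.evalRingHom (1 : ℂ) (aeval (fun i : Fin (2 * n) =>
      (Polynomial.X ^ (i : ℕ) : Polynomial ℂ)) (p0 (ex n))) = evalOne (p0 (ex n)) := by
    have : ((Polynomial.aeval (1 : ℂ)).comp (aeval (fun i : Fin (2 * n) =>
      (Polynomial.X ^ (i : ℕ) : Polynomial ℂ)))) = aeval (fun _ : Fin (2 * n) => (1 : ℂ)) := by
      apply MvPolynomial.algHom_ext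
      intro i
      simp
    have h5 := AlgHom.congr_fun this (p0 (ex n))
    simp [Polynomial.aeval_def, Polynomial.eval₂_eq_eval_map, aeval_eq_eval] at h5
    exact h5
  rw [map_mul, h4] at h3
  simp only [map_prod, map_sub, Polynomial.coe_evalRingHom, GG_eval] at h3
  exact h3.symm

lemma num_step (n : ℕ) :
    (∏ a ∈ Finset.range n, (3 * (n : ℂ) + 1 - 3 * a)) *
      (∏ b ∈ Finset.range n, (3 * (b : ℂ) + 1 - 3 * n)) * (3 ^ n * n.factorial) =
    (-1) ^ n * (3 * n + 1).factorial := by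
  have h1 : (∏ a ∈ Finset.range n, (3 * (n : ℂ) + 1 - 3 * a)) =
      ∏ c ∈ Finset.range n, (3 * ((c : ℂ) + 1) + 1) := by
    rw [← Finset.prod_range_reflect]
    apply Finset.prod_congr rfl
    intro c hc
    rw [Finset.mem_range] at hc
    have : ((n - 1 - c : ℕ) : ℂ) = n - 1 - c := by
      rw [Nat.cast_sub (by omega), Nat.cast_sub (by omega)]; simp
    rw [this]; ring
  have h2 : (∏ b ∈ Finset.range n, (3 * (b : ℂ) + 1 - 3 * n)) =
      ∏ c ∈ Finset.range n, (1 - 3 * ((c : ℂ) + 1)) := by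
    rw [← Finset.prod_range_reflect]
    apply Finset.prod_congr rfl
    intro c hc
    rw [Finset.mem_range] at hc
    have : ((n - 1 - c : ℕ) : ℂ) = n - 1 - c := by
      rw [Nat.cast_sub (by omega), Nat.cast_sub (by omega)]; simp
    rw [this]; ring
  rw [h1, h2]
  clear h1 h2
  induction n with
  | zero => simp
  | succ n ih =>
    rw [Finset.prod_range_succ, Finset.prod_range_succ]
    have e : 3 * (n + 1) + 1 = (3 * n + 1) + 1 + 1 + 1 := by ring
    rw [e, Nat.factorial_succ (3 * n + 1 + 1 + 1), Nat.factorial_succ (3 * n + 1 + 1),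
      Nat.factorial_succ (3 * n + 1), Nat.factorial_succ n]
    push_cast
    rw [pow_succ, pow_succ]
    linear_combination (-(3 * (n : ℂ) + 2) * (3 * n + 3) * (3 * n + 4)) * ih

lemma sub_prod (n : ℕ) : ∏ a ∈ Finset.range n, (3 * (n : ℂ) - 3 * a) = 3 ^ n * n.factorial := by
  have h1 : (∏ a ∈ Finset.range n, (3 * (n : ℂ) - 3 * a)) =
      ∏ c ∈ Finset.range n, (3 * ((c : ℂ) + 1)) := by
    rw [← Finset.prod_range_reflect]
    apply Finset.prod_congr rfl
    intro c hc
    rw [Finset.mem_range] at hc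
    have : ((n - 1 - c : ℕ) : ℂ) = n - 1 - c := by
      rw [Nat.cast_sub (by omega), Nat.cast_sub (by omega)]; simp
    rw [this]; ring
  rw [h1, Finset.prod_mul_distrib]
  simp only [Finset.prod_const, Finset.card_range]
  congr 1
  rw [← Finset.prod_range_add_one_eq_factorial]
  push_cast
  rfl

lemma fact_prod (n : ℕ) : ∏ i ∈ Finset.range n, ((n : ℂ) - i) = n.factorial := by
  have h := sub_prod n
  have h3 : (3 : ℂ) ^ n ≠ 0 := pow_ne_zero _ (by norm_num)
  apply mul_left_cancel₀ h3
  rw [← h]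
  have : ∀ a : ℕ, (3 * (n : ℂ) - 3 * a) = 3 * (n - a) := fun a => by ring
  simp only [this]
  rw [Finset.prod_mul_distrib]
  simp

lemma num_main (n : ℕ) :
    (∏ j ∈ Finset.range n, ∏ i ∈ Finset.range j, (3 * (j : ℂ) - 3 * i)) ^ 2 *
      (∏ j ∈ Finset.range n, ∏ i ∈ Finset.range n, (3 * (j : ℂ) + 1 - 3 * i)) =
    kap n * ∏ j ∈ Finset.range n, (((3 * j + 1).factorial : ℂ) * j.factorial) := by
  unfold kap
  simp only [sub_prod, Finset.prod_const, Finset.card_range]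
  induction n with
  | zero => simp
  | succ n ih =>
    simp only [Finset.prod_range_succ _ n, Finset.prod_mul_distrib]
    simp only [Finset.prod_mul_distrib] at ih
    have h := num_step n
    have h2 : ((-3 : ℂ)) ^ n = (-1) ^ n * 3 ^ n := by rw [← mul_pow]; norm_num
    rw [h2]
    linear_combination (((-1 : ℂ)) ^ n * 3 ^ n * (3 * n + 1).factorial * n.factorial) * ih +
      (((∏ j ∈ Finset.range n, (3 : ℂ) ^ j) * (∏ j ∈ Finset.range n, (j.factorial : ℂ))) ^ 2 *
        (∏ j ∈ Finset.range n, ∏ i ∈ Finset.range n, (3 * (j : ℂ) + 1 - 3 * i)) *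
        (3 ^ n * n.factorial)) * h

lemma p0_one (n : ℕ) : evalOne (p0 (ex n)) = kap n * ASM n := by
  have h := p0_one_mul n
  rw [vdm_split n (fun i => (ev n i : ℂ))] at h
  have e1 : ∏ j ∈ Finset.range n, ∏ i ∈ Finset.range j, ((ev n j : ℂ) - ev n i) =
      ∏ j ∈ Finset.range n, ∏ i ∈ Finset.range j, (3 * (j : ℂ) - 3 * i) := by
    apply Finset.prod_congr rfl
    intro j hj
    apply Finset.prod_congr rfl
    intro i hi
    rw [Finset.mem_range] at hi hj
    rw [ev_inl hj, ev_inl (hi.trans hj)]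
    push_cast; rfl
  have e2 : ∏ j ∈ Finset.range n, ∏ i ∈ Finset.range j, ((ev n (n + j) : ℂ) - ev n (n + i)) =
      ∏ j ∈ Finset.range n, ∏ i ∈ Finset.range j, (3 * (j : ℂ) - 3 * i) := by
    apply Finset.prod_congr rfl
    intro j hj
    apply Finset.prod_congr rfl
    intro i hi
    rw [ev_inr, ev_inr]
    push_cast; ring
  have e3 : ∏ j ∈ Finset.range n, ∏ i ∈ Finset.range n, ((ev n (n + j) : ℂ) - ev n i) =
      ∏ j ∈ Finset.range n, ∏ i ∈ Finset.range n, (3 * (j : ℂ) + 1 - 3 * i) := by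
    apply Finset.prod_congr rfl
    intro j hj
    apply Finset.prod_congr rfl
    intro i hi
    rw [Finset.mem_range] at hi
    rw [ev_inr, ev_inl hi]
    push_cast; rfl
  rw [e1, e2, e3, ← sq, num_main] at h
  simp only [fact_prod] at h
  have hF : ∏ x ∈ Finset.range (2 * n), (x.factorial : ℂ) =
      (∏ x ∈ Finset.range n, (x.factorial : ℂ)) *
        ∏ x ∈ Finset.range n, ((n + x).factorial : ℂ) := by
    rw [two_mul, Finset.prod_range_add]
  rw [hF] at h
  have n1 : (∏ x ∈ Finset.range n, (x.factorial : ℂ)) ≠ 0 :=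
    Finset.prod_ne_zero_iff.2 fun i _ => Nat.cast_ne_zero.2 i.factorial_ne_zero
  have n2 : (∏ x ∈ Finset.range n, ((n + x).factorial : ℂ)) ≠ 0 :=
    Finset.prod_ne_zero_iff.2 fun i _ => Nat.cast_ne_zero.2 (n + i).factorial_ne_zero
  apply mul_left_cancel₀ (mul_ne_zero n1 n2)
  rw [h]
  unfold ASM
  rw [Finset.prod_mul_distrib, Finset.prod_div_distrib]
  field_simp

lemma sum_ex (n : ℕ) : ∑ j, ex n j = ∑ i ∈ Finset.range (2 * n), i + n * (n - 1) := by
  have h1 : ∑ j, ex n j = ∑ i ∈ Finset.range (2 * n), ev n i := (Finset.sum_range _).symm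
  have h2 : ∑ i ∈ Finset.range (2 * n), ev n i = ∑ i ∈ Finset.range n, (3 * i) +
      ∑ i ∈ Finset.range n, (3 * i + 1) := by
    rw [two_mul, Finset.sum_range_add]
    congr 1
    · exact Finset.sum_congr rfl fun i hi => ev_inl (Finset.mem_range.1 hi)
    · exact Finset.sum_congr rfl fun i hi => ev_inr n i
  rw [h1, h2, Finset.sum_add_distrib, ← Finset.mul_sum]
  have h3 := Finset.sum_range_id_mul_two n
  have h4 := Finset.sum_range_id_mul_two (2 * n)
  simp only [Finset.sum_const, Finset.card_range, smul_eq_mul, mul_one]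
  rcases n with _ | n
  · simp
  · have : 2 * (n + 1) - 1 = 2 * n + 1 := by omega
    rw [this] at h4
    rw [Nat.add_sub_cancel] at h3 ⊢
    nlinarith

lemma p0_ww (n : ℕ) : WW n (p0 (ex n)) := by
  constructor
  · apply p0_wheel
    intro j
    unfold ex ev
    split_ifs
    · exact ⟨_, Or.inl rfl⟩
    · exact ⟨_, Or.inr rfl⟩
  · rcases p0_degree (ex n) with h | h
    · rw [sum_ex] at h
      omega
    · rw [h]; simp

end WheelProof

/-- Theorem 2.17: for every wheel polynomial `p` of order `n`,
`p(1,…,1) = ASM(n) · Σ_π μ_π p(π)`. -/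
theorem eval_one_expansion (n : ℕ) (hn : 1 ≤ n) (μ : NCM n → ℂ)
    (hsum : ∑ π : NCM n, μ π = 1) (hstat : Stationary μ)
    (huniq : ∀ v : NCM n → ℂ, (∑ π : NCM n, v π = 1) → Stationary v → v = μ) :
    ∀ p : MvPolynomial (Fin (2 * n)) ℂ, IsWheel n p →
      evalOne p = ASM n * ∑ π : NCM n, μ π * evalNC p π := by
  intro p hp
  rw [WheelProof.wheel_iff] at hp
  apply WheelProof.assembly n μ hsum hstat huniq (ASM n)
    (C (WheelProof.kap n)⁻¹ * WheelProof.p0 (WheelProof.ex n)) ((WheelProof.p0_ww n).smul _)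
  · intro π
    have h := WheelProof.p0_evalNC n π
    unfold evalNC at h ⊢
    rw [map_mul, eval_C, h, inv_mul_cancel₀ (WheelProof.kap_ne n)]
  · have h := WheelProof.p0_one n
    unfold evalOne at h ⊢
    rw [map_mul, eval_C, h, ← mul_assoc, inv_mul_cancel₀ (WheelProof.kap_ne n), one_mul]
  · exact ⟨hp.2, hp.1.totalDegree_le⟩
end

section
/- For every n ≥ 1 there exists a unique family (Ψ_π)_{π∈NC_n} of wheel polynomials of order n such that for all π, σ ∈ NC_n, the σ-evaluation Ψ_π(σ) equals 1 if σ = π and 0 otherwise. -/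
open scoped BigOperators

open MvPolynomial

attribute [local instance 10] Classical.propDecidable

namespace QKZ

lemma q_prim : IsPrimitiveRoot q 3 := by
  have := Complex.isPrimitiveRoot_exp 3 (by norm_num)
  simpa [q] using this

lemma q_cube : q ^ 3 = 1 := q_prim.pow_eq_one

lemma q_ne_one : q ≠ 1 := q_prim.ne_one (by norm_num)

lemma q_ne_zero : q ≠ 0 := q_prim.ne_zero (by norm_num)

lemma q_four : q ^ 4 = q := by
  have := q_cube
  linear_combination q * this

lemma q_inv : q⁻¹ = q ^ 2 := by
  have := q_cube
  have h0 := q_ne_zero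
  field_simp
  linear_combination -this

lemma q_sq_ne_one : q ^ 2 ≠ 1 := by
  intro h
  apply q_ne_one
  have := q_cube
  linear_combination this - q * h

lemma q_norm : ‖q‖ = 1 := by
  have h : ‖q‖ ^ 3 = 1 := by rw [← norm_pow, q_cube, norm_one]
  exact (pow_eq_one_iff_of_nonneg (norm_nonneg _) (by norm_num)).1 h

variable {ι : Type} 

lemma eval_aeval' {κ : Type} (p : MvPolynomial ι ℂ) (g : ι → MvPolynomial κ ℂ) (z : κ → ℂ) :
    eval z (aeval g p) = eval (fun k => eval z (g k)) p := by
  induction p using MvPolynomial.induction_on with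
  | C a => simp
  | add p q hp hq => simp only [map_add, hp, hq]
  | mul_X p n hp => simp only [map_mul, hp, aeval_X, eval_X]

lemma eval_line (p : MvPolynomial ι ℂ) (z u : ι → ℂ) :
    ∃ P : Polynomial ℂ, ∀ t, P.eval t = eval (fun k => z k + t * (u k - z k)) p := by
  refine ⟨aeval (fun k => Polynomial.C (z k) + Polynomial.X * Polynomial.C (u k - z k)) p, ?_⟩
  intro t
  induction p using MvPolynomial.induction_on with
  | C a => simp
  | add p q hp hq => simp only [map_add, Polynomial.eval_add, hp, hq]
  | mul_X p n hp => simp only [map_mul, Polynomial.eval_mul, hp, aeval_X, eval_X]; simp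

/-- Cancelling a factor that is not identically zero on a set closed under lines. -/
lemma cancel_on (W : Set (ι → ℂ))
    (hW : ∀ z ∈ W, ∀ u ∈ W, ∀ t : ℂ, (fun k => z k + t * (u k - z k)) ∈ W)
    (g r : MvPolynomial ι ℂ) (u : ι → ℂ) (hu : u ∈ W) (hg : eval u g ≠ 0)
    (h : ∀ z ∈ W, eval z g * eval z r = 0) : ∀ z ∈ W, eval z r = 0 := by
  intro z hz
  obtain ⟨G, hG⟩ := eval_line g z u
  obtain ⟨R, hR⟩ := eval_line r z u
  have h1 : G * R = 0 := by
    apply Polynomial.funext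
    intro t
    simp only [Polynomial.eval_mul, hG, hR, Polynomial.eval_zero]
    exact h _ (hW z hz u hu t)
  have h2 : G ≠ 0 := by
    rintro rfl
    apply hg
    have := hG 1
    simpa using this.symm
  have h3 : R = 0 := (mul_eq_zero.1 h1).resolve_left h2
  have := hR 0
  rw [h3] at this
  simpa using this.symm

/-- substitution of `f` for the variable `k` -/
noncomputable def sbst (k : ι) (f : MvPolynomial ι ℂ) :
    MvPolynomial ι ℂ →ₐ[ℂ] MvPolynomial ι ℂ :=
  aeval (Function.update X k f)

lemma eval_sbst (k : ι) (f p : MvPolynomial ι ℂ) (z : ι → ℂ) :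
    eval z (sbst k f p) = eval (Function.update z k (eval z f)) p := by
  unfold sbst
  induction p using MvPolynomial.induction_on with
  | C a => simp
  | add p q hp hq => simp only [map_add, hp, hq]
  | mul_X p n hp =>
    simp only [map_mul, hp, aeval_X, eval_X]
    by_cases h : n = k
    · subst h; simp
    · simp [Function.update_of_ne h]

lemma form_dvd_sub (k : ι) (f p : MvPolynomial ι ℂ) : X k - f ∣ p - sbst k f p := by
  induction p using MvPolynomial.induction_on with
  | C a => simp [sbst]
  | add p q hp hq =>
    rw [map_add, add_sub_add_comm]
    exact dvd_add hp hq
  | mul_X p n hp =>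
    have h2 : X k - f ∣ (X n : MvPolynomial ι ℂ) - sbst k f (X n) := by
      by_cases h : n = k
      · subst h; simp [sbst]
      · simp [sbst, Function.update_of_ne h]
    rw [map_mul]
    have : p * X n - sbst k f p * sbst k f (X n)
      = (p - sbst k f p) * X n + sbst k f p * (X n - sbst k f (X n)) := by ring
    rw [this]
    exact dvd_add (hp.mul_right _) (h2.mul_left _)

/-- `f` does not involve the variable `k` -/
def Free (k : ι) (f : MvPolynomial ι ℂ) : Prop :=
  ∀ (z : ι → ℂ) (c : ℂ), eval (Function.update z k c) f = eval z f

lemma sbst_eq_zero_iff {k : ι} {f : MvPolynomial ι ℂ} (hf : Free k f) (p : MvPolynomial ι ℂ) :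
    sbst k f p = 0 ↔ ∀ z, z k = eval z f → eval z p = 0 := by
  constructor
  · intro h z hz
    have := eval_sbst k f p z
    rw [h, ← hz] at this
    simpa using this.symm
  · intro h
    apply MvPolynomial.funext
    intro z
    rw [eval_sbst, map_zero]
    apply h
    simp [hf z]

lemma form_dvd_iff' {k : ι} {f : MvPolynomial ι ℂ} (hf : Free k f) (p : MvPolynomial ι ℂ) :
    X k - f ∣ p ↔ ∀ z, z k = eval z f → eval z p = 0 := by
  constructor
  · rintro ⟨r, rfl⟩ z hz
    simp [hz]
  · intro h
    have := form_dvd_sub k f p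
    rwa [(sbst_eq_zero_iff hf p).2 h, sub_zero] at this

lemma form_prime {k : ι} {f : MvPolynomial ι ℂ} (hf : Free k f) :
    Prime (X k - f : MvPolynomial ι ℂ) := by
  refine ⟨?_, ?_, ?_⟩
  · intro h
    have := congrArg (eval (Function.update (0 : ι → ℂ) k (eval 0 f + 1))) h
    rw [map_sub, hf, eval_X, Function.update_self, map_zero] at this
    simp at this
  · intro h
    have h1 := (form_dvd_iff' hf 1).1 (isUnit_iff_dvd_one.1 h)
      (Function.update (0 : ι → ℂ) k (eval 0 f)) (by simp [hf (0 : ι → ℂ)])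
    simp at h1
  · intro a b h
    rw [form_dvd_iff' hf, ← sbst_eq_zero_iff hf, map_mul, mul_eq_zero] at h
    rwa [form_dvd_iff' hf, form_dvd_iff' hf, ← sbst_eq_zero_iff hf, ← sbst_eq_zero_iff hf]

lemma prime_totalDegree {p : MvPolynomial ι ℂ} (hp : Prime p) : 1 ≤ p.totalDegree := by
  by_contra h
  have h0 : p.totalDegree = 0 := by omega
  rw [totalDegree_eq_zero_iff_eq_C] at h0
  apply hp.not_isUnit
  rw [h0]
  apply IsUnit.map
  rw [isUnit_iff_ne_zero]
  intro h1
  rw [h1] at h0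
  exact hp.ne_zero (by simpa using h0)

lemma prod_totalDegree {τ : Type} (s : Finset τ) (L : τ → MvPolynomial ι ℂ)
    (hL : ∀ t ∈ s, Prime (L t)) : s.card ≤ (∏ t ∈ s, L t).totalDegree := by
  induction s using Finset.induction_on with
  | empty => simp
  | insert a s ha ih =>
    rw [Finset.prod_insert ha, Finset.card_insert_of_notMem ha, totalDegree_mul_of_isDomain]
    · have := prime_totalDegree (hL a (by simp))
      have := ih (fun t ht => hL t (by simp [ht]))
      omega
    · exact (hL a (by simp)).ne_zero
    · rw [Finset.prod_ne_zero_iff]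
      exact fun t ht => (hL t (by simp [ht])).ne_zero

/-- A polynomial vanishing on several hyperplanes is divisible by the product of the forms,
and the degree drops accordingly. -/
lemma prod_dvd {τ : Type} (s : Finset τ) (K : τ → ι) (F : τ → MvPolynomial ι ℂ)
    (hF : ∀ t ∈ s, Free (K t) (F t)) (p : MvPolynomial ι ℂ)
    (hp : ∀ t ∈ s, ∀ z, z (K t) = eval z (F t) → eval z p = 0)
    (hpair : ∀ t ∈ s, ∀ t' ∈ s, t ≠ t' →
      ∃ u, u (K t) = eval u (F t) ∧ u (K t') ≠ eval u (F t')) :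
    ∃ r, p = (∏ t ∈ s, (X (K t) - F t)) * r ∧
      (r ≠ 0 → s.card + r.totalDegree ≤ p.totalDegree) := by
  have hd : (∏ t ∈ s, (X (K t) - F t)) ∣ p := by
    apply Finset.prod_dvd_of_isRelPrime
    · intro t ht t' ht' hne
      have hpr := form_prime (hF t ht)
      refine (hpr.irreducible.isRelPrime_iff_not_dvd).2 ?_
      intro hdv
      obtain ⟨u, hu1, hu2⟩ := hpair t ht t' ht' hne
      have := (form_dvd_iff' (hF t ht) _).1 hdv u hu1
      apply hu2
      simpa [sub_eq_zero] using this
    · intro t ht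
      exact (form_dvd_iff' (hF t ht) _).2 (hp t ht)
  obtain ⟨r, hr⟩ := hd
  refine ⟨r, hr, fun h0 => ?_⟩
  have hpr : ∀ t ∈ s, Prime (X (K t) - F t) := fun t ht => form_prime (hF t ht)
  rw [hr, totalDegree_mul_of_isDomain _ h0]
  · have := prod_totalDegree s _ hpr
    omega
  · rw [Finset.prod_ne_zero_iff]
    exact fun t ht => (hpr t ht).ne_zero

lemma free_C (k : ι) (a : ℂ) : Free k (C a) := by
  intro z c; simp

lemma free_X {k i : ι} (h : i ≠ k) : Free k (X i : MvPolynomial ι ℂ) := by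
  intro z c; simp [Function.update_of_ne h]

lemma free_CX {k i : ι} (h : i ≠ k) (a : ℂ) : Free k (C a * X i) := by
  intro z c; simp [Function.update_of_ne h]

lemma totalDegree_aeval_le {κ : Type} (p : MvPolynomial ι ℂ) (g : ι → MvPolynomial κ ℂ)
    (hg : ∀ k, (g k).totalDegree ≤ 1) : (aeval g p).totalDegree ≤ p.totalDegree := by
  rw [aeval_def, eval₂_eq]
  apply totalDegree_finsetSum_le
  intro d hd
  refine (totalDegree_mul _ _).trans ?_
  rw [algebraMap_eq, totalDegree_C, zero_add]
  refine (totalDegree_finsetProd _ _).trans ?_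
  refine le_trans ?_ (le_totalDegree hd)
  rw [Finsupp.sum]
  apply Finset.sum_le_sum
  intro i _
  refine (totalDegree_pow _ _).trans ?_
  have := Nat.mul_le_mul_left (d i) (hg i)
  simpa using this

lemma card_lt_pairs (ι : Type) [Fintype ι] [LinearOrder ι] :
    2 * (Finset.univ.filter (fun t : ι × ι => t.1 < t.2)).card
      = Fintype.card ι * (Fintype.card ι - 1) := by
  have h1 : (Finset.univ.filter (fun t : ι × ι => t.1 < t.2)).card
      = (Finset.univ.filter (fun t : ι × ι => t.2 < t.1)).card := by
    apply Finset.card_bij (fun t _ => (t.2, t.1))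
    · simp
    · rintro ⟨a, b⟩ _ ⟨c, d⟩ _ h; simp at h ⊢; tauto
    · rintro ⟨a, b⟩ h; exact ⟨(b, a), by simpa using h, rfl⟩
  have h2 : (Finset.univ : Finset ι).offDiag
      = (Finset.univ.filter (fun t : ι × ι => t.1 < t.2)) ∪
        (Finset.univ.filter (fun t : ι × ι => t.2 < t.1)) := by
    ext ⟨a, b⟩
    simp [lt_or_lt_iff_ne]
  have h3 := congrArg Finset.card h2
  rw [Finset.card_union_of_disjoint, Finset.offDiag_card, ← h1] at h3
  · rw [two_mul, ← h3, Finset.card_univ, Nat.mul_sub, mul_one]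
  · rw [Finset.disjoint_left]
    rintro ⟨a, b⟩ h h'
    simp at h h'
    exact lt_asymm h h'

/-- wheel condition in terms of evaluations -/
def WheelFn {ι : Type} [LinearOrder ι] (p : MvPolynomial ι ℂ) : Prop :=
  ∀ i j k : ι, i < j → j < k → ∀ z : ι → ℂ, z j = q ^ 2 * z i → z k = q ^ 4 * z i → eval z p = 0

/-- perfect matching -/
structure PM {ι : Type} (f : ι → ι) : Prop where
  invol : ∀ k, f (f k) = k
  nofix : ∀ k, f k ≠ k

/-- noncrossing -/
def NCf {ι : Type} [LinearOrder ι] (f : ι → ι) : Prop :=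
  ∀ a b c d : ι, a < b → b < c → c < d → f a = c → f b = d → False

/-- the linear space attached to a matching -/
def VV {ι : Type} [LinearOrder ι] (f : ι → ι) : Set (ι → ℂ) :=
  {z | ∀ k, k < f k → z (f k) = q ^ 2 * z k}

lemma VV_line {ι : Type} [LinearOrder ι] (f : ι → ι) :
    ∀ z ∈ VV f, ∀ u ∈ VV f, ∀ t : ℂ, (fun k => z k + t * (u k - z k)) ∈ VV f := by
  intro z hz u hu t k hk
  have h1 := hz k hk
  have h2 := hu k hk
  simp only [h1, h2]
  ring

lemma norm_q_ne {a b : ℂ} (h : ‖a‖ ≠ ‖b‖) : a ≠ b := by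
  rintro rfl; exact h rfl

section restr
variable {ι : Type} [LinearOrder ι]

/-- the remaining indices -/
abbrev Rest (i j : ι) := {x : ι // x ≠ i ∧ x ≠ j}

/-- extension of a point -/
noncomputable def extPt (i j : ι) (c : ℂ) (z : Rest i j → ℂ) : ι → ℂ := fun k =>
  if h : k ≠ i ∧ k ≠ j then z ⟨k, h⟩ else if k = i then c else q ^ 2 * c

lemma extPt_i (i j : ι) (c : ℂ) (z : Rest i j → ℂ) : extPt i j c z i = c := by
  simp [extPt]

lemma extPt_j {i j : ι} (hij : i < j) (c : ℂ) (z : Rest i j → ℂ) :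
    extPt i j c z j = q ^ 2 * c := by
  simp [extPt, hij.ne']

lemma extPt_k {i j : ι} (c : ℂ) (z : Rest i j → ℂ) (k : Rest i j) :
    extPt i j c z k.1 = z k := by
  simp [extPt, k.2]

/-- restriction of a polynomial -/
noncomputable def restr (i j : ι) (c : ℂ) (p : MvPolynomial ι ℂ) : MvPolynomial (Rest i j) ℂ :=
  aeval (fun k : ι => if h : k ≠ i ∧ k ≠ j then X (⟨k, h⟩ : Rest i j)
    else if k = i then C c else C (q ^ 2 * c)) p

lemma eval_restr (i j : ι) (c : ℂ) (p : MvPolynomial ι ℂ) (z : Rest i j → ℂ) :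
    eval z (restr i j c p) = eval (extPt i j c z) p := by
  unfold restr
  rw [eval_aeval']
  congr 2
  funext k
  unfold extPt
  split_ifs <;> simp

lemma restr_totalDegree (i j : ι) (c : ℂ) (p : MvPolynomial ι ℂ) :
    (restr i j c p).totalDegree ≤ p.totalDegree := by
  apply totalDegree_aeval_le
  intro k
  split_ifs
  · simp
  · simp
  · exact (totalDegree_C _).le.trans zero_le_one

lemma prod_form_ne {κ : Type} (s : Finset (κ × ℂ)) (u : κ → ℂ) (h : ∀ t ∈ s, u t.1 ≠ t.2) :
    eval u (∏ t ∈ s, (X t.1 - C t.2 : MvPolynomial κ ℂ)) ≠ 0 := by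
  rw [map_prod, Finset.prod_ne_zero_iff]
  intro t ht
  simpa [sub_eq_zero] using h t ht

/-- extension of a matching by an adjacent arc -/
noncomputable def extM (i j : ι) (f : Rest i j → Rest i j) : ι → ι := fun k =>
  if h : k ≠ i ∧ k ≠ j then (f ⟨k, h⟩).1 else if k = i then j else i

lemma extM_i (i j : ι) (f : Rest i j → Rest i j) : extM i j f i = j := by simp [extM]

lemma extM_j (i j : ι) (f : Rest i j → Rest i j) : extM i j f j = i := by
  simp only [extM]
  simp

lemma extM_k {i j : ι} (f : Rest i j → Rest i j) (k : Rest i j) :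
    extM i j f k.1 = (f k).1 := by
  simp [extM, k.2]

lemma rest_cases (i j k : ι) : k = i ∨ k = j ∨ ∃ x : Rest i j, k = x.1 := by
  by_cases h : k = i
  · exact Or.inl h
  by_cases h' : k = j
  · exact Or.inr (Or.inl h')
  exact Or.inr (Or.inr ⟨⟨k, h, h'⟩, rfl⟩)

lemma extM_PM {i j : ι} (hij : i < j) {f : Rest i j → Rest i j} (hf : PM f) :
    PM (extM i j f) := by
  constructor
  · intro k
    rcases rest_cases i j k with rfl | rfl | ⟨x, rfl⟩
    · rw [extM_i, extM_j]
    · rw [extM_j, extM_i]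
    · rw [extM_k, extM_k, hf.invol]
  · intro k
    rcases rest_cases i j k with rfl | rfl | ⟨x, rfl⟩
    · rw [extM_i]; exact hij.ne'
    · rw [extM_j]; exact hij.ne
    · rw [extM_k]
      intro h
      exact hf.nofix x (Subtype.ext h)

lemma extM_NC {i j : ι} (hij : i < j) (hadj : ∀ k, ¬ (i < k ∧ k < j)) {f : Rest i j → Rest i j}
    (hf : NCf f) : NCf (extM i j f) := by
  intro a b c d hab hbc hcd hac hbd
  rcases rest_cases i j a with rfl | rfl | ⟨a, rfl⟩
  · rw [extM_i] at hac
    subst hac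
    exact hadj _ ⟨hab, hbc⟩
  · rw [extM_j] at hac
    subst hac
    exact lt_asymm hij (hab.trans hbc)
  rcases rest_cases i j b with rfl | rfl | ⟨b, rfl⟩
  · rw [extM_i] at hbd
    subst hbd
    exact hadj _ ⟨hbc, hcd⟩
  · rw [extM_j] at hbd
    subst hbd
    exact lt_asymm hij (hbc.trans hcd)
  rw [extM_k] at hac hbd
  subst hac hbd
  exact hf a b (f a) (f b) hab hbc hcd rfl rfl

end restr

/-- The key step: one reduction. `a k` are the zeros on the remaining indices. -/
lemma step {ι : Type} [LinearOrder ι] [Fintype ι] (p : MvPolynomial ι ℂ) (hw : WheelFn p)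
    {i j : ι} (hij : i < j) {c : ℂ} (hc : c ≠ 0) (s : Finset (Rest i j × ℂ))
    (hs : ∀ t ∈ s, ‖t.2‖ = ‖c‖)
    (hz : ∀ t ∈ s, ∀ z : Rest i j → ℂ, z t.1 = t.2 → eval (extPt i j c z) p = 0) :
    ∃ r : MvPolynomial (Rest i j) ℂ, WheelFn r ∧
      (r ≠ 0 → s.card + r.totalDegree ≤ p.totalDegree) ∧
      (r = 0 → ∀ z : Rest i j → ℂ, eval (extPt i j c z) p = 0) ∧
      (∀ f : Rest i j → Rest i j, PM f → (∀ z ∈ VV f, eval (extPt i j c z) p = 0) →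
        ∀ z ∈ VV f, eval z r = 0) := by
  have hcn : 0 < ‖c‖ := norm_pos_iff.2 hc
  obtain ⟨r, hr, hdeg⟩ := prod_dvd s (fun t => t.1) (fun t => C t.2) (fun t _ => free_C _ _)
    (restr i j c p) (by
      intro t ht z h
      rw [eval_restr]
      exact hz t ht z (by simpa using h)) (by
      rintro ⟨k, a⟩ _ ⟨k', a'⟩ _ hne
      by_cases hk : k = k'
      · subst hk
        refine ⟨fun _ => a, by simp, ?_⟩
        simp only [eval_C]
        intro h
        exact hne (by rw [h])
      · refine ⟨Function.update (fun _ => a) k' (a' + 1), ?_, ?_⟩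
        · simp [Function.update_of_ne hk]
        · simp)
  have hmul : ∀ z, eval (extPt i j c z) p
      = eval z (∏ t ∈ s, (X t.1 - C t.2 : MvPolynomial (Rest i j) ℂ)) * eval z r := by
    intro z
    rw [← eval_restr, hr, map_mul]
  refine ⟨r, ?_, ?_, ?_, ?_⟩
  · intro a b d hab hbd z hzb hzd
    refine cancel_on {z | z b = q ^ 2 * z a ∧ z d = q ^ 4 * z a} ?_
      (∏ t ∈ s, (X t.1 - C t.2 : MvPolynomial (Rest i j) ℂ)) r
      (fun k => 2 * c * (if k = b then q ^ 2 else if k = d then q ^ 4 else 1)) ?_ ?_ ?_ z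
      ⟨hzb, hzd⟩
    · rintro z ⟨h1, h2⟩ u ⟨h3, h4⟩ t
      simp only [Set.mem_ofPred_eq, h1, h2, h3, h4]
      constructor <;> ring
    · simp only [Set.mem_ofPred_eq, hab.ne, (hab.trans hbd).ne, hbd.ne', if_true, if_false]
      constructor <;> ring
    · apply prod_form_ne
      intro t ht
      apply norm_q_ne
      rw [hs t ht]
      split_ifs <;> simp [q_norm] <;> linarith
    · rintro z ⟨h1, h2⟩
      rw [← hmul]
      refine hw a.1 b.1 d.1 hab hbd _ ?_ ?_
      · rw [extPt_k, extPt_k, h1]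
      · rw [extPt_k, extPt_k, h2]
  · intro h
    exact (hdeg h).trans (restr_totalDegree _ _ _ _)
  · intro h z
    rw [hmul, h]; simp
  · intro f hf hv
    refine cancel_on (VV f) (VV_line f)
      (∏ t ∈ s, (X t.1 - C t.2 : MvPolynomial (Rest i j) ℂ)) r
      (fun k => 2 * c * (if k < f k then 1 else q ^ 2)) ?_ ?_ ?_
    · intro k hk
      simp only [hf.invol, hk, not_lt_of_gt hk, if_true, if_false]
      ring
    · apply prod_form_ne
      intro t ht
      apply norm_q_ne
      rw [hs t ht]
      split_ifs <;> simp [q_norm] <;> linarith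
    · intro z hz
      rw [← hmul]
      exact hv z hz

theorem wheel_zero (m : ℕ) : ∀ (ι : Type) [LinearOrder ι] [Fintype ι], Fintype.card ι = 2 * m →
    ∀ p : MvPolynomial ι ℂ, WheelFn p → p.totalDegree ≤ m * (m - 1) →
    (p.totalDegree < m * (m - 1) ∨ ∀ f : ι → ι, PM f → NCf f → ∀ z ∈ VV f, eval z p = 0) →
    p = 0 := by
  induction m with
  | zero =>
    intro ι _ _ hcard p _ _ h
    rcases h with h | h
    · simp at h
    · have hE : IsEmpty ι := by
        rw [← Fintype.card_eq_zero_iff]; simpa using hcard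
      apply MvPolynomial.funext
      intro z
      rw [map_zero]
      exact h id ⟨fun k => hE.elim k, fun k => hE.elim k⟩ (fun k => hE.elim k) z
        (fun k => hE.elim k)
  | succ m ih =>
    intro ι _ _ hcard p hw hdeg halt
    have hcardR : ∀ i j : ι, i < j → Fintype.card (Rest i j) = 2 * m := by
      intro i j hij
      have h1 : Fintype.card (Rest i j) = (Finset.univ \ {i, j} : Finset ι).card := by
        rw [Fintype.card_subtype]
        congr 1
        ext x; simp
      rw [h1, Finset.card_sdiff_of_subset (Finset.subset_univ _), Finset.card_univ, hcard,
        Finset.card_pair hij.ne]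
      omega
    have hmm : (m + 1) * (m + 1 - 1) = m * (m - 1) + 2 * m := by
      cases m with
      | zero => rfl
      | succ m => simp; ring
    -- main claim
    have key : ∀ N : ℕ, ∀ i j : ι, i < j → (Finset.univ.filter (fun k => i < k ∧ k < j)).card = N →
        ∀ z : ι → ℂ, z j = q ^ 2 * z i → eval z p = 0 := by
      intro N
      induction N using Nat.strong_induction_on with
      | _ N IH =>
      intro i j hij hN
      -- reduce to z i ≠ 0
      suffices hmain : ∀ z : ι → ℂ, z j = q ^ 2 * z i → z i ≠ 0 → eval z p = 0 by
        intro z hz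
        refine cancel_on {z | z j = q ^ 2 * z i} ?_ (X i) p
          (fun k => if k = j then q ^ 2 else 1) ?_ ?_ ?_ z hz
        · intro z h1 u h2 t
          simp only [Set.mem_ofPred_eq] at h1 h2 ⊢
          rw [h1, h2]; ring
        · simp [hij.ne]
        · simp [hij.ne]
        · intro z hz
          rw [eval_X]
          by_cases h : z i = 0
          · rw [h, zero_mul]
          · rw [hmain z hz h, mul_zero]
      intro z hz hc
      set c := z i with hcdef
      have hzext : z = extPt i j c (fun k => z k.1) := by
        funext k
        rcases rest_cases i j k with rfl | rfl | ⟨x, rfl⟩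
        · rw [extPt_i]
        · rw [extPt_j hij, hz]
        · rw [extPt_k]
      -- the basic zeros
      let a : Rest i j → ℂ := fun k => if i < k.1 ∧ k.1 < j then c else q * c
      have hsub : ∀ k : ι, i < k → k < j →
          (Finset.univ.filter (fun x => i < x ∧ x < k)).card < N ∧
          (Finset.univ.filter (fun x => k < x ∧ x < j)).card < N := by
        intro k h1 h2
        rw [← hN]
        constructor
        · apply Finset.card_lt_card
          rw [Finset.ssubset_iff_of_subset]
          · exact ⟨k, by simp [h1, h2], by simp⟩
          · intro x; simp only [Finset.mem_filter, Finset.mem_univ, true_and]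
            exact fun h => ⟨h.1, h.2.trans h2⟩
        · apply Finset.card_lt_card
          rw [Finset.ssubset_iff_of_subset]
          · exact ⟨k, by simp [h1, h2], by simp⟩
          · intro x; simp only [Finset.mem_filter, Finset.mem_univ, true_and]
            exact fun h => ⟨h1.trans h.1, h.2⟩
      have ha : ∀ k : Rest i j, ∀ w : Rest i j → ℂ, w k = a k → eval (extPt i j c w) p = 0 := by
        intro k w hwk
        by_cases hb : i < k.1 ∧ k.1 < j
        · have hak : a k = c := by simp [a, hb]
          refine IH _ (hsub k.1 hb.1 hb.2).2 k.1 j hb.2 rfl _ ?_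
          rw [extPt_j hij, extPt_k, hwk, hak]
        · have hak : a k = q * c := by simp only [a, hb, if_false]
          rcases lt_or_gt_of_ne k.2.1 with h | h
          · refine hw k.1 i j h hij _ ?_ ?_
            · rw [extPt_i, extPt_k, hwk, hak]; linear_combination -c * q_cube
            · rw [extPt_j hij, extPt_k, hwk, hak]; linear_combination -c * q ^ 2 * q_cube
          · have h' : j < k.1 := by
              rcases lt_or_gt_of_ne k.2.2 with h2 | h2
              · exact absurd ⟨h, h2⟩ hb
              · exact h2
            refine hw i j k.1 hij h' _ ?_ ?_
            · rw [extPt_i, extPt_j hij]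
            · rw [extPt_i, extPt_k, hwk, hak, q_four]
      have han : ∀ k, ‖a k‖ = ‖c‖ := by
        intro k
        simp only [a]
        split_ifs <;> simp [q_norm]
      let s0 : Finset (Rest i j × ℂ) := Finset.univ.image (fun k => (k, a k))
      have hs0 : s0.card = 2 * m := by
        rw [Finset.card_image_of_injective, Finset.card_univ, hcardR i j hij]
        intro x y h
        exact (Prod.ext_iff.1 h).1
      rw [hzext]
      by_cases hadj : ∃ k, i < k ∧ k < j
      · obtain ⟨k0, hk1, hk2⟩ := hadj
        let K0 : Rest i j := ⟨k0, hk1.ne', hk2.ne⟩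
        have hnot : (K0, q ^ 2 * c) ∉ s0 := by
          simp only [s0, Finset.mem_image, Finset.mem_univ, true_and, not_exists, Prod.ext_iff]
          rintro x ⟨h1, h2⟩
          subst h1
          have : a K0 = c := by simp [a, K0, hk1, hk2]
          rw [this] at h2
          apply q_sq_ne_one
          exact mul_right_cancel₀ hc (by rw [one_mul]; exact h2.symm)
        obtain ⟨r, hrw, hrd, hr0, hrv⟩ := step p hw hij hc (insert (K0, q ^ 2 * c) s0) (by
            intro t ht
            rw [Finset.mem_insert] at ht
            rcases ht with rfl | ht
            · simp [q_norm]
            · simp only [s0, Finset.mem_image, Finset.mem_univ, true_and] at ht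
              obtain ⟨k, rfl⟩ := ht
              exact han k) (by
            intro t ht w hwt
            rw [Finset.mem_insert] at ht
            rcases ht with rfl | ht
            · refine IH _ (hsub k0 hk1 hk2).1 i k0 hk1 rfl _ ?_
              rw [extPt_i]
              have := extPt_k (i := i) (j := j) c w K0
              simp only [K0] at this hwt
              rw [this, hwt]
            · simp only [s0, Finset.mem_image, Finset.mem_univ, true_and] at ht
              obtain ⟨k, rfl⟩ := ht
              exact ha k w hwt)
        apply hr0
        by_contra hne
        have hd := hrd hne
        rw [Finset.card_insert_of_notMem hnot, hs0] at hd
        apply hne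
        apply ih _ (hcardR i j hij) r hrw
        · omega
        · left; omega
      · push Not at hadj
        have hadj' : ∀ k, ¬ (i < k ∧ k < j) := by
          rintro k ⟨h1, h2⟩
          exact absurd h2 (not_lt.2 (hadj k h1))
        obtain ⟨r, hrw, hrd, hr0, hrv⟩ := step p hw hij hc s0 (by
            intro t ht
            simp only [s0, Finset.mem_image, Finset.mem_univ, true_and] at ht
            obtain ⟨k, rfl⟩ := ht
            exact han k) (by
            intro t ht w hwt
            simp only [s0, Finset.mem_image, Finset.mem_univ, true_and] at ht
            obtain ⟨k, rfl⟩ := ht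
            exact ha k w hwt)
        apply hr0
        by_contra hne
        have hd := hrd hne
        rw [hs0] at hd
        apply hne
        apply ih _ (hcardR i j hij) r hrw
        · omega
        · rcases halt with hlt | hv
          · left; omega
          · right
            intro f hf hnc
            apply hrv f hf
            intro w hwV
            refine hv (extM i j f) (extM_PM hij hf) (extM_NC hij hadj' hnc) _ ?_
            intro k hk
            rcases rest_cases i j k with rfl | rfl | ⟨x, rfl⟩
            · rw [extM_i, extPt_i, extPt_j hij]
            · rw [extM_j] at hk
              exact absurd hk (not_lt_of_gt hij)
            · rw [extM_k] at hk ⊢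
              rw [extPt_k, extPt_k]
              exact hwV x hk
    -- conclusion
    obtain ⟨r, hr, hrd⟩ := prod_dvd (Finset.univ.filter (fun t : ι × ι => t.1 < t.2))
      (fun t => t.2) (fun t => C (q ^ 2) * X t.1) (by
        intro t ht
        simp only [Finset.mem_filter, Finset.mem_univ, true_and] at ht
        exact free_CX ht.ne _) p (by
        intro t ht z hz
        simp only [Finset.mem_filter, Finset.mem_univ, true_and] at ht
        exact key _ t.1 t.2 ht rfl z (by simpa using hz)) (by
        rintro ⟨x, y⟩ h ⟨x', y'⟩ h' hne
        simp only [Finset.mem_filter, Finset.mem_univ, true_and] at h h'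
        simp only [map_mul, eval_C, eval_X]
        by_cases hy : y = y'
        · subst hy
          have hx : x ≠ x' := fun e => hne (by rw [e])
          refine ⟨fun k => if k = y then q ^ 2 else if k = x' then 0 else 1, ?_, ?_⟩
          · simp [h.ne, hx]
          · simp [h'.ne, q_ne_zero]
        · by_cases hxy : x = y'
          · subst hxy
            refine ⟨fun k => if k = y then q ^ 2 else if k = x' then 0 else 1, ?_, ?_⟩
            · simp [h.ne, h'.ne']
            · simp [h.ne, h'.ne']
              simp [(h'.trans h).ne]
          · refine ⟨fun k => if k = y' then 1 else 0, ?_, ?_⟩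
            · simp [hy, hxy]
            · simp [h'.ne])
    by_contra hp0
    have hr0 : r ≠ 0 := by
      rintro rfl
      exact hp0 (by rw [hr, mul_zero])
    have hd := hrd hr0
    have hc2 := card_lt_pairs ι
    rw [hcard] at hc2
    have e1 : 2 * (m + 1) - 1 = 2 * m + 1 := by omega
    rw [e1] at hc2
    have e2 : (m + 1) * (m + 1 - 1) = m * m + m := by
      rw [Nat.add_sub_cancel]; ring
    rw [e2] at hdeg
    have e3 : 2 * (m + 1) * (2 * m + 1) = 4 * (m * m) + 6 * m + 2 := by ring
    rw [e3] at hc2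
    omega

lemma openings_card {ι : Type} [LinearOrder ι] [Fintype ι] {n : ℕ} (hcard : Fintype.card ι = 2 * n)
    {f : ι → ι} (hf : PM f) : Fintype.card {k : ι // k < f k} = n := by
  have h1 : Fintype.card {k : ι // k < f k} = Fintype.card {k : ι // ¬ k < f k} := by
    apply Fintype.card_congr
    refine ⟨fun k => ⟨f k.1, ?_⟩, fun k => ⟨f k.1, ?_⟩, ?_, ?_⟩
    · rw [hf.invol]; exact not_lt_of_gt k.2
    · rw [hf.invol]; exact lt_of_le_of_ne (not_lt.1 k.2) (hf.nofix _)
    · intro k; simp [hf.invol]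
    · intro k; simp [hf.invol]
  have h2 := Fintype.card_subtype_compl (fun k : ι => k < f k)
  have h3 := Fintype.card_subtype_le (fun k : ι => k < f k)
  omega

lemma vanish_VV {ι : Type} [LinearOrder ι] [Fintype ι] {n : ℕ} (hcard : Fintype.card ι = 2 * n)
    (p : MvPolynomial ι ℂ) (hw : WheelFn p) (hdeg : p.totalDegree ≤ n * (n - 1))
    {f : ι → ι} (hf : PM f) (hnc : NCf f)
    (h0 : eval (fun k => if k < f k then q⁻¹ else q) p = 0) : ∀ z ∈ VV f, eval z p = 0 := by
  let A := {k : ι // k < f k}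
  have hA : Fintype.card A = n := openings_card hcard hf
  have hop : ∀ k, ¬ k < f k → f k < f (f k) := by
    intro k hk
    rw [hf.invol]; exact lt_of_le_of_ne (not_lt.1 hk) (hf.nofix _)
  let g : ι → MvPolynomial A ℂ := fun k =>
    if h : k < f k then X (⟨k, h⟩ : A) else C (q ^ 2) * X (⟨f k, hop k h⟩ : A)
  let P := aeval g p
  have hgA : ∀ (t : A → ℂ) (a : A), eval t (g a.1) = t a := by
    intro t a
    have e : g a.1 = X (⟨a.1, a.2⟩ : A) := dif_pos a.2
    rw [e, eval_X]
  have hgB : ∀ (t : A → ℂ) (a : A), eval t (g (f a.1)) = q ^ 2 * t a := by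
    intro t a
    have : ¬ (f a.1 < f (f a.1)) := by rw [hf.invol]; exact not_lt_of_gt a.2
    have e : g (f a.1) = C (q ^ 2) * X (⟨f (f a.1), hop _ this⟩ : A) := dif_neg this
    rw [e, map_mul, eval_C, eval_X]
    congr 2
    exact Subtype.ext (hf.invol _)
  have hPe : ∀ t, eval t P = eval (fun k => eval t (g k)) p := fun t => eval_aeval' p g t
  have hPd : P.totalDegree ≤ n * (n - 1) := by
    refine (totalDegree_aeval_le p g ?_).trans hdeg
    intro k
    simp only [g]
    split_ifs
    · simp
    · refine (totalDegree_mul _ _).trans ?_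
      rw [totalDegree_C, totalDegree_X]
  have hfl : ∀ x y : A, x ≠ y → x.1 ≠ y.1 := fun x y h h' => h (Subtype.ext h')
  have hfne : ∀ x y : A, x ≠ y → f x.1 ≠ f y.1 := fun x y h h' =>
    h (Subtype.ext (by rw [← hf.invol x.1, h', hf.invol]))
  have hfx : ∀ x y : A, f x.1 ≠ y.1 := by
    intro x y h
    have h1 := y.2
    rw [← h, hf.invol] at h1
    exact lt_asymm h1 x.2
  have hzero : ∀ a b : A, a ≠ b → ∀ t : A → ℂ, t b = q * t a → eval t P = 0 := by
    intro a b hab t ht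
    rw [hPe]
    rcases lt_or_gt_of_ne (hfl a b hab) with h | h
    · rcases lt_or_gt_of_ne (hfx a b) with h1 | h1
      · refine hw a.1 (f a.1) b.1 a.2 h1 _ ?_ ?_
        · rw [hgA, hgB]
        · rw [hgA, hgA, ht, q_four]
      · have h2 : f b.1 < f a.1 := by
          rcases lt_or_gt_of_ne (hfne a b hab) with h3 | h3
          · exact (hnc a.1 b.1 (f a.1) (f b.1) h h1 h3 rfl rfl).elim
          · exact h3
        refine hw b.1 (f b.1) (f a.1) b.2 h2 _ ?_ ?_
        · rw [hgA, hgB]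
        · rw [hgA, hgB, ht]; linear_combination -(t a) * q ^ 2 * q_cube
    · rcases lt_or_gt_of_ne (hfx b a) with h1 | h1
      · refine hw b.1 a.1 (f a.1) h a.2 _ ?_ ?_
        · rw [hgA, hgA, ht]; linear_combination -(t a) * q_cube
        · rw [hgA, hgB, ht]; linear_combination -(t a) * q ^ 2 * q_cube
      · refine hw b.1 a.1 (f a.1) h a.2 _ ?_ ?_
        · rw [hgA, hgA, ht]; linear_combination -(t a) * q_cube
        · rw [hgA, hgB, ht]; linear_combination -(t a) * q ^ 2 * q_cube
  have hP0 : P = 0 := by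
    obtain ⟨r, hr, hrd⟩ := prod_dvd (Finset.univ : Finset A).offDiag
      (fun t => t.2) (fun t => C q * X t.1) (by
        intro t ht
        simp only [Finset.mem_offDiag, Finset.mem_univ, true_and] at ht
        exact free_CX ht _) P (by
        intro t ht z hz
        simp only [Finset.mem_offDiag, Finset.mem_univ, true_and] at ht
        exact hzero t.1 t.2 ht z (by simpa using hz)) (by
        rintro ⟨x, y⟩ h ⟨x', y'⟩ h' hne
        simp only [Finset.mem_offDiag, Finset.mem_univ, true_and] at h h'
        simp only [map_mul, eval_C, eval_X]
        by_cases hy : y = y'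
        · subst hy
          have hx : x ≠ x' := fun e => hne (by rw [e])
          refine ⟨fun k => if k = y then q else if k = x' then 0 else 1, ?_, ?_⟩
          · simp [h, hx]
          · simp [h', q_ne_zero]
        · by_cases hxy : x = y'
          · subst hxy
            by_cases hyx : y = x'
            · subst hyx
              refine ⟨fun k => if k = y then q else 1, ?_, ?_⟩
              · simp [h]
              · simp [h]
                intro h2
                apply q_sq_ne_one
                rw [sq]; exact h2.symm
            · refine ⟨fun k => if k = y then q else if k = x' then 0 else 1, ?_, ?_⟩
              · simp [h, h'.symm]
              · simp [h, h'.symm, Ne.symm hyx]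
          · refine ⟨fun k => if k = y' then 1 else 0, ?_, ?_⟩
            · simp [hy, hxy]
            · simp [h'])
    by_contra hne
    have hr0 : r ≠ 0 := by
      rintro rfl
      exact hne (by rw [hr, mul_zero])
    have hd := hrd hr0
    rw [Finset.offDiag_card, Finset.card_univ, hA] at hd
    rw [Nat.mul_sub, mul_one] at hPd
    have hrt : r.totalDegree = 0 := by omega
    rw [totalDegree_eq_zero_iff_eq_C] at hrt
    have he : eval (fun _ => q⁻¹) P = 0 := by
      rw [hPe, ← h0]
      congr 2
      funext k
      by_cases hk : k < f k
      · simp only [g, hk, dif_pos, if_true, eval_X]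
      · simp only [g, hk, dif_neg, if_false, not_false_eq_true, map_mul, eval_C, eval_X]
        rw [sq, mul_assoc, mul_inv_cancel₀ q_ne_zero, mul_one]
    rw [hr, map_mul, mul_eq_zero] at he
    rcases he with he | he
    · rw [map_prod, Finset.prod_eq_zero_iff] at he
      obtain ⟨t, _, ht⟩ := he
      simp only [map_sub, map_mul, eval_X, eval_C, mul_inv_cancel₀ q_ne_zero] at ht
      apply q_sq_ne_one
      rw [← q_inv]
      exact sub_eq_zero.1 ht
    · rw [hrt, eval_C] at he
      apply hr0
      rw [hrt, he, C_0]
  intro z hz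
  have : z = fun k => eval (fun a : A => z a.1) (g k) := by
    funext k
    by_cases hk : k < f k
    · exact (hgA (fun a : A => z a.1) ⟨k, hk⟩).symm
    · have h1 := hgB (fun a : A => z a.1) ⟨f k, hop k hk⟩
      simp only [hf.invol] at h1
      rw [h1]
      have := hz (f k) (hop k hk)
      rwa [hf.invol] at this
  rw [this, ← hPe, hP0, map_zero]

lemma isWheel_iff (n : ℕ) (p : MvPolynomial (Fin (2 * n)) ℂ) :
    IsWheel n p ↔ p.IsHomogeneous (n * (n - 1)) ∧ WheelFn p := by
  unfold IsWheel WheelFn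
  apply and_congr_right
  intro _
  constructor
  · intro h i j k hij hjk z hj hk
    have := congrArg (eval z) (h i j k hij hjk)
    rw [eval_aeval', map_zero] at this
    rw [← this]
    congr 2
    funext l
    split_ifs with h1 h2
    · subst h1; simp [hj]
    · subst h2; simp [hk]
    · simp
  · intro h i j k hij hjk
    apply MvPolynomial.funext
    intro z
    rw [eval_aeval', map_zero]
    apply h i j k hij hjk
    · simp [hij.ne, (hij.trans hjk).ne]
    · simp [hij.ne, hjk.ne', (hij.trans hjk).ne]

lemma wheel_unique (n : ℕ) (p : MvPolynomial (Fin (2 * n)) ℂ) (hp : IsWheel n p)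
    (h : ∀ σ : NCM n, evalNC p σ = 0) : p = 0 := by
  obtain ⟨hh, hw⟩ := (isWheel_iff n p).1 hp
  have hd := hh.totalDegree_le
  refine wheel_zero n (Fin (2 * n)) (by simp) p hw hd (Or.inr ?_)
  intro f hf hnc
  exact vanish_VV (n := n) (by simp) p hw hd hf hnc (h ⟨f, hf.invol, hf.nofix, hnc⟩)

section existence

lemma hom_factor {σ : Type} (l g p : MvPolynomial σ ℂ) (D : ℕ) (hl : l.IsHomogeneous 1)
    (hp : p.IsHomogeneous (D + 1)) (h : p = l * g) : p = l * homogeneousComponent D g := by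
  let _ := MvPolynomial.gradedAlgebra (σ := σ) (R := ℂ)
  have h1 := DirectSum.coe_decompose_mul_add_of_left_mem (homogeneousSubmodule σ ℂ)
    (i := 1) (j := D) (a := l) (b := g) hl
  have h2 : ((DirectSum.decompose (homogeneousSubmodule σ ℂ) (l * g)) (1 + D) : MvPolynomial σ ℂ)
      = homogeneousComponent (1 + D) (l * g) := decomposition.decompose'_apply _ _
  have h3 : ((DirectSum.decompose (homogeneousSubmodule σ ℂ) g) D : MvPolynomial σ ℂ)
      = homogeneousComponent D g := decomposition.decompose'_apply _ _
  rw [h2, h3, ← h, add_comm 1 D, homogeneousComponent_of_mem hp, if_pos rfl] at h1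
  exact h1

lemma hom_form {σ : Type} (i j : σ) (a : ℂ) :
    (X j - C a * X i : MvPolynomial σ ℂ).IsHomogeneous 1 := by
  apply IsHomogeneous.sub (isHomogeneous_X _ _)
  have := (isHomogeneous_C σ a).mul (isHomogeneous_X ℂ i)
  simpa using this

lemma exists_T {N D : ℕ} (p : MvPolynomial (Fin N) ℂ) (a b : Fin N) (hab : a ≠ b)
    (hp : p.IsHomogeneous D) : ∃ t : MvPolynomial (Fin N) ℂ, t.IsHomogeneous D ∧
      (∀ z, z b = q ^ 2 * z a → eval z t = 0) ∧
      ∀ z, (z a - z b) * eval z t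
        = (z b - q ^ 2 * z a) * (eval z p - eval (z ∘ Equiv.swap a b) p) := by
  have hdv : X a - X b ∣ p - rename (Equiv.swap a b) p := by
    rw [form_dvd_iff' (free_X hab.symm)]
    intro z hz
    rw [map_sub, eval_rename, sub_eq_zero]
    congr 2
    funext k
    simp only [eval_X] at hz
    simp only [Function.comp, Equiv.swap_apply_def]
    split_ifs with h1 h2
    · rw [h1, hz]
    · rw [h2, hz]
    · rfl
  obtain ⟨g, hg⟩ := hdv
  have hh : (p - rename (Equiv.swap a b) p).IsHomogeneous D := hp.sub hp.rename_isHomogeneous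
  cases D with
  | zero =>
    refine ⟨0, isHomogeneous_zero _ _ _, by simp, ?_⟩
    intro z
    rw [← totalDegree_zero_iff_isHomogeneous, totalDegree_eq_zero_iff_eq_C] at hp
    rw [hp]
    simp
  | succ D =>
    have h1 : (X a - X b : MvPolynomial (Fin N) ℂ).IsHomogeneous 1 :=
      (isHomogeneous_X _ _).sub (isHomogeneous_X _ _)
    have h2 := hom_factor _ g _ D h1 hh hg
    refine ⟨(X b - C (q ^ 2) * X a) * homogeneousComponent D g, ?_, ?_, ?_⟩
    · rw [add_comm]
      exact (hom_form a b _).mul (homogeneousComponent_isHomogeneous _ _)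
    · intro z hz
      rw [map_mul, map_sub, map_mul, eval_C, eval_X, eval_X, hz, sub_self, zero_mul]
    · intro z
      have h3 := congrArg (eval z) h2
      simp only [map_sub, map_mul, eval_X, eval_rename] at h3
      rw [h3]
      simp only [map_mul, map_sub, eval_X, eval_C]
      ring

lemma swap_lt {N : ℕ} {a b : Fin N} (hab : a.val + 1 = b.val) {x y : Fin N} (hxy : x < y)
    (h : ¬ (x = a ∧ y = b)) : Equiv.swap a b x < Equiv.swap a b y := by
  simp only [Equiv.swap_apply_def]
  split_ifs <;> simp only [Fin.lt_def, Fin.ext_iff] at * <;> omega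

/-- conjugation of a matching by a transposition -/
def cj {N : ℕ} (a b : Fin N) (f : Fin N → Fin N) : Fin N → Fin N :=
  fun k => Equiv.swap a b (f (Equiv.swap a b k))

lemma cj_PM {N : ℕ} (a b : Fin N) {f : Fin N → Fin N} (hf : PM f) : PM (cj a b f) := by
  constructor
  · intro k; simp [cj, hf.invol]
  · intro k h
    apply hf.nofix (Equiv.swap a b k)
    have := congrArg (Equiv.swap a b) h
    simpa [cj] using this

lemma cj_op {N : ℕ} {a b : Fin N} (hab : a.val + 1 = b.val) {f : Fin N → Fin N} (hf : PM f)
    (hne : f a ≠ b) (k : Fin N) :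
    k < cj a b f k ↔ Equiv.swap a b k < f (Equiv.swap a b k) := by
  unfold cj
  constructor
  · intro h
    have := swap_lt hab h (by
      rintro ⟨rfl, h2⟩
      rw [Equiv.swap_apply_left, Equiv.swap_apply_eq_iff, Equiv.swap_apply_right] at h2
      apply hne
      rw [← h2, hf.invol])
    simpa using this
  · intro h
    have := swap_lt hab h (by
      rintro ⟨h1, h2⟩
      rw [h1] at h2
      exact hne h2)
    simpa using this

/-- sum of the opening positions -/
def dd {N : ℕ} (f : Fin N → Fin N) : ℕ := ∑ k, if k < f k then (k : ℕ) else 0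

lemma dd_cj {N : ℕ} {a b : Fin N} (hab : a.val + 1 = b.val) {f : Fin N → Fin N} (hf : PM f)
    (hne : f a ≠ b) :
    dd (cj a b f) = ∑ k, if k < f k then ((Equiv.swap a b k : Fin N) : ℕ) else 0 := by
  unfold dd
  rw [← Equiv.sum_comp (Equiv.swap a b)]
  apply Finset.sum_congr rfl
  intro k _
  simp only [cj_op hab hf hne, Equiv.swap_apply_self]

lemma dd_le {N : ℕ} {a b : Fin N} (hab : a.val + 1 = b.val) {f : Fin N → Fin N} (hf : PM f)
    (hne : f a ≠ b) : dd f ≤ dd (cj a b f) + 1 := by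
  have h1 : (∑ k : Fin N, if k = b then 1 else 0) = 1 := by simp
  rw [dd_cj hab hf hne, ← h1, ← Finset.sum_add_distrib]
  apply Finset.sum_le_sum
  intro k _
  simp only [Equiv.swap_apply_def]
  split_ifs <;> simp only [Fin.ext_iff] at * <;> omega

lemma dd_eq {N : ℕ} {a b : Fin N} (hab : a.val + 1 = b.val) {f : Fin N → Fin N} (hf : PM f)
    (hne : f a ≠ b) (ha : ¬ a < f a) (hb : b < f b) : dd f = dd (cj a b f) + 1 := by
  have h1 : (∑ k : Fin N, if k = b then 1 else 0) = 1 := by simp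
  rw [dd_cj hab hf hne, ← h1, ← Finset.sum_add_distrib]
  apply Finset.sum_congr rfl
  intro k _
  by_cases hka : k = a
  · subst hka
    have : k ≠ b := by rintro rfl; omega
    simp [ha, this]
  · by_cases hkb : k = b
    · subst hkb
      simp [hb, hab]
    · simp [Equiv.swap_apply_of_ne_of_ne hka hkb, hkb]

/-- the evaluation point of a matching -/
noncomputable def pt {N : ℕ} (f : Fin N → Fin N) : Fin N → ℂ := fun k => if k < f k then q⁻¹ else q

lemma pt_mem {N : ℕ} {f : Fin N → Fin N} (hf : PM f) : pt f ∈ VV f := by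
  intro k hk
  unfold pt
  rw [hf.invol, if_pos hk, if_neg (not_lt_of_gt hk), sq, mul_assoc, mul_inv_cancel₀ q_ne_zero,
    mul_one]

/-- triangularity property -/
def Good (n : ℕ) (σ : Fin (2 * n) → Fin (2 * n)) (p : MvPolynomial (Fin (2 * n)) ℂ) : Prop :=
  IsWheel n p ∧
  (∀ f, PM f → dd σ ≤ dd f → (¬ ∀ k, (k < f k ↔ k < σ k)) → ∀ z ∈ VV f, eval z p = 0) ∧
  eval (pt σ) p ≠ 0

lemma good_step {n : ℕ} {σ : Fin (2 * n) → Fin (2 * n)} (hσ : PM σ) {a b : Fin (2 * n)}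
    (hab : a.val + 1 = b.val) (ha : ¬ a < σ a) (hb : b < σ b) {p : MvPolynomial (Fin (2 * n)) ℂ}
    (hp : Good n (cj a b σ) p) : ∃ t, Good n σ t := by
  obtain ⟨hwh, hv, hne⟩ := hp
  obtain ⟨hh, hw⟩ := (isWheel_iff n p).1 hwh
  have haltb : a < b := by rw [Fin.lt_def]; omega
  have hanb : a ≠ b := haltb.ne
  have hσab : σ a ≠ b := by
    intro h
    rw [h] at ha
    exact ha haltb
  obtain ⟨t, hth, ht0, htm⟩ := exists_T p a b hanb hh
  have hdd := dd_eq hab hσ hσab ha hb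
  refine ⟨t, (isWheel_iff n t).2 ⟨hth, ?_⟩, ?_, ?_⟩
  · intro i j k hij hjk z hzj hzk
    by_cases h1 : i = a ∧ j = b
    · apply ht0
      rw [← h1.1, ← h1.2, hzj]
    by_cases h2 : j = a ∧ k = b
    · apply ht0
      rw [← h2.1, ← h2.2, hzj, hzk]
      ring
    have h3 : ¬ (i = a ∧ k = b) := by
      rintro ⟨rfl, rfl⟩
      rw [Fin.lt_def] at hij hjk
      omega
    refine cancel_on {z | z j = q ^ 2 * z i ∧ z k = q ^ 4 * z i} ?_ (X a - X b) t
      (fun x => if x = i then 1 else if x = j then q ^ 2 else if x = k then q ^ 4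
        else ((x.val + 2 : ℕ) : ℂ)) ?_ ?_ ?_ z ⟨hzj, hzk⟩
    · rintro z ⟨h1, h2⟩ u ⟨h3, h4⟩ t
      simp only [Set.mem_ofPred_eq, h1, h2, h3, h4]
      constructor <;> ring
    · simp only [Set.mem_ofPred_eq, hij.ne', (hij.trans hjk).ne', hjk.ne', if_true, if_false]
      constructor <;> ring
    · rw [map_sub, eval_X, eval_X, sub_ne_zero]
      apply norm_q_ne
      have e1 : ∀ x : Fin (2 * n), ‖(if x = i then (1 : ℂ) else if x = j then q ^ 2
          else if x = k then q ^ 4 else ((x.val + 2 : ℕ) : ℂ))‖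
          = ((if x = i ∨ x = j ∨ x = k then 1 else x.val + 2 : ℕ) : ℝ) := by
        intro x
        by_cases hi : x = i
        · simp [hi]
        by_cases hj : x = j
        · subst hj; simp [hi, q_norm]
        by_cases hk : x = k
        · subst hk; simp [hi, hj, q_norm]
        simp only [hi, hj, hk, if_false, or_self, Complex.norm_natCast]
      rw [e1, e1]
      intro he
      rw [Nat.cast_inj] at he
      simp only [Fin.lt_def, Fin.ext_iff] at *
      split_ifs at he <;> omega
    · rintro z ⟨hz1, hz2⟩
      rw [map_sub, eval_X, eval_X, htm, hw i j k hij hjk z hz1 hz2,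
        hw _ _ _ (swap_lt hab hij h1) (swap_lt hab hjk h2) (z ∘ Equiv.swap a b)
          (by simpa using hz1) (by simpa using hz2)]
      ring
  · intro f hf hdf hop
    by_cases hfab : f a = b
    · intro z hz
      apply ht0
      have := hz a (by rw [hfab]; exact haltb)
      rwa [hfab] at this
    have hdf' := dd_le hab hf hfab
    refine cancel_on (VV f) (VV_line f) (X a - X b) t
      (fun x => if x < f x then ((x.val + 2 : ℕ) : ℂ) else q ^ 2 * (((f x).val + 2 : ℕ) : ℂ))
      ?_ ?_ ?_
    · intro k hk
      simp only [hf.invol, hk, not_lt_of_gt hk, if_true, if_false]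
    · rw [map_sub, eval_X, eval_X, sub_ne_zero]
      apply norm_q_ne
      have e1 : ∀ x : Fin (2 * n), ‖(if x < f x then ((x.val + 2 : ℕ) : ℂ)
          else q ^ 2 * (((f x).val + 2 : ℕ) : ℂ))‖
          = (((if x < f x then x else f x).val + 2 : ℕ) : ℝ) := by
        intro x
        split_ifs
        · rw [Complex.norm_natCast]
        · rw [norm_mul, norm_pow, q_norm, one_pow, one_mul, Complex.norm_natCast]
      rw [e1, e1]
      intro he
      rw [Nat.cast_inj, Nat.add_right_cancel_iff, Fin.val_inj] at he
      split_ifs at he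
      · exact hanb he
      · exact hfab (by rw [he, hf.invol])
      · exact hfab he
      · apply hanb
        rw [← hf.invol a, he, hf.invol]
    · intro z hz
      have hz1 : eval z p = 0 := by
        refine hv f hf (by omega) ?_ z hz
        intro hall
        have : dd f = dd (cj a b σ) := by
          unfold dd
          apply Finset.sum_congr rfl
          intro k _
          simp only [hall k]
        omega
      have hz2 : eval (z ∘ Equiv.swap a b) p = 0 := by
        refine hv (cj a b f) (cj_PM a b hf) (by omega) ?_ _ ?_
        · intro hall
          apply hop
          intro k
          have := hall (Equiv.swap a b k)
          rw [cj_op hab hf hfab, cj_op hab hσ hσab] at this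
          simpa using this
        · intro k hk
          rw [cj_op hab hf hfab] at hk
          have := hz _ hk
          simpa [cj] using this
      rw [map_sub, eval_X, eval_X, htm, hz1, hz2]
      ring
  · intro h0
    have hm := htm (pt σ)
    have hz1 : eval (pt σ) p = 0 := by
      refine hv σ hσ (by omega) ?_ _ (pt_mem hσ)
      intro hall
      have : dd σ = dd (cj a b σ) := by
        unfold dd
        apply Finset.sum_congr rfl
        intro k _
        simp only [hall k]
      omega
    have hz2 : pt σ ∘ Equiv.swap a b = pt (cj a b σ) := by
      funext k
      simp only [Function.comp, pt, cj_op hab hσ hσab]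
    rw [h0, hz1, hz2, mul_zero, zero_sub, eq_comm, mul_eq_zero] at hm
    rcases hm with hm | hm
    · simp only [pt, ha, hb, if_true, if_false, q_inv] at hm
      apply q_sq_ne_one
      linear_combination hm + q_cube
    · exact hne (neg_eq_zero.1 hm)

lemma good_base {n : ℕ} {σ : Fin (2 * n) → Fin (2 * n)}
    (hop : ∀ k : Fin (2 * n), k < σ k ↔ k.val < n) : ∃ p, Good n σ p := by
  let lo : Fin n → Fin (2 * n) := fun x => ⟨x.val, by omega⟩
  let hi : Fin n → Fin (2 * n) := fun x => ⟨n + x.val, by omega⟩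
  let p : MvPolynomial (Fin (2 * n)) ℂ :=
    ∏ t ∈ Finset.univ.filter (fun t : Fin n × Fin n => t.1 < t.2),
      ((X (lo t.2) - C (q ^ 2) * X (lo t.1)) * (X (hi t.2) - C (q ^ 2) * X (hi t.1)))
  have hv : ∀ x y : Fin (2 * n), x < y → (y.val < n ∨ n ≤ x.val) → ∀ z : Fin (2 * n) → ℂ,
      z y = q ^ 2 * z x → eval z p = 0 := by
    intro x y hxy hc z hz
    simp only [p]
    rw [map_prod, Finset.prod_eq_zero_iff]
    rw [Fin.lt_def] at hxy
    rcases hc with hc | hc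
    · refine ⟨(⟨x.val, by omega⟩, ⟨y.val, hc⟩), by simpa using hxy, ?_⟩
      simp only [lo, map_mul, map_sub, eval_X, eval_C, Fin.eta]
      rw [hz, sub_self, zero_mul]
    · refine ⟨(⟨x.val - n, by omega⟩, ⟨y.val - n, by omega⟩), ?_, ?_⟩
      · simp only [Finset.mem_filter, Finset.mem_univ, true_and, Fin.mk_lt_mk]
        omega
      · have e1 : n + (x.val - n) = x.val := by omega
        have e2 : n + (y.val - n) = y.val := by omega
        simp only [hi, map_mul, map_sub, eval_X, eval_C, e1, e2, Fin.eta]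
        rw [hz, sub_self, mul_zero]
  refine ⟨p, (isWheel_iff n p).2 ⟨?_, ?_⟩, ?_, ?_⟩
  · have h1 : p.IsHomogeneous (∑ t ∈ Finset.univ.filter (fun t : Fin n × Fin n => t.1 < t.2),
        (1 + 1)) := by
      apply IsHomogeneous.prod
      intro t _
      exact (hom_form _ _ _).mul (hom_form _ _ _)
    have h2 := card_lt_pairs (Fin n)
    rw [Fintype.card_fin] at h2
    rw [← h2]
    rw [Finset.sum_const, smul_eq_mul] at h1
    convert h1 using 1
    omega
  · intro i j k hij hjk z hj hk
    by_cases h : j.val < n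
    · exact hv i j hij (Or.inl h) z hj
    · refine hv j k hjk (Or.inr (by omega)) z ?_
      rw [hk, hj]; ring
  · intro f hf _ hne z hz
    by_contra h0
    apply hne
    have harc : ∀ k, k < f k → k.val < n ∧ n ≤ (f k).val := by
      intro k hk
      by_contra hcon
      apply h0
      refine hv k (f k) hk ?_ z (hz k hk)
      rw [Fin.lt_def] at hk
      omega
    intro k
    rw [hop]
    constructor
    · intro hk
      exact (harc k hk).1
    · intro hk
      by_contra hcon
      have h1 : f k < f (f k) := by
        rw [hf.invol]; exact lt_of_le_of_ne (not_lt.1 hcon) (hf.nofix _)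
      have h2 := (harc _ h1).2
      rw [hf.invol] at h2
      omega
  · simp only [p]
    rw [map_prod, Finset.prod_ne_zero_iff]
    intro t _
    have e1 : ∀ x, pt σ (lo x) = q ^ 2 := by
      intro x
      have : lo x < σ (lo x) := (hop _).2 x.2
      rw [pt, if_pos this, q_inv]
    have e2 : ∀ x, pt σ (hi x) = q := by
      intro x
      have : ¬ hi x < σ (hi x) := by
        rw [hop]; simp [hi]
      rw [pt, if_neg this]
    simp only [map_mul, map_sub, eval_X, eval_C, e1, e2]
    apply mul_ne_zero
    · intro h
      apply q_sq_ne_one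
      linear_combination -q * h + (1 - q ^ 2) * q_cube
    · intro h
      apply q_ne_one
      linear_combination h + q_cube

lemma good_exists {n : ℕ} (D : ℕ) : ∀ σ : Fin (2 * n) → Fin (2 * n), PM σ → dd σ = D →
    ∃ p, Good n σ p := by
  induction D using Nat.strong_induction_on with
  | _ D IH =>
  intro σ hσ hD
  by_cases hval : ∃ a b : Fin (2 * n), a.val + 1 = b.val ∧ ¬ a < σ a ∧ b < σ b
  · obtain ⟨a, b, hab, ha, hb⟩ := hval
    have hσab : σ a ≠ b := by
      intro h
      rw [h, Fin.lt_def] at ha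
      omega
    have hdd := dd_eq hab hσ hσab ha hb
    obtain ⟨p, hp⟩ := IH (dd (cj a b σ)) (by omega) _ (cj_PM a b hσ) rfl
    exact good_step hσ hab ha hb hp
  · push Not at hval
    have hdown : ∀ d : ℕ, ∀ a b : Fin (2 * n), a.val + d = b.val → b < σ b → a < σ a := by
      intro d
      induction d with
      | zero =>
        intro a b h hb
        have : a = b := Fin.ext (by omega)
        rwa [this]
      | succ d ih =>
        intro a b h hb
        by_contra ha
        have hb' := ih ⟨a.val + 1, by omega⟩ b (by simp; omega) hb
        have := hval a ⟨a.val + 1, by omega⟩ rfl (by simpa using ha)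
        exact absurd hb' (not_lt.2 this)
    have hcard := openings_card (n := n) (by simp) hσ
    rw [Fintype.card_subtype] at hcard
    apply good_base
    intro k
    constructor
    · intro hk
      have hsub : Finset.Iic k ⊆ Finset.univ.filter (fun k => k < σ k) := by
        intro x hx
        rw [Finset.mem_Iic, Fin.le_def] at hx
        simp only [Finset.mem_filter, Finset.mem_univ, true_and]
        exact hdown (k.val - x.val) x k (by omega) hk
      have := Finset.card_le_card hsub
      rw [hcard, Fin.card_Iic] at this
      omega
    · intro hk
      by_contra hcon
      have hsub : Finset.univ.filter (fun k => k < σ k) ⊆ Finset.Iio k := by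
        intro x hx
        simp only [Finset.mem_filter, Finset.mem_univ, true_and] at hx
        rw [Finset.mem_Iio]
        by_contra hx2
        rw [not_lt, Fin.le_def] at hx2
        exact hcon (hdown (x.val - k.val) k x (by omega) hx)
      have := Finset.card_le_card hsub
      rw [hcard, Fin.card_Iio] at this
      omega

lemma ncm_pm {n : ℕ} (σ : NCM n) : PM σ.f := ⟨σ.invol, σ.nofix⟩

lemma nc_aux {n : ℕ} (π σ : NCM n) (h : ∀ k, k < π.f k ↔ k < σ.f k) :
    ∀ d : ℕ, ∀ k : Fin (2 * n), k.val + d = 2 * n → k < π.f k → ¬ π.f k < σ.f k := by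
  intro d
  induction d using Nat.strong_induction_on with
  | _ d IH =>
  intro k hkd hk hlt
  -- the partner in `σ` of the point `x = π.f k`
  have hx : ¬ π.f k < σ.f (π.f k) := by
    rw [← h, π.invol]; exact not_lt_of_gt hk
  have hy : σ.f (π.f k) < π.f k := lt_of_le_of_ne (not_lt.1 hx) (σ.nofix _)
  have hky : k < σ.f (π.f k) := by
    by_contra hcon
    rcases lt_or_eq_of_le (not_lt.1 hcon) with h1 | h1
    · exact σ.noncross _ k (π.f k) (σ.f k) h1 hk hlt (σ.invol _) rfl
    · have h2 := congrArg σ.f h1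
      rw [σ.invol] at h2
      exact hlt.ne h2
  have hyo : σ.f (π.f k) < π.f (σ.f (π.f k)) := by
    rw [h, σ.invol]; exact hy
  refine IH (2 * n - (σ.f (π.f k)).val) ?_ (σ.f (π.f k)) (by omega) hyo ?_
  · rw [Fin.lt_def] at hky; omega
  · rw [σ.invol]
    by_contra hcon
    rcases lt_or_eq_of_le (not_lt.1 hcon) with h1 | h1
    · exact π.noncross k _ (π.f k) _ hky hy h1 rfl rfl
    · have h2 := congrArg π.f h1
      rw [π.invol, π.invol] at h2
      rw [← h2] at hky
      exact lt_irrefl _ hky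

lemma nc_ext {n : ℕ} (π σ : NCM n) (h : ∀ k, k < π.f k ↔ k < σ.f k) : π = σ := by
  apply NCM.ext'
  have h1 : ∀ k, k < π.f k → π.f k = σ.f k := by
    intro k hk
    have a1 := nc_aux π σ h (2 * n - k.val) k (by omega) hk
    have a2 := nc_aux σ π (fun k => (h k).symm) (2 * n - k.val) k (by omega) ((h k).1 hk)
    exact le_antisymm (not_lt.1 a2) (not_lt.1 a1)
  funext k
  by_cases hk : k < π.f k
  · exact h1 k hk
  · have h2 : π.f k < π.f (π.f k) := by
      rw [π.invol]; exact lt_of_le_of_ne (not_lt.1 hk) (π.nofix _)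
    have h3 := h1 _ h2
    rw [π.invol] at h3
    have h4 := congrArg σ.f h3
    rw [σ.invol] at h4
    exact h4.symm

lemma isWheel_smul {n : ℕ} {p : MvPolynomial (Fin (2 * n)) ℂ} (c : ℂ) (hp : IsWheel n p) :
    IsWheel n (C c * p) := by
  rw [isWheel_iff] at hp ⊢
  refine ⟨?_, ?_⟩
  · have := (isHomogeneous_C (Fin (2 * n)) c).mul hp.1
    simpa using this
  · intro i j k hij hjk z h1 h2
    rw [map_mul, hp.2 i j k hij hjk z h1 h2, mul_zero]

lemma isWheel_sub {n : ℕ} {p p' : MvPolynomial (Fin (2 * n)) ℂ} (hp : IsWheel n p)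
    (hp' : IsWheel n p') : IsWheel n (p - p') := by
  rw [isWheel_iff] at hp hp' ⊢
  refine ⟨hp.1.sub hp'.1, ?_⟩
  intro i j k hij hjk z h1 h2
  rw [map_sub, hp.2 i j k hij hjk z h1 h2, hp'.2 i j k hij hjk z h1 h2, sub_zero]

lemma isWheel_sum {n : ℕ} {τ : Type} (s : Finset τ) (P : τ → MvPolynomial (Fin (2 * n)) ℂ)
    (hP : ∀ t ∈ s, IsWheel n (P t)) : IsWheel n (∑ t ∈ s, P t) := by
  rw [isWheel_iff]
  refine ⟨IsHomogeneous.sum _ _ _ fun t ht => ((isWheel_iff _ _).1 (hP t ht)).1, ?_⟩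
  intro i j k hij hjk z h1 h2
  rw [map_sum]
  apply Finset.sum_eq_zero
  intro t ht
  exact ((isWheel_iff _ _).1 (hP t ht)).2 i j k hij hjk z h1 h2

lemma dual_exists {n : ℕ} (D : ℕ) : ∀ σ : NCM n, dd σ.f = D →
    ∃ p, IsWheel n p ∧ ∀ ρ : NCM n, evalNC p ρ = if ρ = σ then 1 else 0 := by
  induction D using Nat.strong_induction_on with
  | _ D IH =>
  intro σ hD
  obtain ⟨p, hpw, hpv, hpn⟩ := good_exists _ σ.f (ncm_pm σ) rfl
  have hne : evalNC p σ ≠ 0 := hpn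
  have hpz : ∀ ρ : NCM n, D ≤ dd ρ.f → ρ ≠ σ → evalNC p ρ = 0 := by
    intro ρ hρ hρσ
    refine hpv ρ.f (ncm_pm ρ) (by omega) ?_ _ (pt_mem (ncm_pm ρ))
    intro hall
    exact hρσ (nc_ext ρ σ hall)
  have hlow : ∀ ρ : NCM n, ∃ p, dd ρ.f < D →
      IsWheel n p ∧ ∀ τ : NCM n, evalNC p τ = if τ = ρ then 1 else 0 := by
    intro ρ
    by_cases h : dd ρ.f < D
    · obtain ⟨p, hp⟩ := IH _ h ρ rfl
      exact ⟨p, fun _ => hp⟩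
    · exact ⟨0, fun h' => absurd h' h⟩
  choose Ψ hΨ using hlow
  let s : Finset (NCM n) := Finset.univ.filter (fun ρ => dd ρ.f < D)
  refine ⟨C (evalNC p σ)⁻¹ * (p - ∑ ρ ∈ s, C (evalNC p ρ) * Ψ ρ), ?_, ?_⟩
  · apply isWheel_smul
    apply isWheel_sub hpw
    apply isWheel_sum
    intro ρ hρ
    exact isWheel_smul _ (hΨ ρ (Finset.mem_filter.1 hρ).2).1
  · intro τ
    have e1 : evalNC (C (evalNC p σ)⁻¹ * (p - ∑ ρ ∈ s, C (evalNC p ρ) * Ψ ρ)) τ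
        = (evalNC p σ)⁻¹ * (evalNC p τ - ∑ ρ ∈ s, evalNC p ρ * evalNC (Ψ ρ) τ) := by
      simp only [evalNC, map_mul, map_sub, map_sum, eval_C]
    have e2 : ∑ ρ ∈ s, evalNC p ρ * evalNC (Ψ ρ) τ = if τ ∈ s then evalNC p τ else 0 := by
      rw [← Finset.sum_ite_eq s τ (fun ρ => evalNC p ρ)]
      apply Finset.sum_congr rfl
      intro ρ hρ
      rw [(hΨ ρ (Finset.mem_filter.1 hρ).2).2 τ]
      split_ifs <;> simp
    rw [e1, e2]
    by_cases hτ : τ = σ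
    · subst hτ
      have : τ ∉ s := by simp [s, hD]
      rw [if_neg this, if_pos rfl, sub_zero, inv_mul_cancel₀ hne]
    · rw [if_neg hτ]
      by_cases hs : τ ∈ s
      · rw [if_pos hs, sub_self, mul_zero]
      · have : D ≤ dd τ.f := by simpa [s] using hs
        rw [if_neg hs, hpz τ this hτ, sub_zero, mul_zero]

end existence

end QKZ

/-- Existence and uniqueness of the qKZ basis: there is a unique family
`(Ψ_π)_{π ∈ NC_n}` of wheel polynomials with `Ψ_π(σ) = δ_{π,σ}`. -/
theorem qKZ_basis_exists_unique (n : ℕ) (hn : 1 ≤ n) :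
    ∃! Ψ : NCM n → MvPolynomial (Fin (2 * n)) ℂ,
      (∀ π, IsWheel n (Ψ π)) ∧
      ∀ π σ : NCM n, evalNC (Ψ π) σ = if σ = π then 1 else 0 := by
  choose Ψ hΨ using fun π : NCM n => QKZ.dual_exists (n := n) _ π rfl
  refine ⟨Ψ, ⟨fun π => (hΨ π).1, fun π σ => (hΨ π).2 σ⟩, ?_⟩
  rintro Φ ⟨h1, h2⟩
  funext π
  rw [← sub_eq_zero]
  apply QKZ.wheel_unique n _ (QKZ.isWheel_sub (h1 π) (hΨ π).1)
  intro σ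
  have e1 : evalNC (Φ π - Ψ π) σ = evalNC (Φ π) σ - evalNC (Ψ π) σ := by
    simp only [evalNC, map_sub]
  rw [e1, h2, (hΨ π).2, sub_self]
end
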